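/- Let n ≥ 5, a ≥ 0 and p > 1 with p ≠ (n+4+2a)/(n-4), and suppose that either p < (n+4+2a)/(n-4), or p > (n+4+2a)/(n-4) together with p·ℓ₁ > n(n-4)/2 and p·ℓ₂ > n²(n-4)²/16. If u is a smooth solution of Δ²u = |x|^a |u|^{p-1} u on ℝ^n that is stable outside some compact set of ℝ^n, then u ≡ 0. -/

import Mathlib

open MeasureTheory Metric Set Filter
open scoped RealInnerProductSpace Topology

noncomputable section

/-- The Laplacian of `u : ℝⁿ → ℝ` at `x`, as the sum of the pure second
partial derivatives in the coordinate directions. -/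
def lap (n : ℕ) (u : EuclideanSpace ℝ (Fin n) → ℝ) (x : EuclideanSpace ℝ (Fin n)) : ℝ :=
  ∑ i : Fin n, iteratedFDeriv ℝ 2 u x ![EuclideanSpace.single i 1, EuclideanSpace.single i 1]

/-- `u` solves `Δ²u = |x|^a |u|^(p-1) u` pointwise on `Ω`. -/
def IsSolutionOn (n : ℕ) (a p : ℝ) (u : EuclideanSpace ℝ (Fin n) → ℝ)
    (Ω : Set (EuclideanSpace ℝ (Fin n))) : Prop :=
  ∀ x ∈ Ω, lap n (lap n u) x = ‖x‖ ^ a * |u x| ^ (p - 1) * u x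

/-- `u` is a stable solution on `Ω`:
`p ∫ |x|^a |u|^(p-1) ψ² ≤ ∫ (Δψ)²` for every test function `ψ ∈ C_c^∞(Ω)`. -/
def StableOn (n : ℕ) (a p : ℝ) (u : EuclideanSpace ℝ (Fin n) → ℝ)
    (Ω : Set (EuclideanSpace ℝ (Fin n))) : Prop :=
  ∀ ψ : EuclideanSpace ℝ (Fin n) → ℝ, ContDiff ℝ (⊤ : ℕ∞) ψ → HasCompactSupport ψ →
    tsupport ψ ⊆ Ω →
    p * ∫ x, ‖x‖ ^ a * |u x| ^ (p - 1) * ψ x ^ 2 ≤ ∫ x, lap n ψ x ^ 2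

/-- Surface integral of `f` over the sphere `∂B_r(x)`, with respect to the
`(n-1)`-dimensional Hausdorff measure. -/
def sphInt (n : ℕ) (x : EuclideanSpace ℝ (Fin n)) (r : ℝ)
    (f : EuclideanSpace ℝ (Fin n) → ℝ) : ℝ :=
  ∫ y in sphere x r, f y ∂(Measure.hausdorffMeasure ((n : ℝ) - 1))

/-- Radial derivative of `u` at `y`, relative to the center `x`. -/
def radDeriv (n : ℕ) (x : EuclideanSpace ℝ (Fin n))
    (u : EuclideanSpace ℝ (Fin n) → ℝ) (y : EuclideanSpace ℝ (Fin n)) : ℝ :=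
  ⟪gradient u y, ‖y - x‖⁻¹ • (y - x)⟫

/-- `ℓ₁ = (β+2)(n-4-β) + β(n-2-β)` with `β = (4+a)/(p-1)`. -/
def ell1 (n : ℕ) (a p : ℝ) : ℝ :=
  let β : ℝ := (4 + a) / (p - 1)
  (β + 2) * ((n : ℝ) - 4 - β) + β * ((n : ℝ) - 2 - β)

/-- `ℓ₂ = β(β+2)(n-4-β)(n-2-β)` with `β = (4+a)/(p-1)`. -/
def ell2 (n : ℕ) (a p : ℝ) : ℝ :=
  let β : ℝ := (4 + a) / (p - 1)
  β * (β + 2) * ((n : ℝ) - 4 - β) * ((n : ℝ) - 2 - β)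

/-- The constant `c(n,p,a) = 2(ρ - γ - 1)`, `ρ = n-1-2β`, `γ = β(β-n+2)`. -/
def cConst (n : ℕ) (a p : ℝ) : ℝ :=
  let β : ℝ := (4 + a) / (p - 1)
  2 * (((n : ℝ) - 1 - 2 * β) - β * (β - (n : ℝ) + 2) - 1)

/-- The rescaled energy `E(r; x, u)` from the monotonicity formula. -/
def energyE (n : ℕ) (a p : ℝ) (u : EuclideanSpace ℝ (Fin n) → ℝ)
    (x : EuclideanSpace ℝ (Fin n)) (r : ℝ) : ℝ :=
  let β : ℝ := (4 + a) / (p - 1)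
  r ^ (2 * β + 4 - (n : ℝ)) *
      (∫ y in ball x r,
        (1 / 2) * lap n u y ^ 2 - (1 / (p + 1)) * ‖y‖ ^ a * |u y| ^ (p + 1))
    + β / 2 * ((n : ℝ) - 2 - β) *
        deriv (fun ρ : ℝ => ρ ^ (2 * β + 1 - (n : ℝ)) * sphInt n x ρ fun y => u y ^ 2) r
    + β / 2 * ((n : ℝ) - 2 - β) *
        deriv (fun ρ : ℝ => ρ ^ (2 * β + 2 - (n : ℝ)) * sphInt n x ρ fun y => u y ^ 2) r
    + r ^ 3 / 2 *
        deriv (fun ρ : ℝ => ρ ^ (2 * β + 1 - (n : ℝ)) *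
          sphInt n x ρ fun y => (β * ρ⁻¹ * u y + radDeriv n x u y) ^ 2) r
    + 1 / 2 *
        deriv (fun ρ : ℝ => ρ ^ (2 * β + 4 - (n : ℝ)) *
          sphInt n x ρ fun y => ‖gradient u y‖ ^ 2 - radDeriv n x u y ^ 2) r
    + 1 / 2 * r ^ (2 * β + 3 - (n : ℝ)) *
        (sphInt n x r fun y => ‖gradient u y‖ ^ 2 - radDeriv n x u y ^ 2)

end

open scoped ContDiff

/-- Integration-by-parts calculus on a cylinder: an algebra `S` of smooth functions on a space `X`
with height function `τ`, the derivation `D` in the direction of the axis, derivations `L i`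
tangent to the cross-sections, and an integral `I` for functions vanishing near both ends
(the ideal `c`). -/
structure CylCalc (S X ι : Type) [CommRing S] [Algebra ℝ S] [Fintype ι] where
  D : Derivation ℝ S S
  L : ι → Derivation ℝ S S
  I : S →ₗ[ℝ] ℝ
  c : Ideal S
  ev : X → S →ₐ[ℝ] ℝ
  τ : X → ℝ
  rad : (ℝ → ℝ) → S
  ext : ∀ {g h : S}, (∀ x, ev x g = ev x h) → g = h
  D_L : ∀ i g, D (L i g) = L i (D g)
  D_mem : ∀ {g}, g ∈ c → D g ∈ c
  L_mem : ∀ {i g}, g ∈ c → L i g ∈ c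
  I_D : ∀ {g}, g ∈ c → I (D g) = 0
  I_L : ∀ {i g}, g ∈ c → I (L i g) = 0
  I_nonneg : ∀ {g}, g ∈ c → (∀ x, 0 ≤ ev x g) → 0 ≤ I g
  I_faithful : ∀ {g}, g ∈ c → (∀ x, 0 ≤ ev x g) → I g = 0 → g = 0
  ev_rad : ∀ {f}, ContDiff ℝ ∞ f → ∀ x, ev x (rad f) = f (τ x)
  D_rad : ∀ {f}, ContDiff ℝ ∞ f → D (rad f) = rad (deriv f)
  L_rad : ∀ {f}, ContDiff ℝ ∞ f → ∀ i, L i (rad f) = 0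
  rad_mem : ∀ {f}, ContDiff ℝ ∞ f → HasCompactSupport f → rad f ∈ c
  I_translate : ∀ {f}, ContDiff ℝ ∞ f → HasCompactSupport f → ∀ T : ℝ,
    I (rad fun t => f (t - T)) = I (rad f)

namespace CylCalc

variable {S X ι : Type} [CommRing S] [Algebra ℝ S] [Fintype ι] (A : CylCalc S X ι)

/-- The Laplacian of the cross-sections. -/
def lapS : S →ₗ[ℝ] S := ∑ i, (A.L i : S →ₗ[ℝ] S) ∘ₗ (A.L i : S →ₗ[ℝ] S)

/-- The inner product of the gradients along the cross-sections. -/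
def Γ (g h : S) : S := ∑ i, A.L i g * A.L i h

/-- Functions depending only on the height. -/
def IsRad (f : S) : Prop := ∀ i, A.L i f = 0

lemma lapS_apply (g : S) : A.lapS g = ∑ i, A.L i (A.L i g) := by
  simp [lapS, LinearMap.sum_apply]

lemma D_lapS (g : S) : A.D (A.lapS g) = A.lapS (A.D g) := by
  simp [lapS_apply, A.D_L]

lemma Γ_comm (g h : S) : A.Γ g h = A.Γ h g := by
  simp only [Γ, mul_comm]

lemma Γ_add (g h k : S) : A.Γ (g + h) k = A.Γ g k + A.Γ h k := by
  simp [Γ, add_mul, Finset.sum_add_distrib]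

lemma Γ_add_right (g h k : S) : A.Γ k (g + h) = A.Γ k g + A.Γ k h := by
  simp [Γ, mul_add, Finset.sum_add_distrib]

lemma Γ_smul (r : ℝ) (g h : S) : A.Γ (r • g) h = r • A.Γ g h := by
  simp [Γ, Finset.smul_sum]

lemma Γ_smul_right (r : ℝ) (g h : S) : A.Γ g (r • h) = r • A.Γ g h := by
  simp [Γ, Finset.smul_sum]

lemma ev_Γ_self_nonneg (g : S) (x : X) : 0 ≤ A.ev x (A.Γ g g) := by
  simp only [Γ, map_sum, map_mul]
  exact Finset.sum_nonneg fun i _ => mul_self_nonneg _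

lemma ev_Γ_add_le (g h : S) (x : X) :
    A.ev x (A.Γ (g + h) (g + h)) ≤ 2 * A.ev x (A.Γ g g) + 2 * A.ev x (A.Γ h h) := by
  have := A.ev_Γ_self_nonneg (g + (-1 : ℝ) • h) x
  simp only [Γ_add, Γ_add_right, Γ_smul, Γ_smul_right, map_add, map_smul, smul_eq_mul] at this ⊢
  linarith

variable {A}

lemma IsRad.D {f : S} (hf : A.IsRad f) : A.IsRad (A.D f) := fun i => by
  rw [← A.D_L, hf i, map_zero]

lemma IsRad.mul {f g : S} (hf : A.IsRad f) (hg : A.IsRad g) : A.IsRad (f * g) := fun i => by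
  simp [hf i, hg i]

lemma IsRad.lapS_mul {f : S} (hf : A.IsRad f) (g : S) : A.lapS (f * g) = f * A.lapS g := by
  simp [lapS_apply, hf _, Finset.mul_sum]

lemma IsRad.Γ_mul {f : S} (hf : A.IsRad f) (g h : S) : A.Γ (f * g) h = f * A.Γ g h := by
  simp only [Γ, Derivation.leibniz, hf _, smul_eq_mul, mul_zero, add_zero, Finset.mul_sum,
    mul_assoc]

lemma IsRad.Γ_mul_right {f : S} (hf : A.IsRad f) (g h : S) : A.Γ g (f * h) = f * A.Γ g h := by
  rw [Γ_comm, hf.Γ_mul, Γ_comm]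

lemma isRad_rad {f : ℝ → ℝ} (hf : ContDiff ℝ ∞ f) : A.IsRad (A.rad f) := A.L_rad hf

lemma I_lapS_mul {g h : S} (hc : ∀ i, A.L i g * h ∈ A.c) :
    A.I (A.lapS g * h) = -A.I (A.Γ g h) := by
  rw [lapS_apply, Γ, Finset.sum_mul, map_sum, map_sum, eq_neg_iff_add_eq_zero,
    ← Finset.sum_add_distrib]
  refine Finset.sum_eq_zero fun i _ => ?_
  have := A.I_L (i := i) (hc i)
  rw [Derivation.leibniz, map_add, smul_eq_mul, smul_eq_mul, mul_comm h] at this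
  linarith

lemma I_mul_lapS {F : S} (hF : F ∈ A.c) (hr : A.IsRad F) (g h : S) :
    A.I (F * (A.lapS g * h)) = -A.I (F * A.Γ g h) := by
  rw [← hr.Γ_mul_right, ← I_lapS_mul]
  · ring_nf
  · exact fun i => A.c.mul_mem_left _ (A.c.mul_mem_right _ hF)

/-- `∫ F x' y = -∫ F x y' - ∫ F' x y`. -/
lemma I_parts {F : S} (hF : F ∈ A.c) (x y : S) :
    A.I (F * (A.D x * y)) = -A.I (F * (x * A.D y)) - A.I (A.D F * (x * y)) := by
  have := A.I_D (A.c.mul_mem_right (x * y) hF)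
  simp only [Derivation.leibniz, smul_eq_mul, mul_add, map_add] at this
  rw [mul_comm (A.D x) y, mul_comm (A.D F)]
  linarith

lemma I_D_mul_self {F : S} (hF : F ∈ A.c) (x : S) :
    A.I (F * (A.D x * x)) = -(1 / 2) * A.I (A.D F * x ^ 2) := by
  have := I_parts hF x x
  rw [mul_comm x (A.D x), ← sq] at this
  linarith

lemma I_D2_mul_self {F : S} (hF : F ∈ A.c) (x : S) :
    A.I (F * (A.D (A.D x) * x)) =
      -A.I (F * A.D x ^ 2) + 1 / 2 * A.I (A.D (A.D F) * x ^ 2) := by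
  rw [I_parts hF, I_D_mul_self (A.D_mem hF), ← sq]
  ring

lemma I_D3_mul_self {F : S} (hF : F ∈ A.c) (x : S) :
    A.I (F * (A.D (A.D (A.D x)) * x)) =
      3 / 2 * A.I (A.D F * A.D x ^ 2) - 1 / 2 * A.I (A.D (A.D (A.D F)) * x ^ 2) := by
  rw [I_parts hF, I_D_mul_self hF, I_D2_mul_self (A.D_mem hF)]
  ring

lemma I_D4_mul_self {F : S} (hF : F ∈ A.c) (x : S) :
    A.I (F * (A.D (A.D (A.D (A.D x))) * x)) =
      A.I (F * A.D (A.D x) ^ 2) - 2 * A.I (A.D (A.D F) * A.D x ^ 2) +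
        1 / 2 * A.I (A.D (A.D (A.D (A.D F))) * x ^ 2) := by
  rw [I_parts hF, I_D2_mul_self hF, I_D3_mul_self (A.D_mem hF)]
  ring

lemma I_Γ_D_self {F : S} (hF : F ∈ A.c) (x : S) :
    A.I (F * A.Γ (A.D x) x) = -(1 / 2) * A.I (A.D F * A.Γ x x) := by
  simp only [Γ, Finset.mul_sum, map_sum, ← A.D_L, I_D_mul_self hF, sq]

lemma I_Γ_D2_self {F : S} (hF : F ∈ A.c) (x : S) :
    A.I (F * A.Γ (A.D (A.D x)) x) =
      -A.I (F * A.Γ (A.D x) (A.D x)) + 1 / 2 * A.I (A.D (A.D F) * A.Γ x x) := by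
  simp only [Γ, Finset.mul_sum, map_sum, ← A.D_L, I_D2_mul_self hF, sq,
    Finset.sum_add_distrib, Finset.sum_neg_distrib]

/-- The bilaplacian in cylindrical coordinates. -/
def bilap (A : CylCalc S X ι) (k l₁ l₂ : ℝ) (v : S) : S :=
  A.D (A.D (A.D (A.D v))) + (2 * k) • A.D (A.D (A.D v)) + (k ^ 2 - 4 - l₁) • A.D (A.D v)
    - (k * (l₁ + 4)) • A.D v + l₂ • v
    + ((2 : ℝ) • A.lapS (A.D (A.D v)) + (2 * k) • A.lapS (A.D v) - l₁ • A.lapS v)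
    + A.lapS (A.lapS v)

lemma I_bilap_mul_D {F : S} (hF : F ∈ A.c) (hr : A.IsRad F) (k l₁ l₂ : ℝ) (v : S) :
    A.I (F * (A.bilap k l₁ l₂ v * A.D v)) =
      -(2 * k * A.I (F * A.D (A.D v) ^ 2) + k * (l₁ + 4) * A.I (F * A.D v ^ 2)
        + 2 * k * A.I (F * A.Γ (A.D v) (A.D v)))
      + 3 / 2 * A.I (A.D F * A.D (A.D v) ^ 2) - (k ^ 2 - 4 - l₁) / 2 * A.I (A.D F * A.D v ^ 2)
      - l₂ / 2 * A.I (A.D F * v ^ 2) + A.I (A.D F * A.Γ (A.D v) (A.D v))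
      - l₁ / 2 * A.I (A.D F * A.Γ v v) - 1 / 2 * A.I (A.D F * A.lapS v ^ 2)
      + k * A.I (A.D (A.D F) * A.D v ^ 2)
      - 1 / 2 * A.I (A.D (A.D (A.D F)) * A.D v ^ 2) := by
  have e1 : A.I (F * (A.lapS (A.lapS v) * A.D v)) = -(1 / 2) * A.I (A.D F * A.lapS v ^ 2) := by
    rw [I_mul_lapS hF hr, Γ_comm, ← I_mul_lapS hF hr, ← D_lapS, I_D_mul_self hF]
  have e2 : A.I (F * (A.lapS v * A.D v)) = 1 / 2 * A.I (A.D F * A.Γ v v) := by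
    rw [I_mul_lapS hF hr, Γ_comm, I_Γ_D_self hF]; ring
  have e3 : A.I (F * (v * A.D v)) = -(1 / 2) * A.I (A.D F * v ^ 2) := by
    rw [mul_comm v, I_D_mul_self hF]
  have e4 : A.I (F * (A.D v * A.D v)) = A.I (F * A.D v ^ 2) := by rw [← sq]
  simp only [bilap, add_mul, sub_mul, mul_add, mul_sub, smul_mul_assoc, mul_smul_comm, map_add,
    map_sub, map_smul, smul_eq_mul, e1, e2, e3, e4, I_D_mul_self hF, I_D2_mul_self hF,
    I_D3_mul_self hF, I_mul_lapS hF hr, I_Γ_D_self hF]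
  ring

lemma I_bilap_mul_self {F : S} (hF : F ∈ A.c) (hr : A.IsRad F) (k l₁ l₂ : ℝ) (v : S) :
    A.I (F * (A.bilap k l₁ l₂ v * v)) =
      A.I (F * A.lapS v ^ 2) + l₁ * A.I (F * A.Γ v v) + l₂ * A.I (F * v ^ 2)
      + A.I (F * A.D (A.D v) ^ 2) - (k ^ 2 - 4 - l₁) * A.I (F * A.D v ^ 2)
      + 2 * A.I (F * A.Γ (A.D v) (A.D v))
      + 3 * k * A.I (A.D F * A.D v ^ 2) + k * (l₁ + 4) / 2 * A.I (A.D F * v ^ 2)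
      + k * A.I (A.D F * A.Γ v v)
      - 2 * A.I (A.D (A.D F) * A.D v ^ 2) + (k ^ 2 - 4 - l₁) / 2 * A.I (A.D (A.D F) * v ^ 2)
      - A.I (A.D (A.D F) * A.Γ v v)
      - k * A.I (A.D (A.D (A.D F)) * v ^ 2)
      + 1 / 2 * A.I (A.D (A.D (A.D (A.D F))) * v ^ 2) := by
  have e1 : A.I (F * (A.lapS (A.lapS v) * v)) = A.I (F * A.lapS v ^ 2) := by
    rw [I_mul_lapS hF hr, Γ_comm, ← I_mul_lapS hF hr, ← sq]
  have e4 : A.I (F * (v * v)) = A.I (F * v ^ 2) := by rw [← sq]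
  simp only [bilap, add_mul, sub_mul, mul_add, mul_sub, smul_mul_assoc, mul_smul_comm, map_add,
    map_sub, map_smul, smul_eq_mul, e1, e4, I_D_mul_self hF, I_D2_mul_self hF,
    I_D3_mul_self hF, I_D4_mul_self hF, I_mul_lapS hF hr, I_Γ_D_self hF, I_Γ_D2_self hF]
  ring

/-- The symmetric normalisation of the Laplacian in cylindrical coordinates. -/
def symLap (A : CylCalc S X ι) (c : ℝ) (z : S) : S :=
  A.D (A.D z) + (2 : ℝ) • A.D z - c • z + A.lapS z

/-- Density of the quadratic form of the squared Laplacian. -/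
def quad (A : CylCalc S X ι) (c : ℝ) (z : S) : S :=
  A.D (A.D z) ^ 2 + (4 + 2 * c) • A.D z ^ 2 + c ^ 2 • z ^ 2 + A.lapS z ^ 2
    + (2 * c) • A.Γ z z + (2 : ℝ) • A.Γ (A.D z) (A.D z)


lemma I_symLap_sq {z : S} (hz : z ∈ A.c) (c : ℝ) :
    A.I (A.symLap c z ^ 2) = A.I (A.quad c z) := by
  have hp : ∀ x y : S, x ∈ A.c → A.I (A.D x * y) = -A.I (x * A.D y) := fun x y hx => by
    have := A.I_D (A.c.mul_mem_right y hx)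
    rw [Derivation.leibniz, map_add, smul_eq_mul, smul_eq_mul, mul_comm y] at this
    linarith
  have hl : ∀ x y : S, x ∈ A.c → A.I (A.lapS x * y) = -A.I (A.Γ x y) := fun x y hx =>
    I_lapS_mul fun i => A.c.mul_mem_right _ (A.L_mem hx)
  have hz1 := A.D_mem hz
  have e1 : A.I (A.D (A.D z) * A.D z) = 0 := by
    have := hp _ (A.D z) hz1
    rw [mul_comm (A.D z)] at this; linarith
  have e2 : A.I (A.D (A.D z) * z) = -A.I (A.D z ^ 2) := by rw [hp _ _ hz1, ← sq]
  have e3 : A.I (A.D z * z) = 0 := by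
    have := hp _ z hz
    rw [mul_comm z] at this; linarith
  have e4 : A.I (A.D (A.D z) * A.lapS z) = A.I (A.Γ (A.D z) (A.D z)) := by
    rw [hp _ _ hz1, D_lapS, mul_comm, hl _ _ hz1]; ring
  have e5 : A.I (A.D z * A.lapS z) = 0 := by
    have h1 := hp _ (A.lapS z) hz
    rw [D_lapS, mul_comm z, hl _ _ hz1] at h1
    have h2 := hl _ (A.D z) hz
    rw [mul_comm, Γ_comm] at h2; linarith
  have e6 : A.I (z * A.lapS z) = -A.I (A.Γ z z) := by rw [mul_comm, hl _ _ hz]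
  have : A.symLap c z ^ 2 = A.D (A.D z) ^ 2 + (4 : ℝ) • A.D z ^ 2 + c ^ 2 • z ^ 2 + A.lapS z ^ 2
      + (4 : ℝ) • (A.D (A.D z) * A.D z) - (2 * c) • (A.D (A.D z) * z)
      + (2 : ℝ) • (A.D (A.D z) * A.lapS z) - (4 * c) • (A.D z * z)
      + (4 : ℝ) • (A.D z * A.lapS z) - (2 * c) • (z * A.lapS z) := by
    simp only [symLap, Algebra.smul_def, map_mul, map_ofNat, map_pow]
    ring
  rw [this]
  simp only [quad, map_add, map_sub, map_smul, smul_eq_mul, e1, e2, e3, e4, e5, e6]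
  ring

lemma quad_mul {η : S} (hr : A.IsRad η) (c : ℝ) (w : S) :
    A.quad c (η * w) =
      (A.D (A.D η) * w + (2 : ℝ) • (A.D η * A.D w) + η * A.D (A.D w)) ^ 2
      + (4 + 2 * c) • (A.D η * w + η * A.D w) ^ 2 + c ^ 2 • (η * w) ^ 2
      + η ^ 2 * A.lapS w ^ 2 + (2 * c) • (η ^ 2 * A.Γ w w)
      + (2 : ℝ) • (A.D η ^ 2 * A.Γ w w + (2 : ℝ) • (A.D η * η * A.Γ (A.D w) w)
        + η ^ 2 * A.Γ (A.D w) (A.D w)) := by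
  simp only [quad, Derivation.leibniz, smul_eq_mul, map_add, hr.lapS_mul, hr.Γ_mul,
    hr.Γ_mul_right, Γ_add, Γ_add_right]
  rw [mul_comm w (A.D η), mul_comm (A.D w), mul_comm w (A.D (A.D η))]
  simp only [hr.D.Γ_mul, hr.D.Γ_mul_right, Algebra.smul_def, map_mul,
    map_ofNat, map_add, A.Γ_comm w (A.D w)]
  ring

lemma I_quad_mul {η : S} (hη : η ∈ A.c) (hr : A.IsRad η) (c : ℝ) (w : S) :
    A.I (A.quad c (η * w)) = A.I (η ^ 2 * (A.bilap 0 (2 * c) (c ^ 2) w * w))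
      + 6 * A.I (A.D η ^ 2 * A.D w ^ 2) + 2 * A.I (A.D η ^ 2 * A.Γ w w)
      + (4 + 2 * c) * A.I (A.D η ^ 2 * w ^ 2) - 3 * A.I (A.D (A.D η) ^ 2 * w ^ 2)
      - 4 * A.I (A.D η * A.D (A.D (A.D η)) * w ^ 2) := by
  have hF : η ^ 2 ∈ A.c := by rw [sq]; exact A.c.mul_mem_left _ hη
  have hFr : A.IsRad (η ^ 2) := by rw [sq]; exact hr.mul hr
  have h1 : A.D η * η ∈ A.c := A.c.mul_mem_left _ hη
  have h2 : A.D (A.D η) * η ∈ A.c := A.c.mul_mem_left _ hη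
  have h3 : A.D (A.D η) * A.D η ∈ A.c := A.c.mul_mem_left _ (A.D_mem hη)
  have a1 := I_D_mul_self h1 (A.D w)
  have a2 := I_D2_mul_self h2 w
  have a3 := I_D_mul_self h3 w
  have a4 := I_D_mul_self h1 w
  have a5 := I_Γ_D_self h1 w
  rw [I_bilap_mul_self hF hFr, quad_mul hr]
  have e : (A.D (A.D η) * w + (2 : ℝ) • (A.D η * A.D w) + η * A.D (A.D w)) ^ 2
      + (4 + 2 * c) • (A.D η * w + η * A.D w) ^ 2 =
      A.D (A.D η) ^ 2 * w ^ 2 + (4 : ℝ) • (A.D η ^ 2 * A.D w ^ 2) + η ^ 2 * A.D (A.D w) ^ 2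
      + (4 : ℝ) • (A.D (A.D η) * A.D η * (A.D w * w))
      + (2 : ℝ) • (A.D (A.D η) * η * (A.D (A.D w) * w))
      + (4 : ℝ) • (A.D η * η * (A.D (A.D w) * A.D w))
      + (4 + 2 * c) • (A.D η ^ 2 * w ^ 2) + (4 + 2 * c) • (η ^ 2 * A.D w ^ 2)
      + (2 * (4 + 2 * c)) • (A.D η * η * (A.D w * w)) := by
    simp only [Algebra.smul_def, map_mul, map_ofNat, map_add]; ring
  rw [e, mul_pow]
  simp only [map_add, map_smul, smul_eq_mul, a1, a2, a3, a4, a5]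
  simp only [Derivation.leibniz, Derivation.leibniz_pow, smul_eq_mul, map_add,
    add_mul, nsmul_eq_mul, Nat.cast_ofNat, Nat.add_one_sub_one, pow_one, mul_add, two_mul]
  ring_nf

lemma I_mono {g h : S} (hg : g ∈ A.c) (hh : h ∈ A.c) (H : ∀ x, A.ev x g ≤ A.ev x h) :
    A.I g ≤ A.I h := by
  have := A.I_nonneg (A.c.sub_mem hh hg) fun x => by rw [map_sub]; linarith [H x]
  rw [map_sub] at this; linarith

/-- The energy density controlled by the stability inequality. -/
def en (A : CylCalc S X ι) (w : S) : S :=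
  w ^ 2 + A.D w ^ 2 + A.D (A.D w) ^ 2 + A.Γ w w + A.Γ (A.D w) (A.D w) + A.lapS w ^ 2

lemma ev_quad (c : ℝ) (z : S) (x : X) : A.ev x (A.quad c z) =
    A.ev x (A.D (A.D z)) ^ 2 + (4 + 2 * c) * A.ev x (A.D z) ^ 2 + c ^ 2 * A.ev x z ^ 2
      + A.ev x (A.lapS z) ^ 2 + 2 * c * A.ev x (A.Γ z z) + 2 * A.ev x (A.Γ (A.D z) (A.D z)) := by
  simp [quad]

lemma lapS_mem {z : S} (hz : z ∈ A.c) : A.lapS z ∈ A.c := by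
  rw [lapS_apply]; exact A.c.sum_mem fun i _ => A.L_mem (A.L_mem hz)

lemma Γ_mem {z : S} (hz : z ∈ A.c) (w : S) : A.Γ z w ∈ A.c :=
  A.c.sum_mem fun _ _ => A.c.mul_mem_right _ (A.L_mem hz)

lemma smul_mem' {z : S} (hz : z ∈ A.c) (r : ℝ) : r • z ∈ A.c := by
  rw [Algebra.smul_def]; exact A.c.mul_mem_left _ hz

lemma mul_I (r : ℝ) (g : S) : r * A.I g = A.I (r • g) := by simp

lemma quad_mem {z : S} (hz : z ∈ A.c) (c : ℝ) : A.quad c z ∈ A.c := by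
  have h1 := A.D_mem hz
  have hsq : ∀ {y}, y ∈ A.c → y ^ 2 ∈ A.c := fun hy => by rw [sq]; exact A.c.mul_mem_left _ hy
  exact A.c.add_mem (A.c.add_mem (A.c.add_mem (A.c.add_mem (A.c.add_mem (hsq (A.D_mem h1))
    (smul_mem' (hsq h1) _)) (smul_mem' (hsq hz) _)) (hsq (lapS_mem hz)))
    (smul_mem' (Γ_mem hz _) _)) (smul_mem' (Γ_mem h1 _) _)

set_option maxHeartbeats 1000000 in
/-- Caccioppoli-type inequality for solutions satisfying the stability inequality. -/
lemma exists_caccioppoli {p c B : ℝ} (hp : 1 < p) (hc : 0 < c) (hB : 0 ≤ B) :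
    ∃ C : ℝ, 0 < C ∧ ∀ (A : CylCalc S X ι) (η g θ w : S), η ∈ A.c → θ ∈ A.c → A.IsRad η →
      A.D η ^ 2 = η * g →
      (∀ x, |A.ev x g| ≤ B * A.ev x θ) →
      (∀ x, |A.ev x (A.D (A.D η))| ≤ B * A.ev x θ) →
      (∀ x, |A.ev x (A.D η) * A.ev x (A.D (A.D (A.D η)))| ≤ B * A.ev x θ ^ 2) →
      (∀ x, A.ev x (A.D η) ^ 2 ≤ B * A.ev x θ ^ 2) →
      p * A.I (η ^ 2 * (A.bilap 0 (2 * c) (c ^ 2) w * w)) ≤ A.I (A.quad c (η * w)) →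
      A.I (η ^ 2 * (A.en w + A.bilap 0 (2 * c) (c ^ 2) w * w)) ≤ C * A.I (θ ^ 2 * w ^ 2) := by
  obtain ⟨q, hq⟩ : ∃ q, q = p / (p - 1) := ⟨_, rfl⟩
  have hq0 : 0 < q := by rw [hq]; exact div_pos (by linarith) (by linarith)
  have hqp : q * (p - 1) = p := by rw [hq]; field_simp [show p - 1 ≠ 0 by linarith]
  obtain ⟨ε, hε⟩ : ∃ ε, ε = 1 / (2 * (24 * q + 12)) := ⟨_, rfl⟩
  have hε0 : 0 < ε := by rw [hε]; positivity
  have hεq : (24 * q + 12) * ε = 1 / 2 := by rw [hε]; field_simp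
  obtain ⟨K, hK⟩ : ∃ K, K = B ^ 2 / (4 * ε) + B ^ 2 + B := ⟨_, rfl⟩
  have hK0 : 0 ≤ K := by rw [hK]; positivity
  obtain ⟨K3, hK3⟩ : ∃ K3, K3 = (4 + 2 * c) * B + 4 * B := ⟨_, rfl⟩
  have hK30 : 0 ≤ K3 := by rw [hK3]; positivity
  obtain ⟨M1, hM1⟩ : ∃ M1, M1 = 2 * ((32 * q + 12) * K + 4 * q * K3 + 3 * B ^ 2) := ⟨_, rfl⟩
  have hM10 : 0 ≤ M1 := by rw [hM1]; positivity
  obtain ⟨M2, hM2⟩ : ∃ M2, M2 = ε * M1 + K := ⟨_, rfl⟩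
  have hM20 : 0 ≤ M2 := by rw [hM2]; positivity
  obtain ⟨M3, hM3⟩ : ∃ M3, M3 = q * (8 * M2 + K3) := ⟨_, rfl⟩
  have hM30 : 0 ≤ M3 := by rw [hM3]; positivity
  refine ⟨M1 + (M3 + 2 * B) + M3 / (2 * c) + (M3 + 2 * M2) + M3 / c ^ 2 + M3 + 1, by positivity, ?_⟩
  intro A η g θ w hη hθ hr hg hgB h2B h13B h1B hstab
  have hη1 := A.D_mem hη
  have hsq : ∀ {y}, y ∈ A.c → y ^ 2 ∈ A.c := fun hy => by rw [sq]; exact A.c.mul_mem_left _ hy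
  have hF := hsq hη
  have hF1 := hsq hη1
  have hF1r : A.IsRad (A.D η ^ 2) := by rw [sq]; exact hr.D.mul hr.D
  have hθ2 := hsq hθ
  have hz : η * w ∈ A.c := A.c.mul_mem_right _ hη
  have hQm := quad_mem hz c
  have hgev : ∀ x, A.ev x (A.D η) ^ 2 = A.ev x η * A.ev x g := fun x => by
    rw [← map_pow, hg, map_mul]
  have hg2 : ∀ x, A.ev x g ^ 2 ≤ B ^ 2 * A.ev x θ ^ 2 := fun x => by
    rw [← mul_pow]; exact sq_le_sq.2 ((hgB x).trans (le_abs_self _))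
  have h22 : ∀ x, A.ev x (A.D (A.D η)) ^ 2 ≤ B ^ 2 * A.ev x θ ^ 2 := fun x => by
    rw [← mul_pow]; exact sq_le_sq.2 ((h2B x).trans (le_abs_self _))
  set W := A.I (θ ^ 2 * w ^ 2) with hW
  set V1 := A.I (A.D η ^ 2 * A.D w ^ 2) with hV1
  set V2 := A.I (A.D η ^ 2 * A.Γ w w) with hV2
  set Xq := A.I (η ^ 2 * A.D (A.D w) ^ 2) with hX
  set Yq := A.I (η ^ 2 * A.lapS w ^ 2) with hY
  set Gq := A.I (η ^ 2 * (A.bilap 0 (2 * c) (c ^ 2) w * w)) with hG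
  set Q := A.I (A.quad c (η * w)) with hQ
  have mr : ∀ {f}, f ∈ A.c → ∀ y, f * y ∈ A.c := fun hf y => A.c.mul_mem_right y hf
  have hW0 : 0 ≤ W := A.I_nonneg (mr hθ2 _) fun x => by simp only [map_mul, map_pow]; positivity
  have hX0 : 0 ≤ Xq := A.I_nonneg (mr hF _) fun x => by simp only [map_mul, map_pow]; positivity
  have hY0 : 0 ≤ Yq := A.I_nonneg (mr hF _) fun x => by simp only [map_mul, map_pow]; positivity
  have y1 : ∀ a b : ℝ, -(a * b) ≤ ε * a ^ 2 + b ^ 2 / (4 * ε) := fun a b => by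
    have : ε * a ^ 2 + b ^ 2 / (4 * ε) + a * b = (2 * ε * a + b) ^ 2 / (4 * ε) := by
      field_simp; ring
    have h2 : 0 ≤ (2 * ε * a + b) ^ 2 / (4 * ε) := by positivity
    linarith
  have y2 : ∀ a b : ℝ, (a - b) ^ 2 ≤ 2 * a ^ 2 + 2 * b ^ 2 := fun a b => by
    linarith [sq_nonneg (a + b)]
  have y3 : ∀ a b d : ℝ, (a - 2 * b - d) ^ 2 ≤ 3 * a ^ 2 + 12 * b ^ 2 + 3 * d ^ 2 := fun a b d => by
    linarith [sq_nonneg (a + 2 * b), sq_nonneg (a + d), sq_nonneg (2 * b - d)]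
  have f1 : V1 ≤ ε * Xq + K * W := by
    have h := I_D2_mul_self hF1 w
    have hD : A.D (A.D (A.D η ^ 2)) = (2 : ℝ) • (A.D (A.D η) ^ 2 + A.D η * A.D (A.D (A.D η))) := by
      simp only [sq, Derivation.leibniz, smul_eq_mul, map_add, two_smul]; ring
    have e : V1 = A.I (-(A.D η ^ 2 * (A.D (A.D w) * w)) +
        (A.D (A.D η) ^ 2 + A.D η * A.D (A.D (A.D η))) * w ^ 2) := by
      rw [hD, smul_mul_assoc, map_smul, smul_eq_mul] at h
      rw [map_add, map_neg, h]; ring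
    rw [e, hX, hW, mul_I, mul_I, ← map_add]
    refine I_mono (A.c.add_mem (A.c.neg_mem (mr hF1 _)) (mr (A.c.add_mem (hsq (A.D_mem hη1))
      (mr hη1 _)) _)) (A.c.add_mem (smul_mem' (mr hF _) _) (smul_mem' (mr hθ2 _) _)) fun x => ?_
    have b1 := y1 (A.ev x η * A.ev x (A.D (A.D w))) (A.ev x g * A.ev x w)
    have b2 : (A.ev x g * A.ev x w) ^ 2 / (4 * ε) ≤
        B ^ 2 / (4 * ε) * (A.ev x θ ^ 2 * A.ev x w ^ 2) := by
      rw [mul_pow, div_mul_eq_mul_div, ← mul_assoc]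
      gcongr; exact hg2 x
    have b3 := mul_le_mul_of_nonneg_right (h22 x) (sq_nonneg (A.ev x w))
    have b4 := mul_le_mul_of_nonneg_right ((le_abs_self _).trans (h13B x)) (sq_nonneg (A.ev x w))
    simp only [map_mul, map_pow, map_add, map_smul, map_neg, smul_eq_mul, hgev x]
    rw [hK]
    linarith
  have f2 : V2 ≤ ε * Yq + K * W := by
    have e : V2 = A.I (-(A.D η ^ 2 * (A.lapS w * w))) := by
      rw [map_neg, I_mul_lapS hF1 hF1r, neg_neg]
    rw [e, hY, hW, mul_I, mul_I, ← map_add]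
    refine I_mono (A.c.neg_mem (mr hF1 _)) (A.c.add_mem (smul_mem' (mr hF _) _)
      (smul_mem' (mr hθ2 _) _)) fun x => ?_
    have b1 := y1 (A.ev x η * A.ev x (A.lapS w)) (A.ev x g * A.ev x w)
    have b2 : (A.ev x g * A.ev x w) ^ 2 / (4 * ε) ≤
        B ^ 2 / (4 * ε) * (A.ev x θ ^ 2 * A.ev x w ^ 2) := by
      rw [mul_pow, div_mul_eq_mul_div, ← mul_assoc]
      gcongr; exact hg2 x
    have b3 : 0 ≤ (B ^ 2 + B) * (A.ev x θ ^ 2 * A.ev x w ^ 2) := by positivity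
    simp only [map_mul, map_pow, map_add, map_smul, map_neg, smul_eq_mul, hgev x]
    rw [hK]
    linarith
  have g1 : A.I (A.D η ^ 2 * w ^ 2) ≤ B * W := by
    rw [hW, mul_I]
    refine I_mono (mr hF1 _) (smul_mem' (mr hθ2 _) _) fun x => ?_
    simp only [map_mul, map_pow, map_smul, smul_eq_mul]
    have := mul_le_mul_of_nonneg_right (h1B x) (sq_nonneg (A.ev x w))
    linarith
  have g2 : A.I (A.D (A.D η) ^ 2 * w ^ 2) ≤ B ^ 2 * W := by
    rw [hW, mul_I]
    refine I_mono (mr (hsq (A.D_mem hη1)) _) (smul_mem' (mr hθ2 _) _) fun x => ?_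
    simp only [map_mul, map_pow, map_smul, smul_eq_mul]
    have := mul_le_mul_of_nonneg_right (h22 x) (sq_nonneg (A.ev x w))
    linarith
  have g2' : 0 ≤ A.I (A.D (A.D η) ^ 2 * w ^ 2) :=
    A.I_nonneg (mr (hsq (A.D_mem hη1)) _) fun x => by simp only [map_mul, map_pow]; positivity
  have g3 : -A.I (A.D η * A.D (A.D (A.D η)) * w ^ 2) ≤ B * W := by
    rw [hW, mul_I, ← map_neg]
    refine I_mono (A.c.neg_mem (mr (mr hη1 _) _)) (smul_mem' (mr hθ2 _) _) fun x => ?_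
    simp only [map_mul, map_pow, map_smul, smul_eq_mul, map_neg]
    have := mul_le_mul_of_nonneg_right ((neg_le_abs _).trans (h13B x)) (sq_nonneg (A.ev x w))
    linarith
  have f3 : Q ≤ Gq + 6 * V1 + 2 * V2 + K3 * W := by
    rw [hQ, I_quad_mul hη hr, hK3]
    have := mul_le_mul_of_nonneg_left g1 (show 0 ≤ 4 + 2 * c by positivity)
    linarith
  have hz1 : A.D (η * w) = A.D η * w + η * A.D w := by
    simp only [Derivation.leibniz, smul_eq_mul]; ring
  have hz2 : A.D (A.D (η * w)) =
      A.D (A.D η) * w + (2 : ℝ) • (A.D η * A.D w) + η * A.D (A.D w) := by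
    simp only [Derivation.leibniz, smul_eq_mul, map_add, two_smul]; ring
  have hqx : ∀ x, 0 ≤ A.ev x (A.Γ (η * w) (η * w)) ∧
      0 ≤ A.ev x (A.Γ (A.D (η * w)) (A.D (η * w))) := fun x =>
    ⟨A.ev_Γ_self_nonneg _ x, A.ev_Γ_self_nonneg _ x⟩
  have bd : ∀ y, y ∈ A.c → (∀ x, A.ev x y ≤ A.ev x (A.quad c (η * w))) → A.I y ≤ Q :=
    fun y hy h => I_mono hy hQm h
  have f4 : Xq ≤ 3 * Q + 12 * V1 + 3 * (B ^ 2 * W) := by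
    have : Xq ≤ A.I ((3 : ℝ) • A.quad c (η * w) + (12 : ℝ) • (A.D η ^ 2 * A.D w ^ 2)
        + (3 : ℝ) • (A.D (A.D η) ^ 2 * w ^ 2)) := by
      refine I_mono (mr hF _) (A.c.add_mem (A.c.add_mem (smul_mem' hQm _)
        (smul_mem' (mr hF1 _) _)) (smul_mem' (mr (hsq (A.D_mem hη1)) _) _)) fun x => ?_
      obtain ⟨p1, p2⟩ := hqx x
      have p3 : 0 ≤ c * A.ev x (A.Γ (η * w) (η * w)) := by positivity
      have p4 : 0 ≤ c * (A.ev x (A.D (η * w))) ^ 2 := by positivity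
      have p5 : 0 ≤ c ^ 2 * (A.ev x (η * w)) ^ 2 := by positivity
      have hh : A.ev x η * A.ev x (A.D (A.D w)) = A.ev x (A.D (A.D (η * w)))
          - 2 * (A.ev x (A.D η) * A.ev x (A.D w)) - A.ev x (A.D (A.D η)) * A.ev x w := by
        rw [hz2]; simp; ring
      simp only [map_add, map_smul, smul_eq_mul, ev_quad, map_mul _ (η ^ 2), map_mul _ (A.D η ^ 2),
        map_mul _ (A.D (A.D η) ^ 2), map_pow]
      simp only [← mul_pow, hh]
      have p6 := sq_nonneg (A.ev x (A.D (η * w)))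
      have p7 := sq_nonneg (A.ev x (A.lapS (η * w)))
      have p8 := y3 (A.ev x (A.D (A.D (η * w)))) (A.ev x (A.D η) * A.ev x (A.D w))
        (A.ev x (A.D (A.D η)) * A.ev x w)
      linarith
    refine this.trans ?_
    simp only [map_add, map_smul, smul_eq_mul]
    linarith
  have key : ∀ x, 0 ≤ c * A.ev x (A.Γ (η * w) (η * w)) ∧ 0 ≤ c * (A.ev x (A.D (η * w))) ^ 2 ∧
      0 ≤ c ^ 2 * (A.ev x (η * w)) ^ 2 ∧ 0 ≤ (A.ev x (A.lapS (η * w))) ^ 2 ∧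
      0 ≤ (A.ev x (A.D (A.D (η * w)))) ^ 2 ∧ 0 ≤ (A.ev x (A.D (η * w))) ^ 2 := fun x => by
    have := (hqx x).1
    refine ⟨?_, ?_, ?_, ?_, ?_, ?_⟩ <;> positivity
  have f5 : Yq ≤ Q := by
    refine bd _ (mr hF _) fun x => ?_
    obtain ⟨k1, k2, k3, k4, k5, k6⟩ := key x
    rw [ev_quad]
    have : A.ev x (η ^ 2 * A.lapS w ^ 2) = A.ev x (A.lapS (η * w)) ^ 2 := by
      rw [hr.lapS_mul]; simp [mul_pow]
    linarith [(hqx x).2]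
  have f7 : A.I (η ^ 2 * A.D w ^ 2) ≤ Q + 2 * (B * W) := by
    have : A.I (η ^ 2 * A.D w ^ 2) ≤ A.I (A.quad c (η * w) + (2 : ℝ) • (A.D η ^ 2 * w ^ 2)) := by
      refine I_mono (mr hF _) (A.c.add_mem hQm (smul_mem' (mr hF1 _) _)) fun x => ?_
      obtain ⟨k1, k2, k3, k4, k5, k6⟩ := key x
      have hh : A.ev x η * A.ev x (A.D w) = A.ev x (A.D (η * w)) - A.ev x (A.D η) * A.ev x w := by
        rw [hz1]; simp
      simp only [map_add, map_smul, smul_eq_mul, ev_quad, map_mul _ (η ^ 2), map_mul _ (A.D η ^ 2),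
        map_pow]
      simp only [← mul_pow, hh]
      linarith [y2 (A.ev x (A.D (η * w))) (A.ev x (A.D η) * A.ev x w), (hqx x).2]
    refine this.trans ?_
    simp only [map_add, map_smul, smul_eq_mul]
    linarith
  have f8 : A.I (η ^ 2 * A.Γ w w) ≤ Q / (2 * c) := by
    rw [le_div_iff₀ (by positivity), mul_comm, mul_I]
    refine bd _ (smul_mem' (mr hF _) _) fun x => ?_
    obtain ⟨k1, k2, k3, k4, k5, k6⟩ := key x
    rw [ev_quad]
    have : A.ev x ((2 * c) • (η ^ 2 * A.Γ w w)) = 2 * (c * A.ev x (A.Γ (η * w) (η * w))) := by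
      rw [hr.Γ_mul, hr.Γ_mul_right]; simp only [map_smul, map_mul, map_pow, smul_eq_mul]; ring
    linarith [(hqx x).2]
  have f9 : A.I (η ^ 2 * A.Γ (A.D w) (A.D w)) ≤ Q + 2 * V2 := by
    rw [hQ, hV2, mul_I, ← map_add]
    refine I_mono (mr hF _) (A.c.add_mem hQm (smul_mem' (mr hF1 _) _)) fun x => ?_
    obtain ⟨k1, k2, k3, k4, k5, k6⟩ := key x
    have h := A.ev_Γ_add_le (A.D (η * w)) ((-1 : ℝ) • (A.D η * w)) x
    have e1 : A.D (η * w) + (-1 : ℝ) • (A.D η * w) = η * A.D w := by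
      rw [hz1, neg_one_smul]; ring
    rw [e1, hr.Γ_mul, hr.Γ_mul_right, Γ_smul, Γ_smul_right, hr.D.Γ_mul, hr.D.Γ_mul_right] at h
    simp only [map_mul, map_smul, smul_eq_mul] at h
    rw [map_add, ev_quad]
    simp only [map_mul _ (η ^ 2), map_mul _ (A.D η ^ 2), map_pow, map_smul, smul_eq_mul]
    linarith
  have f10 : A.I (η ^ 2 * w ^ 2) ≤ Q / c ^ 2 := by
    rw [le_div_iff₀ (by positivity), mul_comm, mul_I]
    refine bd _ (smul_mem' (mr hF _) _) fun x => ?_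
    obtain ⟨k1, k2, k3, k4, k5, k6⟩ := key x
    rw [ev_quad]
    have : A.ev x (c ^ 2 • (η ^ 2 * w ^ 2)) = c ^ 2 * (A.ev x (η * w)) ^ 2 := by
      simp only [map_smul, map_mul, map_pow, smul_eq_mul]; ring
    linarith [(hqx x).2]
  have hV10 : 0 ≤ V1 := A.I_nonneg (mr hF1 _) fun x => by simp only [map_mul, map_pow]; positivity
  have hV20 : 0 ≤ V2 := A.I_nonneg (mr hF1 _) fun x => by
    simp only [map_mul, map_pow]; exact mul_nonneg (sq_nonneg _) (A.ev_Γ_self_nonneg _ _)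
  have hQ1 : Q ≤ q * (6 * V1 + 2 * V2 + K3 * W) := by
    have h1 : (p - 1) * Q ≤ p * (6 * V1 + 2 * V2 + K3 * W) := by nlinarith
    have h2 := mul_le_mul_of_nonneg_left h1 hq0.le
    rw [← mul_assoc, hqp] at h2
    have h3 : p * Q ≤ p * (q * (6 * V1 + 2 * V2 + K3 * W)) := by linarith
    exact le_of_mul_le_mul_left h3 (by linarith)
  have hXY : Xq + Yq ≤ M1 * W := by
    have h1 : Xq + Yq ≤ (24 * q + 12) * V1 + 8 * q * V2 + (4 * q * K3 + 3 * B ^ 2) * W := by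
      linarith
    have h2 : (24 * q + 12) * V1 ≤ (24 * q + 12) * (ε * Xq + K * W) := by gcongr
    have h3 : 8 * q * V2 ≤ 8 * q * (ε * Yq + K * W) := by gcongr
    have h5 : 0 ≤ ε * Yq + K * W := by positivity
    have h4 : 8 * q * (ε * Yq + K * W) ≤ (24 * q + 12) * (ε * Yq) + 0 + 8 * q * (K * W) := by
      have : 0 ≤ (16 * q + 12) * (ε * Yq) := by positivity
      linarith
    have h6 : (24 * q + 12) * (ε * Xq) = 1 / 2 * Xq := by rw [← mul_assoc, hεq]
    have h7 : (24 * q + 12) * (ε * Yq) = 1 / 2 * Yq := by rw [← mul_assoc, hεq]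
    have h8 : M1 * W = 2 * ((32 * q + 12) * (K * W)) + 2 * ((4 * q * K3 + 3 * B ^ 2) * W) := by
      rw [hM1]; ring
    have h9 : (24 * q + 12) * (ε * Xq + K * W) = 1 / 2 * Xq + (24 * q + 12) * (K * W) := by
      rw [mul_add, h6]
    linarith
  have hXM : Xq ≤ M1 * W := by linarith
  have hYM : Yq ≤ M1 * W := by linarith
  have hM2W : M2 * W = ε * (M1 * W) + K * W := by rw [hM2]; ring
  have hV1M : V1 ≤ M2 * W := by
    linarith [mul_le_mul_of_nonneg_left hXM hε0.le]
  have hV2M : V2 ≤ M2 * W := by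
    linarith [mul_le_mul_of_nonneg_left hYM hε0.le]
  have hQM : Q ≤ M3 * W := by
    have h1 : q * (6 * V1 + 2 * V2 + K3 * W) ≤ q * (8 * (M2 * W) + K3 * W) := by
      apply mul_le_mul_of_nonneg_left _ hq0.le; linarith
    have h2 : M3 * W = q * (8 * (M2 * W) + K3 * W) := by rw [hM3]; ring
    linarith
  have hQ0 : 0 ≤ Q := hY0.trans f5
  have hGQ : Gq ≤ Q := by
    by_contra h
    push Not at h
    have : 0 < (p - 1) * Gq := mul_pos (by linarith) (by linarith)
    linarith
  have f8' : A.I (η ^ 2 * A.Γ w w) ≤ M3 / (2 * c) * W :=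
    f8.trans (by rw [div_mul_eq_mul_div]; gcongr)
  have f10' : A.I (η ^ 2 * w ^ 2) ≤ M3 / c ^ 2 * W :=
    f10.trans (by rw [div_mul_eq_mul_div]; gcongr)
  have e : A.I (η ^ 2 * (A.en w + A.bilap 0 (2 * c) (c ^ 2) w * w)) =
      A.I (η ^ 2 * w ^ 2) + A.I (η ^ 2 * A.D w ^ 2) + Xq + A.I (η ^ 2 * A.Γ w w)
        + A.I (η ^ 2 * A.Γ (A.D w) (A.D w)) + Yq + Gq := by
    simp only [en, mul_add, map_add, hX, hY, hG]
  rw [e]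
  linarith

lemma abs_I_mul_le {F Y Z E : S} (hF : F ∈ A.c) (hY : Y ∈ A.c)
    (hFY : ∀ x, |A.ev x F| ≤ A.ev x Y) (hZ : ∀ x, 0 ≤ A.ev x Z)
    (hZE : ∀ x, A.ev x Z ≤ A.ev x E) : |A.I (F * Z)| ≤ A.I (Y * E) := by
  have key : ∀ x, |A.ev x F * A.ev x Z| ≤ A.ev x Y * A.ev x E := fun x => by
    rw [abs_mul, abs_of_nonneg (hZ x)]
    exact mul_le_mul (hFY x) (hZE x) (hZ x) ((abs_nonneg _).trans (hFY x))
  have mF := A.c.mul_mem_right Z hF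
  have mY := A.c.mul_mem_right E hY
  rw [abs_le, ← map_neg]
  constructor
  · refine I_mono (A.c.neg_mem mY) mF fun x => ?_
    rw [map_neg, map_mul, map_mul]; exact (abs_le.1 (key x)).1
  · refine I_mono mF mY fun x => ?_
    rw [map_mul, map_mul]; exact (abs_le.1 (key x)).2

/-- Total energy density of a solution. -/
def tot (A : CylCalc S X ι) (k l₁ l₂ : ℝ) (v : S) : S := A.en v + A.bilap k l₁ l₂ v * v

/-- Dissipation density of the energy. -/
def diss (A : CylCalc S X ι) (v : S) : S :=
  A.D (A.D v) ^ 2 + A.D v ^ 2 + A.Γ (A.D v) (A.D v)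

lemma ev_diss_nonneg (v : S) (x : X) : 0 ≤ A.ev x (A.diss v) := by
  have := A.ev_Γ_self_nonneg (A.D v) x
  simp only [diss, map_add, map_pow]; positivity

lemma ev_tot_bounds {k l₁ l₂ : ℝ} {v : S} (hN : ∀ x, 0 ≤ A.ev x (A.bilap k l₁ l₂ v * v)) {Z : S}
    (hZ : Z ∈ ({v ^ 2, A.D v ^ 2, A.D (A.D v) ^ 2, A.Γ v v, A.Γ (A.D v) (A.D v), A.lapS v ^ 2,
      A.bilap k l₁ l₂ v * v} : Set S)) (x : X) :
    0 ≤ A.ev x Z ∧ A.ev x Z ≤ A.ev x (A.tot k l₁ l₂ v) := by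
  have h1 := A.ev_Γ_self_nonneg v x
  have h2 := A.ev_Γ_self_nonneg (A.D v) x
  have h3 := hN x
  have h4 := sq_nonneg (A.ev x v)
  have h5 := sq_nonneg (A.ev x (A.D v))
  have h6 := sq_nonneg (A.ev x (A.D (A.D v)))
  have h7 := sq_nonneg (A.ev x (A.lapS v))
  simp only [tot, en, map_add, map_pow]
  simp only [Set.mem_insert_iff, Set.mem_singleton_iff] at hZ
  rcases hZ with rfl | rfl | rfl | rfl | rfl | rfl | rfl <;>
    (try rw [map_pow]) <;> constructor <;> linarith

lemma exists_pohozaev (k l₁ l₂ σ : ℝ) {p : ℝ} (hp : 1 < p) :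
    ∃ C : ℝ, 0 ≤ C ∧ ∀ (A : CylCalc S X ι) (F Y v : S), F ∈ A.c → A.IsRad F → Y ∈ A.c →
      (∀ x, |A.ev x (A.D F)| ≤ A.ev x Y) → (∀ x, |A.ev x (A.D (A.D F))| ≤ A.ev x Y) →
      (∀ x, |A.ev x (A.D (A.D (A.D F)))| ≤ A.ev x Y) →
      (∀ x, 0 ≤ A.ev x (A.bilap k l₁ l₂ v * v)) →
      A.D (A.bilap k l₁ l₂ v * v) =
        (-σ) • (A.bilap k l₁ l₂ v * v) + (p + 1) • (A.bilap k l₁ l₂ v * A.D v) →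
      |2 * k * A.I (F * A.D (A.D v) ^ 2) + k * (l₁ + 4) * A.I (F * A.D v ^ 2)
        + 2 * k * A.I (F * A.Γ (A.D v) (A.D v)) + σ / (p + 1) * A.I (F * (A.bilap k l₁ l₂ v * v))|
        ≤ C * A.I (Y * A.tot k l₁ l₂ v) := by
  refine ⟨1 / (p + 1) + 3 / 2 + |(k ^ 2 - 4 - l₁) / 2| + |l₂ / 2| + 1 + |l₁ / 2| + 1 / 2 + |k|
    + 1 / 2, by positivity, ?_⟩
  intro A F Y v hF hr hY h1 h2 h3 hN hD
  have hF1 := A.D_mem hF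
  have hF2 := A.D_mem hF1
  have hF3 := A.D_mem hF2
  have B := fun (Z : S) hZ => ev_tot_bounds (k := k) (l₁ := l₁) (l₂ := l₂) (v := v) (Z := Z) hN hZ
  obtain ⟨W, hW⟩ : ∃ W, W = A.I (Y * A.tot k l₁ l₂ v) := ⟨_, rfl⟩
  have m := fun (r : ℝ) {F' : S} (hF' : F' ∈ A.c) (hb : ∀ x, |A.ev x F'| ≤ A.ev x Y) (Z : S) hZ =>
    show |r * A.I (F' * Z)| ≤ |r| * W by
      rw [hW, abs_mul]
      exact mul_le_mul_of_nonneg_left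
        (abs_I_mul_le hF' hY hb (fun x => (B Z hZ x).1) fun x => (B Z hZ x).2) (abs_nonneg _)
  obtain ⟨a1, b1⟩ := abs_le.1 (m (3 / 2) hF1 h1 (A.D (A.D v) ^ 2) (by simp))
  obtain ⟨a2, b2⟩ := abs_le.1 (m (-((k ^ 2 - 4 - l₁) / 2)) hF1 h1 (A.D v ^ 2) (by simp))
  obtain ⟨a3, b3⟩ := abs_le.1 (m (-(l₂ / 2)) hF1 h1 (v ^ 2) (by simp))
  obtain ⟨a4, b4⟩ := abs_le.1 (m 1 hF1 h1 (A.Γ (A.D v) (A.D v)) (by simp))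
  obtain ⟨a5, b5⟩ := abs_le.1 (m (-(l₁ / 2)) hF1 h1 (A.Γ v v) (by simp))
  obtain ⟨a6, b6⟩ := abs_le.1 (m (-(1 / 2)) hF1 h1 (A.lapS v ^ 2) (by simp))
  obtain ⟨a7, b7⟩ := abs_le.1 (m k hF2 h2 (A.D v ^ 2) (by simp))
  obtain ⟨a8, b8⟩ := abs_le.1 (m (-(1 / 2)) hF3 h3 (A.D v ^ 2) (by simp))
  obtain ⟨a9, b9⟩ := abs_le.1 (m (1 / (p + 1)) hF1 h1 (A.bilap k l₁ l₂ v * v) (by simp))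
  have e := I_bilap_mul_D hF hr k l₁ l₂ v
  have e2 : A.I (F * (A.bilap k l₁ l₂ v * A.D v)) = 1 / (p + 1) *
      (σ * A.I (F * (A.bilap k l₁ l₂ v * v)) - A.I (A.D F * (A.bilap k l₁ l₂ v * v))) := by
    have := A.I_D (A.c.mul_mem_right (A.bilap k l₁ l₂ v * v) hF)
    rw [Derivation.leibniz, hD] at this
    simp only [smul_eq_mul, mul_add, mul_smul_comm, map_add, map_smul] at this
    rw [mul_comm (A.bilap k l₁ l₂ v * v)] at this
    have hp' : p + 1 ≠ 0 := by linarith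
    field_simp
    linarith
  rw [e2] at e
  rw [← hW]
  simp only [abs_neg, abs_one, abs_of_pos (show (0 : ℝ) < 1 / 2 by norm_num),
    abs_of_pos (show (0 : ℝ) < 3 / 2 by norm_num),
    abs_of_pos (show 0 < 1 / (p + 1) by positivity)] at *
  have e3 : σ / (p + 1) * A.I (F * (A.bilap k l₁ l₂ v * v)) =
      1 / (p + 1) * (σ * A.I (F * (A.bilap k l₁ l₂ v * v))) := by ring
  rw [e3, abs_le]
  constructor <;> linarith

lemma contDiff_deriv' {f : ℝ → ℝ} (hf : ContDiff ℝ ∞ f) : ContDiff ℝ ∞ (deriv f) :=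
  (contDiff_infty_iff_deriv.1 hf).2

lemma differentiable_of_smooth {f : ℝ → ℝ} (hf : ContDiff ℝ ∞ f) : Differentiable ℝ f :=
  hf.differentiable (by simp)

lemma exists_bound {f : ℝ → ℝ} (hf : ContDiff ℝ ∞ f) (hc : HasCompactSupport f) :
    ∃ M, 0 ≤ M ∧ ∀ t, |f t| ≤ M := by
  obtain ⟨M, hM⟩ := hc.exists_bound_of_continuous hf.continuous
  exact ⟨M, (norm_nonneg _).trans (hM 0), hM⟩

/-- A compactly supported window, together with the derivative bounds of its powers. -/
lemma exists_window (j : ℕ) : ∃ (ζ g : ℝ → ℝ) (B : ℝ), ContDiff ℝ ∞ ζ ∧ ContDiff ℝ ∞ g ∧ 0 ≤ B ∧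
    (∀ t, 0 ≤ ζ t) ∧ (∀ t, ζ t ≤ 1) ∧ (∀ t, 0 ≤ t → t ≤ 1 → ζ t = 1) ∧ (∀ t ≤ -1, ζ t = 0) ∧
    (∀ t, 2 ≤ t → ζ t = 0) ∧
    (∀ t, deriv (fun s => ζ s ^ (j + 3)) t ^ 2 = ζ t ^ (j + 3) * g t) ∧
    (∀ t, |g t| ≤ B * ζ t ^ (j + 1)) ∧
    (∀ t, |deriv (deriv fun s => ζ s ^ (j + 3)) t| ≤ B * ζ t ^ (j + 1)) ∧
    (∀ t, |deriv (fun s => ζ s ^ (j + 3)) t * deriv (deriv (deriv fun s => ζ s ^ (j + 3))) t| ≤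
      B * (ζ t ^ (j + 1)) ^ 2) ∧
    (∀ t, deriv (fun s => ζ s ^ (j + 3)) t ^ 2 ≤ B * (ζ t ^ (j + 1)) ^ 2) := by
  obtain ⟨ζ, hζ⟩ : ∃ ζ : ℝ → ℝ, ζ = fun t => Real.smoothTransition (t + 1) *
    Real.smoothTransition (2 - t) := ⟨_, rfl⟩
  have hs : ContDiff ℝ ∞ ζ := by
    rw [hζ]
    exact (Real.smoothTransition.contDiff.comp (contDiff_id.add contDiff_const)).mul
      (Real.smoothTransition.contDiff.comp (contDiff_const.sub contDiff_id))
  have h0 : ∀ t, 0 ≤ ζ t := fun t => by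
    rw [hζ]; exact mul_nonneg (Real.smoothTransition.nonneg _) (Real.smoothTransition.nonneg _)
  have h1 : ∀ t, ζ t ≤ 1 := fun t => by
    rw [hζ]; exact mul_le_one₀ (Real.smoothTransition.le_one _) (Real.smoothTransition.nonneg _)
      (Real.smoothTransition.le_one _)
  have hl : ∀ t ≤ -1, ζ t = 0 := fun t ht => by
    simp only [hζ, Real.smoothTransition.zero_of_nonpos (show t + 1 ≤ 0 by linarith), zero_mul]
  have hr : ∀ t, 2 ≤ t → ζ t = 0 := fun t ht => by
    simp only [hζ, Real.smoothTransition.zero_of_nonpos (show 2 - t ≤ 0 by linarith), mul_zero]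
  have hm : ∀ t, 0 ≤ t → t ≤ 1 → ζ t = 1 := fun t ht ht' => by
    simp only [hζ, Real.smoothTransition.one_of_one_le (show 1 ≤ t + 1 by linarith),
      Real.smoothTransition.one_of_one_le (show 1 ≤ 2 - t by linarith), mul_one]
  have hcs : HasCompactSupport ζ := HasCompactSupport.intro (isCompact_Icc (a := -1) (b := 2))
    fun t ht => by
      simp only [Set.mem_Icc, not_and_or, not_le] at ht
      exact ht.elim (fun h => hl t h.le) fun h => hr t h.le
  obtain ⟨κ₁, hκ₁⟩ : ∃ κ : ℝ → ℝ, κ = fun t => (j + 3) * deriv ζ t := ⟨_, rfl⟩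
  obtain ⟨κ₂, hκ₂⟩ : ∃ κ : ℝ → ℝ, κ = fun t => (j + 2) * deriv ζ t * κ₁ t + ζ t * deriv κ₁ t :=
    ⟨_, rfl⟩
  obtain ⟨κ₃, hκ₃⟩ : ∃ κ : ℝ → ℝ, κ = fun t => (j + 1) * deriv ζ t * κ₂ t + ζ t * deriv κ₂ t :=
    ⟨_, rfl⟩
  have hd := contDiff_deriv' hs
  have s1 : ContDiff ℝ ∞ κ₁ := by rw [hκ₁]; exact contDiff_const.mul hd
  have s2 : ContDiff ℝ ∞ κ₂ := by
    rw [hκ₂]; exact ((contDiff_const.mul hd).mul s1).add (hs.mul (contDiff_deriv' s1))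
  have s3 : ContDiff ℝ ∞ κ₃ := by
    rw [hκ₃]; exact ((contDiff_const.mul hd).mul s2).add (hs.mul (contDiff_deriv' s2))
  have c1 : HasCompactSupport κ₁ := by rw [hκ₁]; exact hcs.deriv.mul_left
  have c2 : HasCompactSupport κ₂ := by
    rw [hκ₂]; exact HasCompactSupport.add c1.mul_left hcs.mul_right
  have c3 : HasCompactSupport κ₃ := by
    rw [hκ₃]; exact HasCompactSupport.add c2.mul_left hcs.mul_right
  obtain ⟨M₁, hM₁, b1⟩ := exists_bound s1 c1
  obtain ⟨M₂, hM₂, b2⟩ := exists_bound s2 c2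
  obtain ⟨M₃, hM₃, b3⟩ := exists_bound s3 c3
  have dζ : ∀ t, HasDerivAt ζ (deriv ζ t) t := fun t =>
    (differentiable_of_smooth hs t).hasDerivAt
  have d1 : (deriv fun s => ζ s ^ (j + 3)) = fun t => ζ t ^ (j + 2) * κ₁ t := by
    funext t
    rw [((dζ t).fun_pow (j + 3)).deriv, hκ₁]
    push_cast; ring
  have d2 : deriv (deriv fun s => ζ s ^ (j + 3)) = fun t => ζ t ^ (j + 1) * κ₂ t := by
    funext t
    rw [d1, (((dζ t).fun_pow (j + 2)).fun_mul (differentiable_of_smooth s1 t).hasDerivAt).deriv,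
      hκ₂]
    push_cast; ring
  have d3 : deriv (deriv (deriv fun s => ζ s ^ (j + 3))) = fun t => ζ t ^ j * κ₃ t := by
    funext t
    rw [d2, (((dζ t).fun_pow (j + 1)).fun_mul (differentiable_of_smooth s2 t).hasDerivAt).deriv,
      hκ₃]
    push_cast; ring
  obtain ⟨B, hB⟩ : ∃ B, B = M₁ ^ 2 + M₂ + M₁ * M₃ := ⟨_, rfl⟩
  have z0 : ∀ t m, 0 ≤ ζ t ^ m := fun t m => pow_nonneg (h0 t) m
  have q1 : ∀ t, κ₁ t ^ 2 ≤ B := fun t => by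
    have := sq_le_sq' (neg_le_of_abs_le (b1 t)) (le_of_abs_le (b1 t))
    have : 0 ≤ M₁ * M₃ := mul_nonneg hM₁ hM₃
    linarith
  refine ⟨ζ, fun t => ζ t ^ (j + 1) * κ₁ t ^ 2, B, hs, (hs.pow _).mul (s1.pow _), by
    rw [hB]; positivity, h0, h1, hm, hl, hr, fun t => ?_, fun t => ?_, fun t => ?_, fun t => ?_,
    fun t => ?_⟩
  · rw [d1]; ring
  · rw [abs_of_nonneg (mul_nonneg (z0 _ _) (sq_nonneg _)), mul_comm]
    exact mul_le_mul_of_nonneg_right (q1 t) (z0 _ _)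
  · rw [d2, abs_mul, abs_of_nonneg (z0 _ _), mul_comm]
    refine mul_le_mul_of_nonneg_right ?_ (z0 _ _)
    have := b2 t
    have : 0 ≤ M₁ * M₃ := mul_nonneg hM₁ hM₃
    nlinarith
  · have e : (ζ t ^ (j + 2) * κ₁ t) * (ζ t ^ j * κ₃ t) = (ζ t ^ (j + 1)) ^ 2 * (κ₁ t * κ₃ t) := by
      ring
    rw [d3, d1, e, abs_mul, abs_of_nonneg (sq_nonneg _), mul_comm, abs_mul]
    refine mul_le_mul_of_nonneg_right ?_ (sq_nonneg _)
    have := mul_le_mul (b1 t) (b3 t) (abs_nonneg _) hM₁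
    nlinarith
  · have e : (ζ t ^ (j + 2) * κ₁ t) ^ 2 = (ζ t ^ (j + 1)) ^ 2 * (ζ t ^ 2 * κ₁ t ^ 2) := by ring
    rw [d1, e, mul_comm]
    refine mul_le_mul_of_nonneg_right ?_ (sq_nonneg _)
    have : ζ t ^ 2 ≤ 1 := pow_le_one₀ (h0 t) (h1 t)
    exact (mul_le_of_le_one_left (sq_nonneg _) this).trans (q1 t)

/-- A smooth plateau rising on `[s, s + 1]` and falling on `[T, T + 1]`. -/
noncomputable def ramp (s T t : ℝ) : ℝ :=
  Real.smoothTransition (t - s) - Real.smoothTransition (t - T)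

lemma contDiff_shift {f : ℝ → ℝ} (hf : ContDiff ℝ ∞ f) (T : ℝ) :
    ContDiff ℝ ∞ fun t => f (t - T) := hf.comp (contDiff_id.sub contDiff_const)

lemma contDiff_ramp (s T : ℝ) : ContDiff ℝ ∞ (ramp s T) :=
  (contDiff_shift Real.smoothTransition.contDiff s).sub
    (contDiff_shift Real.smoothTransition.contDiff T)

lemma ramp_mono {s s' T T' : ℝ} (hs : s' ≤ s) (hT : T ≤ T') (t : ℝ) :
    ramp s T t ≤ ramp s' T' t :=
  sub_le_sub (Real.smoothTransition.monotone (by linarith))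
    (Real.smoothTransition.monotone (by linarith))

lemma ramp_nonneg {s T : ℝ} (h : s ≤ T) (t : ℝ) : 0 ≤ ramp s T t :=
  sub_nonneg.2 (Real.smoothTransition.monotone (by linarith))

lemma ramp_le_one (s T t : ℝ) : ramp s T t ≤ 1 := by
  have := Real.smoothTransition.nonneg (t - T)
  have := Real.smoothTransition.le_one (t - s)
  unfold ramp; linarith

lemma ramp_of_le {s T t : ℝ} (h : s ≤ T) (ht : t ≤ s) : ramp s T t = 0 := by
  simp only [ramp, Real.smoothTransition.zero_of_nonpos (show t - s ≤ 0 by linarith),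
    Real.smoothTransition.zero_of_nonpos (show t - T ≤ 0 by linarith), sub_zero]

lemma ramp_of_ge {s T t : ℝ} (h : s ≤ T) (ht : T + 1 ≤ t) : ramp s T t = 0 := by
  simp only [ramp, Real.smoothTransition.one_of_one_le (show 1 ≤ t - s by linarith),
    Real.smoothTransition.one_of_one_le (show 1 ≤ t - T by linarith), sub_self]

lemma ramp_eq_one {s T t : ℝ} (h : s + 1 ≤ t) (ht : t ≤ T) : ramp s T t = 1 := by
  simp only [ramp, Real.smoothTransition.one_of_one_le (show 1 ≤ t - s by linarith),
    Real.smoothTransition.zero_of_nonpos (show t - T ≤ 0 by linarith), sub_zero]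

lemma hasCompactSupport_ramp {s T : ℝ} (h : s ≤ T) : HasCompactSupport (ramp s T) :=
  HasCompactSupport.intro (isCompact_Icc (a := s) (b := T + 1)) fun t ht => by
    simp only [Set.mem_Icc, not_and_or, not_le] at ht
    exact ht.elim (fun h' => ramp_of_le h h'.le) fun h' => ramp_of_ge h h'.le

lemma deriv_shift_sub {f : ℝ → ℝ} (hf : ContDiff ℝ ∞ f) (s T : ℝ) :
    (deriv fun t => f (t - s) - f (t - T)) = fun t => deriv f (t - s) - deriv f (t - T) := by
  funext t
  have h := fun r => ((differentiable_of_smooth hf (t - r)).hasDerivAt.comp_sub_const t r)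
  exact ((h s).sub (h T)).deriv

lemma deriv_eq_zero_off_unit {f : ℝ → ℝ} (a b : ℝ) (h0 : ∀ t < 0, f t = a)
    (h1 : ∀ t, 1 < t → f t = b)
    (t : ℝ) : (t < 0 → deriv f t = 0) ∧ (1 < t → deriv f t = 0) := by
  constructor <;> intro ht
  · have : f =ᶠ[𝓝 t] fun _ => a := by filter_upwards [Iio_mem_nhds ht] with y hy using h0 y hy
    rw [this.deriv_eq, deriv_const]
  · have : f =ᶠ[𝓝 t] fun _ => b := by filter_upwards [Ioi_mem_nhds ht] with y hy using h1 y hy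
    rw [this.deriv_eq, deriv_const]

lemma exists_ramp_deriv_bound : ∃ M : ℝ, 0 ≤ M ∧ ∀ χ : ℝ → ℝ, (∀ t, 0 ≤ χ t) →
    (∀ t, 0 ≤ t → t ≤ 1 → χ t = 1) → ∀ s T t,
      |deriv (ramp s T) t| ≤ M * (χ (t - s) + χ (t - T)) ∧
      |deriv (deriv (ramp s T)) t| ≤ M * (χ (t - s) + χ (t - T)) ∧
      |deriv (deriv (deriv (ramp s T))) t| ≤ M * (χ (t - s) + χ (t - T)) ∧
      |deriv (deriv (deriv (deriv (ramp s T)))) t| ≤ M * (χ (t - s) + χ (t - T)) := by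
  have p0 : ContDiff ℝ ∞ Real.smoothTransition := Real.smoothTransition.contDiff
  have p1 := contDiff_deriv' p0
  have p2 := contDiff_deriv' p1
  have p3 := contDiff_deriv' p2
  have p4 := contDiff_deriv' p3
  have z1 := deriv_eq_zero_off_unit (f := Real.smoothTransition) 0 1
    (fun t ht => Real.smoothTransition.zero_of_nonpos ht.le)
    (fun t ht => Real.smoothTransition.one_of_one_le ht.le)
  have z2 := deriv_eq_zero_off_unit 0 0 (fun t => (z1 t).1) (fun t => (z1 t).2)
  have z3 := deriv_eq_zero_off_unit 0 0 (fun t => (z2 t).1) (fun t => (z2 t).2)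
  have z4 := deriv_eq_zero_off_unit 0 0 (fun t => (z3 t).1) (fun t => (z3 t).2)
  have bd : ∀ f : ℝ → ℝ, ContDiff ℝ ∞ f → (∀ t, (t < 0 → f t = 0) ∧ (1 < t → f t = 0)) →
      ∃ M, 0 ≤ M ∧ ∀ χ : ℝ → ℝ, (∀ t, 0 ≤ χ t) →
        (∀ t, 0 ≤ t → t ≤ 1 → χ t = 1) → ∀ t, |f t| ≤ M * χ t := fun f hf hz => by
    obtain ⟨M, hM, hb⟩ := exists_bound hf (HasCompactSupport.intro
      (isCompact_Icc (a := 0) (b := 1)) fun t ht => by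
        simp only [Set.mem_Icc, not_and_or, not_le] at ht
        exact ht.elim (hz t).1 (hz t).2)
    refine ⟨M, hM, fun χ hχ hχ1 t => ?_⟩
    by_cases h0 : t < 0
    · rw [(hz t).1 h0, abs_zero]; exact mul_nonneg hM (hχ t)
    by_cases h1 : 1 < t
    · rw [(hz t).2 h1, abs_zero]; exact mul_nonneg hM (hχ t)
    rw [hχ1 t (not_lt.1 h0) (not_lt.1 h1), mul_one]; exact hb t
  obtain ⟨M1, n1, b1⟩ := bd _ p1 z1
  obtain ⟨M2, n2, b2⟩ := bd _ p2 z2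
  obtain ⟨M3, n3, b3⟩ := bd _ p3 z3
  obtain ⟨M4, n4, b4⟩ := bd _ p4 z4
  refine ⟨M1 + M2 + M3 + M4, by positivity, fun χ h0 h1 s T t => ?_⟩
  have fin : ∀ (f : ℝ → ℝ) (M : ℝ), M ≤ M1 + M2 + M3 + M4 → (∀ t, |f t| ≤ M * χ t) →
      |f (t - s) - f (t - T)| ≤ (M1 + M2 + M3 + M4) * (χ (t - s) + χ (t - T)) := fun f M hM hf => by
    have a1 := mul_le_mul_of_nonneg_right hM (h0 (t - s))
    have a2 := mul_le_mul_of_nonneg_right hM (h0 (t - T))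
    linarith [abs_sub (f (t - s)) (f (t - T)), hf (t - s), hf (t - T)]
  have e1 : deriv (ramp s T) = _ := deriv_shift_sub p0 s T
  have e2 := e1 ▸ deriv_shift_sub p1 s T
  have e3 := e2 ▸ deriv_shift_sub p2 s T
  have e4 := e3 ▸ deriv_shift_sub p3 s T
  rw [e4, e3, e2, e1]
  exact ⟨fin _ M1 (by linarith) (b1 χ h0 h1), fin _ M2 (by linarith) (b2 χ h0 h1),
    fin _ M3 (by linarith) (b3 χ h0 h1), fin _ M4 (by linarith) (b4 χ h0 h1)⟩

lemma ev_quad_mul_le {c : ℝ} (hc : 0 < c) {η : S} (hr : A.IsRad η) (v : S) (x : X) :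
    A.ev x (A.quad c (η * v)) ≤ A.ev x η ^ 2 * (c ^ 2 * A.ev x v ^ 2 + A.ev x (A.lapS v) ^ 2
      + 2 * c * A.ev x (A.Γ v v)) + (15 + 4 * c) * (A.ev x η ^ 2 * A.ev x (A.diss v))
      + 3 * (A.ev x (A.D (A.D η)) ^ 2 * A.ev x v ^ 2) + A.ev x (A.D η) ^ 2 * (12 *
        A.ev x (A.D v) ^ 2 + (8 + 4 * c) * A.ev x v ^ 2 + 4 * A.ev x (A.Γ v v)) := by
  have hz1 : A.D (η * v) = A.D η * v + η * A.D v := by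
    simp only [Derivation.leibniz, smul_eq_mul]; ring
  have hz2 : A.D (A.D (η * v)) =
      A.D (A.D η) * v + (2 : ℝ) • (A.D η * A.D v) + η * A.D (A.D v) := by
    simp only [Derivation.leibniz, smul_eq_mul, map_add, two_smul]; ring
  have h := A.ev_Γ_add_le (A.D η * v) (η * A.D v) x
  rw [hr.Γ_mul, hr.Γ_mul_right, hr.D.Γ_mul, hr.D.Γ_mul_right] at h
  have g0 := A.ev_Γ_self_nonneg (A.D v) x
  rw [ev_quad, hz2, hz1, hr.lapS_mul, hr.Γ_mul v (η * v), hr.Γ_mul_right]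
  simp only [diss, map_add, map_mul, map_smul, smul_eq_mul, map_pow] at h ⊢
  generalize A.ev x η = y0, A.ev x (A.D η) = y1, A.ev x (A.D (A.D η)) = y2, A.ev x v = v0,
    A.ev x (A.D v) = v1, A.ev x (A.D (A.D v)) = v2, A.ev x (A.lapS v) = l,
    A.ev x (A.Γ (A.D v) (A.D v)) = g1, A.ev x (A.Γ v v) = g at *
  have q1 : (y2 * v0 + 2 * (y1 * v1) + y0 * v2) ^ 2 ≤
      3 * (y2 * v0) ^ 2 + 12 * (y1 * v1) ^ 2 + 3 * (y0 * v2) ^ 2 := by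
    linarith [sq_nonneg (y2 * v0 - 2 * (y1 * v1)), sq_nonneg (y2 * v0 - y0 * v2),
      sq_nonneg (2 * (y1 * v1) - y0 * v2)]
  have q2 : (4 + 2 * c) * (y1 * v0 + y0 * v1) ^ 2 ≤
      (4 + 2 * c) * (2 * (y1 * v0) ^ 2 + 2 * (y0 * v1) ^ 2) := by
    gcongr; linarith [sq_nonneg (y1 * v0 - y0 * v1)]
  have q3 : 0 ≤ y0 ^ 2 * g1 := by positivity
  have q4 : 0 ≤ c * (y0 ^ 2 * g1) := by positivity
  have q5 : 0 ≤ c * (y0 * v2) ^ 2 := by positivity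
  have q6 := sq_nonneg (y0 * v2)
  have q7 := sq_nonneg (y0 * v1)
  linarith

set_option maxHeartbeats 1000000 in
lemma exists_energy {p c k l₁ l₂ : ℝ} (hp : 1 < p) (hc : 0 < c) (h₁ : 2 * c < p * l₁)
    (h₂ : c ^ 2 < p * l₂) {M : ℝ} (hM : 0 ≤ M) :
    ∃ C : ℝ, 0 ≤ C ∧ ∀ (A : CylCalc S X ι) (η Y v : S), η ∈ A.c → A.IsRad η → Y ∈ A.c →
      (∀ x, |A.ev x η| ≤ 1) → (∀ x, A.ev x Y ≤ M) →
      (∀ x, |A.ev x (A.D η)| ≤ A.ev x Y) → (∀ x, |A.ev x (A.D (A.D η))| ≤ A.ev x Y) →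
      (∀ x, |A.ev x (A.D (A.D (A.D η)))| ≤ A.ev x Y) →
      (∀ x, |A.ev x (A.D (A.D (A.D (A.D η))))| ≤ A.ev x Y) →
      (∀ x, 0 ≤ A.ev x (A.bilap k l₁ l₂ v * v)) →
      p * A.I (η ^ 2 * (A.bilap k l₁ l₂ v * v)) ≤ A.I (A.quad c (η * v)) →
      A.I (η ^ 2 * A.tot k l₁ l₂ v) ≤ C * (A.I (η ^ 2 * A.diss v) + A.I (Y * A.tot k l₁ l₂ v)) := by
  obtain ⟨K, hK⟩ : ∃ K, K = 14 * M + 2 := ⟨_, rfl⟩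
  have hK0 : 0 ≤ K := by rw [hK]; positivity
  obtain ⟨K1, hK1⟩ : ∃ K1, K1 = (15 + 4 * c) + (27 + 4 * c) * M := ⟨_, rfl⟩
  have hK10 : 0 ≤ K1 := by rw [hK1]; positivity
  obtain ⟨K3, hK3⟩ : ∃ K3, K3 = (3 * |k| + |k * (l₁ + 4) / 2| + |k| + 2 + |(k ^ 2 - 4 - l₁) / 2|
    + 1 + |k| + 1 / 2) * K := ⟨_, rfl⟩
  have hK30 : 0 ≤ K3 := by rw [hK3]; positivity
  obtain ⟨K4, hK4⟩ : ∃ K4, K4 = K1 + p * |k ^ 2 - 4 - l₁| + p * K3 := ⟨_, rfl⟩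
  have hp0 : 0 < p := by linarith
  have hK40 : 0 ≤ K4 := by rw [hK4]; positivity
  have hp1 : 0 < p - 1 := by linarith
  have hp2 : 0 < p * l₁ - 2 * c := by linarith
  have hp3 : 0 < p * l₂ - c ^ 2 := by linarith
  refine ⟨(1 + c ^ 2) * (K4 / (p * l₂ - c ^ 2)) + (1 + 2 * c) * (K4 / (p * l₁ - 2 * c))
    + 2 * (K4 / (p - 1)) + 1 + K1, by positivity, ?_⟩
  intro A η Y v hη hr hY h0 hYM hd1 hd2 hd3 hd4 hN hstab
  have hF : η ^ 2 ∈ A.c := by rw [sq]; exact A.c.mul_mem_left _ hη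
  have hFr : A.IsRad (η ^ 2) := by rw [sq]; exact hr.mul hr
  have B := fun (Z : S) hZ => ev_tot_bounds (k := k) (l₁ := l₁) (l₂ := l₂) (v := v) (Z := Z) hN hZ
  have hKY : ∀ x, A.ev x (K • Y) = K * A.ev x Y := fun x => by simp
  have hKYc := smul_mem' hY K
  have mm : ∀ x a b, |a| ≤ A.ev x Y → |b| ≤ A.ev x Y →
      |a * b| ≤ M * A.ev x Y := fun x a b ha hb => by
    rw [abs_mul]
    exact mul_le_mul (ha.trans (hYM x)) hb (abs_nonneg _) hM
  have m0 : ∀ x b, |b| ≤ A.ev x Y → |A.ev x η * b| ≤ A.ev x Y := fun x b hb => by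
    rw [abs_mul]
    exact (mul_le_mul (h0 x) hb (abs_nonneg _) zero_le_one).trans (one_mul _).le
  have hY0 : ∀ x, 0 ≤ A.ev x Y := fun x => (abs_nonneg _).trans (hd1 x)
  have hMY0 : ∀ x, 0 ≤ M * A.ev x Y := fun x => mul_nonneg hM (hY0 x)
  have e1 : A.D (η ^ 2) = (2 : ℝ) • (η * A.D η) := by
    simp only [sq, Derivation.leibniz, smul_eq_mul, two_smul]
  have e2 : A.D (A.D (η ^ 2)) = (2 : ℝ) • (A.D η * A.D η) + (2 : ℝ) • (η * A.D (A.D η)) := by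
    rw [e1]
    simp only [Derivation.map_smul, Derivation.leibniz, smul_eq_mul, smul_add]; ring
  have e3 : A.D (A.D (A.D (η ^ 2))) = (6 : ℝ) • (A.D η * A.D (A.D η))
      + (2 : ℝ) • (η * A.D (A.D (A.D η))) := by
    rw [e2]
    simp only [map_add, Derivation.map_smul, Derivation.leibniz, smul_eq_mul]
    simp only [Algebra.smul_def, map_ofNat]; ring
  have e4 : A.D (A.D (A.D (A.D (η ^ 2)))) = (6 : ℝ) • (A.D (A.D η) * A.D (A.D η))
      + (8 : ℝ) • (A.D η * A.D (A.D (A.D η))) + (2 : ℝ) • (η * A.D (A.D (A.D (A.D η)))) := by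
    rw [e3]
    simp only [map_add, Derivation.map_smul, Derivation.leibniz, smul_eq_mul]
    simp only [Algebra.smul_def, map_ofNat]; ring
  have b1 : ∀ x, |A.ev x (A.D (η ^ 2))| ≤ A.ev x (K • Y) := fun x => by
    have q1 := abs_le.1 (m0 x _ (hd1 x))
    have := hMY0 x
    rw [hKY, hK, e1, map_smul, map_mul, smul_eq_mul, abs_le]
    constructor <;> linarith [q1.1, q1.2]
  have b2 : ∀ x, |A.ev x (A.D (A.D (η ^ 2)))| ≤ A.ev x (K • Y) := fun x => by
    have q1 := abs_le.1 (m0 x _ (hd2 x))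
    have q2 := abs_le.1 (mm x _ _ (hd1 x) (hd1 x))
    have := hMY0 x
    rw [hKY, hK, e2, map_add, map_smul, map_smul, map_mul, map_mul, smul_eq_mul, smul_eq_mul,
      abs_le]
    constructor <;> linarith [q1.1, q1.2, q2.1, q2.2]
  have b3 : ∀ x, |A.ev x (A.D (A.D (A.D (η ^ 2))))| ≤ A.ev x (K • Y) := fun x => by
    have q1 := abs_le.1 (m0 x _ (hd3 x))
    have q2 := abs_le.1 (mm x _ _ (hd1 x) (hd2 x))
    have := hMY0 x
    rw [hKY, hK, e3, map_add, map_smul, map_smul, map_mul, map_mul, smul_eq_mul, smul_eq_mul,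
      abs_le]
    constructor <;> linarith [q1.1, q1.2, q2.1, q2.2]
  have b4 : ∀ x, |A.ev x (A.D (A.D (A.D (A.D (η ^ 2)))))| ≤ A.ev x (K • Y) := fun x => by
    have q1 := abs_le.1 (m0 x _ (hd4 x))
    have q2 := abs_le.1 (mm x _ _ (hd1 x) (hd3 x))
    have q3 := abs_le.1 (mm x _ _ (hd2 x) (hd2 x))
    have := hMY0 x
    rw [hKY, hK, e4]
    simp only [map_add, map_smul, map_mul, smul_eq_mul]
    rw [abs_le]
    constructor <;> linarith [q1.1, q1.2, q2.1, q2.2, q3.1, q3.2]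
  obtain ⟨W, hW⟩ : ∃ W, W = A.I (Y * A.tot k l₁ l₂ v) := ⟨_, rfl⟩
  obtain ⟨Dd, hDd⟩ : ∃ Dd, Dd = A.I (η ^ 2 * A.diss v) := ⟨_, rfl⟩
  have hW0 : 0 ≤ W := by
    rw [hW]
    refine A.I_nonneg (A.c.mul_mem_right _ hY) fun x => ?_
    have := B (v ^ 2) (by simp) x
    rw [map_mul]
    exact mul_nonneg (hY0 x) (this.1.trans this.2)
  have m := fun (r : ℝ) {F' : S} (hF' : F' ∈ A.c) (hb : ∀ x, |A.ev x F'| ≤ A.ev x (K • Y))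
      (Z : S) hZ => show -(r * A.I (F' * Z)) ≤ |r| * (K * W) by
      have e : K * W = A.I (K • Y * A.tot k l₁ l₂ v) := by rw [hW, smul_mul_assoc]; simp
      rw [e]
      refine (neg_le_abs _).trans ?_
      rw [abs_mul]
      exact mul_le_mul_of_nonneg_left
        (abs_I_mul_le hF' hKYc hb (fun x => (B Z hZ x).1) fun x => (B Z hZ x).2) (abs_nonneg _)
  have hF1 := A.D_mem hF
  have hF2 := A.D_mem hF1
  have hF3 := A.D_mem hF2
  have hF4 := A.D_mem hF3
  have c1 := m (3 * k) hF1 b1 (A.D v ^ 2) (by simp)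
  have c2 := m (k * (l₁ + 4) / 2) hF1 b1 (v ^ 2) (by simp)
  have c3 := m k hF1 b1 (A.Γ v v) (by simp)
  have c4 := m (-2) hF2 b2 (A.D v ^ 2) (by simp)
  have c5 := m ((k ^ 2 - 4 - l₁) / 2) hF2 b2 (v ^ 2) (by simp)
  have c6 := m (-1) hF2 b2 (A.Γ v v) (by simp)
  have c7 := m (-k) hF3 b3 (v ^ 2) (by simp)
  have c8 := m (1 / 2) hF4 b4 (v ^ 2) (by simp)
  have e := I_bilap_mul_self hF hFr k l₁ l₂ v
  have nn : ∀ Z ∈ ({v ^ 2, A.D v ^ 2, A.D (A.D v) ^ 2, A.Γ v v, A.Γ (A.D v) (A.D v), A.lapS v ^ 2,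
      A.bilap k l₁ l₂ v * v} : Set S), 0 ≤ A.I (η ^ 2 * Z) := fun Z hZ =>
    A.I_nonneg (A.c.mul_mem_right _ hF) fun x => by
      rw [map_mul, map_pow]; exact mul_nonneg (sq_nonneg _) (B Z hZ x).1
  have n1 := nn (A.lapS v ^ 2) (by simp)
  have n2 := nn (A.Γ v v) (by simp)
  have n3 := nn (v ^ 2) (by simp)
  have n4 := nn (A.D v ^ 2) (by simp)
  have n5 := nn (A.D (A.D v) ^ 2) (by simp)
  have n6 := nn (A.Γ (A.D v) (A.D v)) (by simp)
  have n7 := nn (A.bilap k l₁ l₂ v * v) (by simp)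
  have hDd' : Dd = A.I (η ^ 2 * A.D (A.D v) ^ 2) + A.I (η ^ 2 * A.D v ^ 2)
      + A.I (η ^ 2 * A.Γ (A.D v) (A.D v)) := by
    rw [hDd]; simp only [diss, mul_add, map_add]
  have hQ : A.I (A.quad c (η * v)) ≤ c ^ 2 * A.I (η ^ 2 * v ^ 2) + A.I (η ^ 2 * A.lapS v ^ 2)
      + 2 * c * A.I (η ^ 2 * A.Γ v v) + K1 * (Dd + W) := by
    have : A.I (A.quad c (η * v)) ≤ A.I (c ^ 2 • (η ^ 2 * v ^ 2) + η ^ 2 * A.lapS v ^ 2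
        + (2 * c) • (η ^ 2 * A.Γ v v) + (15 + 4 * c) • (η ^ 2 * A.diss v)
        + ((27 + 4 * c) * M) • (Y * A.tot k l₁ l₂ v)) := by
      refine I_mono (quad_mem (A.c.mul_mem_right _ hη) c) ?_ fun x => ?_
      · have := fun r y => smul_mem' (A.c.mul_mem_right y hF) r
        exact A.c.add_mem (A.c.add_mem (A.c.add_mem (A.c.add_mem (this _ _)
          (A.c.mul_mem_right _ hF)) (this _ _)) (this _ _)) (smul_mem' (A.c.mul_mem_right _ hY) _)
      · refine (ev_quad_mul_le hc hr v x).trans ?_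
        have t1 := B (v ^ 2) (by simp) x
        have t2 := B (A.D v ^ 2) (by simp) x
        have t3 := B (A.Γ v v) (by simp) x
        have q1 := (abs_le.1 (mm x _ _ (hd1 x) (hd1 x))).2
        have q2 := (abs_le.1 (mm x _ _ (hd2 x) (hd2 x))).2
        have hm := hMY0 x
        rw [map_pow] at t1 t2
        have r1 := mul_le_mul q2 t1.2 t1.1 hm
        have r2 : A.ev x (A.D η) ^ 2 * (12 * A.ev x (A.D v) ^ 2 + (8 + 4 * c) * A.ev x v ^ 2
            + 4 * A.ev x (A.Γ v v)) ≤
            M * A.ev x Y * ((24 + 4 * c) * A.ev x (A.tot k l₁ l₂ v)) := by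
          rw [sq]
          refine mul_le_mul q1 ?_ ?_ hm
          · have : (8 + 4 * c) * A.ev x v ^ 2 ≤ (8 + 4 * c) * A.ev x (A.tot k l₁ l₂ v) := by
              gcongr; exact t1.2
            linarith [t2.2, t3.2]
          · have := t3.1
            positivity
        simp only [map_add, map_mul, map_smul, smul_eq_mul, map_pow]
        linarith
    refine this.trans ?_
    simp only [map_add, map_smul, smul_eq_mul, ← hW, ← hDd, hK1]
    have a1 : 0 ≤ Dd := by linarith
    have a2 : 0 ≤ (27 + 4 * c) * M * Dd := by positivity
    have a3 : 0 ≤ (15 + 4 * c) * W := by positivity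
    linarith
  have hDd0 : 0 ≤ Dd := by linarith
  have hZ0 : 0 ≤ Dd + W := by linarith
  simp only [abs_neg, abs_one, abs_mul 3 k, abs_of_pos (show (0 : ℝ) < 1 / 2 by norm_num),
    abs_of_pos (show (0 : ℝ) < 3 by norm_num), abs_of_pos (show (0 : ℝ) < 2 by norm_num)]
    at c1 c2 c3 c4 c5 c6 c7 c8
  have c0 : (k ^ 2 - 4 - l₁) * A.I (η ^ 2 * A.D v ^ 2) ≤ |k ^ 2 - 4 - l₁| * Dd := by
    refine (mul_le_mul_of_nonneg_right (le_abs_self _) n4).trans ?_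
    gcongr; linarith
  have hlow : A.I (η ^ 2 * A.lapS v ^ 2) + l₁ * A.I (η ^ 2 * A.Γ v v) + l₂ * A.I (η ^ 2 * v ^ 2)
      - |k ^ 2 - 4 - l₁| * Dd - K3 * W ≤ A.I (η ^ 2 * (A.bilap k l₁ l₂ v * v)) := by
    rw [e, hK3]
    linarith
  have hmain : (p - 1) * A.I (η ^ 2 * A.lapS v ^ 2) + (p * l₁ - 2 * c) * A.I (η ^ 2 * A.Γ v v)
      + (p * l₂ - c ^ 2) * A.I (η ^ 2 * v ^ 2) ≤ K4 * (Dd + W) := by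
    have h := mul_le_mul_of_nonneg_left hlow hp0.le
    have a1 : 0 ≤ p * |k ^ 2 - 4 - l₁| * W := by positivity
    have a2 : 0 ≤ p * K3 * Dd := by positivity
    rw [hK4]
    linarith
  have p1 : 0 ≤ (p - 1) * A.I (η ^ 2 * A.lapS v ^ 2) := by positivity
  have p2 : 0 ≤ (p * l₁ - 2 * c) * A.I (η ^ 2 * A.Γ v v) := by positivity
  have p3 : 0 ≤ (p * l₂ - c ^ 2) * A.I (η ^ 2 * v ^ 2) := by positivity
  have x1 : A.I (η ^ 2 * A.lapS v ^ 2) ≤ K4 / (p - 1) * (Dd + W) := by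
    rw [div_mul_eq_mul_div, le_div_iff₀ hp1]; linarith
  have x2 : A.I (η ^ 2 * A.Γ v v) ≤ K4 / (p * l₁ - 2 * c) * (Dd + W) := by
    rw [div_mul_eq_mul_div, le_div_iff₀ hp2]; linarith
  have x3 : A.I (η ^ 2 * v ^ 2) ≤ K4 / (p * l₂ - c ^ 2) * (Dd + W) := by
    rw [div_mul_eq_mul_div, le_div_iff₀ hp3]; linarith
  have x4 : A.I (η ^ 2 * (A.bilap k l₁ l₂ v * v)) ≤ p * A.I (η ^ 2 * (A.bilap k l₁ l₂ v * v)) := by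
    have : 0 ≤ (p - 1) * A.I (η ^ 2 * (A.bilap k l₁ l₂ v * v)) := by positivity
    linarith
  have et : A.I (η ^ 2 * A.tot k l₁ l₂ v) = A.I (η ^ 2 * v ^ 2) + Dd + A.I (η ^ 2 * A.Γ v v)
      + A.I (η ^ 2 * A.lapS v ^ 2) + A.I (η ^ 2 * (A.bilap k l₁ l₂ v * v)) := by
    rw [hDd']; simp only [tot, en, mul_add, map_add]; ring
  rw [et, ← hW, ← hDd]
  have y3 := mul_le_mul_of_nonneg_left x3 (show 0 ≤ 1 + c ^ 2 by positivity)
  have y2 := mul_le_mul_of_nonneg_left x2 (show 0 ≤ 1 + 2 * c by positivity)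
  linarith

lemma rad_mul {f g : ℝ → ℝ} (hf : ContDiff ℝ ∞ f) (hg : ContDiff ℝ ∞ g) :
    A.rad (fun t => f t * g t) = A.rad f * A.rad g :=
  A.ext fun x => by rw [A.ev_rad (hf.mul hg), map_mul, A.ev_rad hf, A.ev_rad hg]

lemma rad_smul {f : ℝ → ℝ} (hf : ContDiff ℝ ∞ f) (r : ℝ) :
    A.rad (fun t => r * f t) = r • A.rad f :=
  A.ext fun x => by rw [A.ev_rad (contDiff_const.mul hf), map_smul, A.ev_rad hf, smul_eq_mul]

lemma rad_pow {f : ℝ → ℝ} (hf : ContDiff ℝ ∞ f) (m : ℕ) :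
    A.rad (fun t => f t ^ m) = A.rad f ^ m :=
  A.ext fun x => by rw [A.ev_rad (hf.pow m), map_pow, A.ev_rad hf]

lemma deriv_shift (f : ℝ → ℝ) (T : ℝ) : (deriv fun t => f (t - T)) = fun t => deriv f (t - T) := by
  funext t; exact deriv_comp_sub_const ..

lemma hasCompactSupport_shift {f : ℝ → ℝ} {a b : ℝ} (h0 : ∀ t ≤ a, f t = 0)
    (h1 : ∀ t, b ≤ t → f t = 0)
    (T : ℝ) : HasCompactSupport fun t => f (t - T) :=
  HasCompactSupport.intro (isCompact_Icc (a := a + T) (b := b + T)) fun t ht => by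
    simp only [Set.mem_Icc, not_and_or, not_le] at ht
    exact ht.elim (fun h => h0 _ (by linarith)) fun h => h1 _ (by linarith)

lemma I_rad_mul_exp {f : ℝ → ℝ} (hf : ContDiff ℝ ∞ f) (hc : HasCompactSupport f) (k T : ℝ) :
    A.I (A.rad fun t => f (t - T) * Real.exp (k * t)) =
      Real.exp (k * T) * A.I (A.rad fun t => f t * Real.exp (k * t)) := by
  have he : ContDiff ℝ ∞ fun t => f t * Real.exp (k * t) :=
    hf.mul (Real.contDiff_exp.comp (contDiff_const.mul contDiff_id))
  rw [← A.I_translate he hc.mul_right T, mul_I, ← rad_smul (contDiff_shift he T)]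
  congr 2
  funext t
  rw [show k * t = k * T + k * (t - T) by ring, Real.exp_add]
  ring

lemma young_window {p δ σ k t z X : ℝ} {j : ℕ} (hp : 1 < p) (hδ : 0 < δ) (hj : 4 / (p - 1) ≤ j + 1)
    (hk : k * (p - 1) = 2 * σ) (hz : 0 ≤ z) (hz1 : z ≤ 1) :
    (z ^ (j + 1)) ^ 2 * X ^ 2 ≤
      δ * ((z ^ (j + 3)) ^ 2 * (Real.exp (-σ * t) * |X| ^ (p + 1)))
        + δ ^ (-(2 / (p - 1))) * Real.exp (k * t) := by
  have hp' : 0 < p - 1 := by linarith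
  rcases hz.eq_or_lt with rfl | hz
  · simp; positivity
  rcases eq_or_ne X 0 with rfl | hX
  · rw [zero_pow two_ne_zero, mul_zero]; positivity
  obtain ⟨Y, hY'⟩ : ∃ Y, Y = |X| := ⟨_, rfl⟩
  have hY : 0 < Y := hY' ▸ abs_pos.2 hX
  rw [← sq_abs X, ← hY']
  by_contra! hlt
  have hE := Real.exp_pos (-σ * t)
  have h1 : δ * z ^ 4 * Real.exp (-σ * t) * Y ^ (p - 1) < 1 := by
    have h2 : δ * ((z ^ (j + 3)) ^ 2 * (Real.exp (-σ * t) * Y ^ (p + 1))) <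
        (z ^ (j + 1)) ^ 2 * Y ^ 2 := by
      have : 0 ≤ δ ^ (-(2 / (p - 1))) * Real.exp (k * t) := by positivity
      linarith
    have h3 : Y ^ (p + 1) = Y ^ (p - 1) * Y ^ 2 := by
      rw [← Real.rpow_natCast Y 2, ← Real.rpow_add hY]; congr 1; push_cast; ring
    rw [h3] at h2
    have h4 : (δ * z ^ 4 * Real.exp (-σ * t) * Y ^ (p - 1)) * ((z ^ (j + 1)) ^ 2 * Y ^ 2) <
        1 * ((z ^ (j + 1)) ^ 2 * Y ^ 2) := by
      refine lt_of_eq_of_lt ?_ (h2.trans_eq (one_mul _).symm); ring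
    exact lt_of_mul_lt_mul_right h4 (by positivity)
  have h2 := Real.rpow_le_one (z := 2 / (p - 1)) (by positivity) h1.le (by positivity)
  rw [Real.mul_rpow (by positivity) (by positivity), Real.mul_rpow (by positivity) hE.le,
    Real.mul_rpow hδ.le (by positivity), ← Real.rpow_mul hY.le, ← Real.exp_mul,
    ← Real.rpow_natCast z 4, ← Real.rpow_mul hz.le] at h2
  have e1 : (p - 1) * (2 / (p - 1)) = 2 := by field_simp
  have e2 : -σ * t * (2 / (p - 1)) = -(k * t) := by
    have : σ = k * (p - 1) / 2 := by linarith
    rw [this]; field_simp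
  rw [e1, e2, Real.rpow_two] at h2
  have h5 : (z ^ (j + 1)) ^ 2 ≤ z ^ (((4 : ℕ) : ℝ) * (2 / (p - 1))) := by
    rw [← pow_mul, ← Real.rpow_natCast]
    refine Real.rpow_le_rpow_of_exponent_ge hz hz1 ?_
    push_cast
    have : 4 * (2 / (p - 1)) = 4 / (p - 1) * 2 := by ring
    linarith
  have h6 : (z ^ (j + 1)) ^ 2 * Y ^ 2 ≤ δ ^ (-(2 / (p - 1))) * Real.exp (k * t) := by
    rw [Real.rpow_neg hδ.le]
    have hd : 0 < δ ^ (2 / (p - 1)) := by positivity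
    rw [Real.exp_neg] at h2
    have hx := Real.exp_pos (k * t)
    refine (mul_le_mul_of_nonneg_right h5 (sq_nonneg Y)).trans ?_
    rw [inv_mul_eq_div, le_div_iff₀ hd]
    have := mul_le_mul_of_nonneg_right h2 hx.le
    rw [one_mul] at this
    refine (le_of_eq ?_).trans this
    field_simp
  have : 0 ≤ δ * ((z ^ (j + 3)) ^ 2 * (Real.exp (-σ * t) * Y ^ (p + 1))) := by positivity
  linarith

/-- Smooth compactly supported windows equal to one on `[0, 1]`. -/
structure Window (χ : ℝ → ℝ) : Prop where
  smooth : ContDiff ℝ ∞ χ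
  nonneg : ∀ t, 0 ≤ χ t
  le_one : ∀ t, χ t ≤ 1
  eq_one : ∀ t, 0 ≤ t → t ≤ 1 → χ t = 1
  left : ∀ t ≤ -1, χ t = 0
  right : ∀ t, 2 ≤ t → χ t = 0


lemma exists_decay {p c σ k T₀ : ℝ} (hp : 1 < p) (hc : 0 < c) (hk : k * (p - 1) = 2 * σ) {w : S}
    (hG : ∀ x, A.ev x (A.bilap 0 (2 * c) (c ^ 2) w * w) =
      Real.exp (-σ * A.τ x) * |A.ev x w| ^ (p + 1))
    (hst : ∀ f, ContDiff ℝ ∞ f → HasCompactSupport f → (∀ t ≤ T₀, f t = 0) →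
      p * A.I (A.rad f ^ 2 * (A.bilap 0 (2 * c) (c ^ 2) w * w)) ≤ A.I (A.quad c (A.rad f * w))) :
    ∃ χ, Window χ ∧ ∃ C, 0 ≤ C ∧ ∀ T, T₀ + 1 ≤ T →
      A.I (A.rad (fun t => χ (t - T)) * A.tot 0 (2 * c) (c ^ 2) w) ≤ C * Real.exp (k * T) := by
  obtain ⟨j, hj⟩ := exists_nat_ge (4 / (p - 1))
  obtain ⟨ζ, g, B, hζ, hg, hB, z0, z1, zm, zl, zr, hd, bg, b2, b13, b1⟩ := exists_window j
  obtain ⟨C, hC, hcac⟩ := exists_caccioppoli (S := S) (X := X) (ι := ι) hp hc hB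
  have hh : ContDiff ℝ ∞ fun s => ζ s ^ (j + 3) := hζ.pow _
  have hθ : ContDiff ℝ ∞ fun s => ζ s ^ (j + 1) := hζ.pow _
  obtain ⟨δ, hδ⟩ : ∃ δ, δ = 1 / (2 * C) := ⟨_, rfl⟩
  have hδ0 : 0 < δ := by rw [hδ]; positivity
  have hb : ContDiff ℝ ∞ (ramp (-2) 2) := contDiff_ramp _ _
  have hbc : HasCompactSupport (ramp (-2) 2) := hasCompactSupport_ramp (by norm_num)
  obtain ⟨M, hM⟩ : ∃ M, M = A.I (A.rad fun t => ramp (-2) 2 t * Real.exp (k * t)) := ⟨_, rfl⟩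
  have hexp : ContDiff ℝ ∞ fun t => Real.exp (k * t) :=
    Real.contDiff_exp.comp (contDiff_const.mul contDiff_id)
  have hM0 : 0 ≤ M := by
    rw [hM]
    refine A.I_nonneg (A.rad_mem (hb.mul hexp) hbc.mul_right) fun x => ?_
    rw [A.ev_rad (hb.mul hexp)]
    exact mul_nonneg (ramp_nonneg (by norm_num) _) (Real.exp_pos _).le
  have hpos : ∀ x, 0 ≤ A.ev x (A.bilap 0 (2 * c) (c ^ 2) w * w) := fun x => by
    rw [hG]; positivity
  refine ⟨fun t => (ζ t ^ (j + 3)) ^ 2, ⟨hh.pow 2, fun t => sq_nonneg _, fun t =>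
    pow_le_one₀ (pow_nonneg (z0 t) _) (pow_le_one₀ (z0 t) (z1 t)), fun t h h' => by
      simp [zm t h h'], fun t h => by simp [zl t h], fun t h => by simp [zr t h]⟩,
    2 * C * (δ ^ (-(2 / (p - 1))) * M), by positivity, fun T hT => ?_⟩
  have cs : ∀ m : ℕ, HasCompactSupport fun t => ζ (t - T) ^ (m + 1) := fun m =>
    hasCompactSupport_shift (f := fun t => ζ t ^ (m + 1)) (a := -1) (b := 2)
      (fun t h => by simp [zl t h]) (fun t h => by simp [zr t h]) T
  obtain ⟨η, hη⟩ : ∃ η, η = A.rad fun t => ζ (t - T) ^ (j + 3) := ⟨_, rfl⟩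
  obtain ⟨θ, hθ'⟩ : ∃ θ, θ = A.rad fun t => ζ (t - T) ^ (j + 1) := ⟨_, rfl⟩
  have sη := contDiff_shift hh T
  have sθ := contDiff_shift hθ T
  have mη : η ∈ A.c := by rw [hη]; exact A.rad_mem sη (cs _)
  have mθ : θ ∈ A.c := by rw [hθ']; exact A.rad_mem sθ (cs _)
  have d1 : A.D η = A.rad fun t => deriv (fun s => ζ s ^ (j + 3)) (t - T) := by
    rw [hη, A.D_rad sη, deriv_shift (fun s => ζ s ^ (j + 3))]
  have d2 : A.D (A.D η) = A.rad fun t => deriv (deriv fun s => ζ s ^ (j + 3)) (t - T) := by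
    rw [d1, A.D_rad (contDiff_shift (contDiff_deriv' hh) T),
      deriv_shift (deriv fun s => ζ s ^ (j + 3))]
  have d3 : A.D (A.D (A.D η)) =
      A.rad fun t => deriv (deriv (deriv fun s => ζ s ^ (j + 3))) (t - T) := by
    rw [d2, A.D_rad (contDiff_shift (contDiff_deriv' (contDiff_deriv' hh)) T),
      deriv_shift (deriv (deriv fun s => ζ s ^ (j + 3)))]
  have s1 := contDiff_shift (contDiff_deriv' hh) T
  have s2 := contDiff_shift (contDiff_deriv' (contDiff_deriv' hh)) T
  have s3 := contDiff_shift (contDiff_deriv' (contDiff_deriv' (contDiff_deriv' hh))) T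
  have sg := contDiff_shift hg T
  have key := hcac A η (A.rad fun t => g (t - T)) θ w mη mθ (by rw [hη]; exact isRad_rad sη)
    (by rw [d1, hη, ← rad_pow s1, ← rad_mul sη sg]
        congr 1; funext t; exact hd (t - T))
    (fun x => by rw [hθ', A.ev_rad sg, A.ev_rad sθ]; exact bg _)
    (fun x => by rw [d2, hθ', A.ev_rad s2, A.ev_rad sθ]; exact b2 _)
    (fun x => by rw [d3, d1, hθ', A.ev_rad s3, A.ev_rad s1, A.ev_rad sθ]; exact b13 _)
    (fun x => by rw [d1, hθ', A.ev_rad s1, A.ev_rad sθ]; exact b1 _)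
    (by rw [hη]
        exact hst _ sη (cs _) fun t ht => by simp [zl (t - T) (by linarith)])
  have e2 : (A.rad fun t => (ζ (t - T) ^ (j + 3)) ^ 2) = η ^ 2 := by rw [hη]; exact rad_pow sη 2
  change A.I ((A.rad fun t => (ζ (t - T) ^ (j + 3)) ^ 2) * _) ≤ _
  rw [e2]
  have mη2 : η ^ 2 ∈ A.c := by rw [sq]; exact A.c.mul_mem_left _ mη
  have mθ2 : θ ^ 2 ∈ A.c := by rw [sq]; exact A.c.mul_mem_left _ mθ
  have sb : ContDiff ℝ ∞ fun t => ramp (-2) 2 (t - T) * Real.exp (k * t) :=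
    (contDiff_shift hb T).mul hexp
  have mb : (A.rad fun t => ramp (-2) 2 (t - T) * Real.exp (k * t)) ∈ A.c :=
    A.rad_mem sb (HasCompactSupport.mul_right (hasCompactSupport_shift (a := -2) (b := 2 + 1)
      (fun t h => ramp_of_le (by norm_num) h) (fun t h => ramp_of_ge (by norm_num) h) T))
  have est : A.I (θ ^ 2 * w ^ 2) ≤ δ * A.I (η ^ 2 * (A.bilap 0 (2 * c) (c ^ 2) w * w)) +
      δ ^ (-(2 / (p - 1))) * (Real.exp (k * T) * M) := by
    rw [hM, ← I_rad_mul_exp hb hbc, mul_I, mul_I, ← map_add]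
    refine I_mono (A.c.mul_mem_right _ mθ2) (A.c.add_mem (smul_mem' (A.c.mul_mem_right _ mη2) _)
      (smul_mem' mb _)) fun x => ?_
    simp only [map_add, map_smul, smul_eq_mul, map_mul _ (θ ^ 2), map_mul _ (η ^ 2), hG, map_pow]
    rw [hη, hθ', A.ev_rad sη, A.ev_rad sθ, A.ev_rad sb]
    by_cases hx : -1 ≤ A.τ x - T ∧ A.τ x - T ≤ 2
    · rw [ramp_eq_one (by linarith) hx.2, one_mul]
      exact young_window hp hδ0 (by linarith) hk (z0 _) (z1 _)
    · have hz : ζ (A.τ x - T) = 0 := by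
        rw [not_and_or, not_le, not_le] at hx
        exact hx.elim (fun h => zl _ h.le) fun h => zr _ h.le
      have := ramp_nonneg (show (-2 : ℝ) ≤ 2 by norm_num) (A.τ x - T)
      rw [hz]; simp only [zero_pow (Nat.succ_ne_zero _), zero_mul, mul_zero, zero_add]
      positivity
  have le : A.I (η ^ 2 * (A.bilap 0 (2 * c) (c ^ 2) w * w)) ≤
      A.I (η ^ 2 * A.tot 0 (2 * c) (c ^ 2) w) := by
    refine I_mono (A.c.mul_mem_right _ mη2) (A.c.mul_mem_right _ mη2) fun x => ?_
    rw [map_mul _ (η ^ 2), map_mul _ (η ^ 2)]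
    refine mul_le_mul_of_nonneg_left (ev_tot_bounds hpos (by simp) x).2 ?_
    rw [map_pow]; positivity
  have key' : A.I (η ^ 2 * A.tot 0 (2 * c) (c ^ 2) w) ≤ C * A.I (θ ^ 2 * w ^ 2) := key
  have hCδ : C * δ = 1 / 2 := by rw [hδ]; field_simp
  have := mul_le_mul_of_nonneg_left est hC.le
  have e3 : C * (δ * A.I (η ^ 2 * (A.bilap 0 (2 * c) (c ^ 2) w * w))) =
      1 / 2 * A.I (η ^ 2 * (A.bilap 0 (2 * c) (c ^ 2) w * w)) := by rw [← mul_assoc, hCδ]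
  rw [mul_add, e3] at this
  linarith

/-- The mass of `E` seen through the window `χ` placed at height `T`. -/
def win (A : CylCalc S X ι) (χ : ℝ → ℝ) (E : S) (T : ℝ) : ℝ :=
  A.I (A.rad (fun t => χ (t - T)) * E)

lemma Window.mem {χ : ℝ → ℝ} (h : Window χ) (T : ℝ) : A.rad (fun t => χ (t - T)) ∈ A.c :=
  A.rad_mem (contDiff_shift h.smooth T) (hasCompactSupport_shift h.left h.right T)

lemma Window.ev {χ : ℝ → ℝ} (h : Window χ) (T : ℝ) (x : X) :
    A.ev x (A.rad fun t => χ (t - T)) = χ (A.τ x - T) := A.ev_rad (contDiff_shift h.smooth T) x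

lemma Window.win_nonneg {χ : ℝ → ℝ} (h : Window χ) {E : S} (hE : ∀ x, 0 ≤ A.ev x E) (T : ℝ) :
    0 ≤ A.win χ E T :=
  A.I_nonneg (A.c.mul_mem_right _ (h.mem T)) fun x => by
    rw [map_mul, h.ev]; exact mul_nonneg (h.nonneg _) (hE x)

lemma ramp_mem {s T : ℝ} (h : s ≤ T) : A.rad (ramp s T) ∈ A.c :=
  A.rad_mem (contDiff_ramp s T) (hasCompactSupport_ramp h)

lemma ev_ramp (s T : ℝ) (x : X) : A.ev x (A.rad (ramp s T)) = ramp s T (A.τ x) :=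
  A.ev_rad (contDiff_ramp s T) x

lemma exists_pohozaev_ramp (k l₁ l₂ σ : ℝ) {p : ℝ} (hp : 1 < p) :
    ∃ C : ℝ, 0 ≤ C ∧ ∀ (A : CylCalc S X ι) (χ : ℝ → ℝ) (v : S), Window χ →
      (∀ x, 0 ≤ A.ev x (A.bilap k l₁ l₂ v * v)) →
      A.D (A.bilap k l₁ l₂ v * v) =
        (-σ) • (A.bilap k l₁ l₂ v * v) + (p + 1) • (A.bilap k l₁ l₂ v * A.D v) →
      ∀ s T, s ≤ T →
      |2 * k * A.I (A.rad (ramp s T) * A.D (A.D v) ^ 2)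
        + k * (l₁ + 4) * A.I (A.rad (ramp s T) * A.D v ^ 2)
        + 2 * k * A.I (A.rad (ramp s T) * A.Γ (A.D v) (A.D v))
        + σ / (p + 1) * A.I (A.rad (ramp s T) * (A.bilap k l₁ l₂ v * v))|
        ≤ C * (A.win χ (A.tot k l₁ l₂ v) s + A.win χ (A.tot k l₁ l₂ v) T) := by
  obtain ⟨C, hC, h⟩ := exists_pohozaev (S := S) (X := X) (ι := ι) k l₁ l₂ σ hp
  obtain ⟨M, hM, hb⟩ := exists_ramp_deriv_bound
  refine ⟨C * M, by positivity, fun A χ v hχ hN hD s T hsT => ?_⟩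
  have r1 := contDiff_ramp s T
  have r2 := contDiff_deriv' r1
  have r3 := contDiff_deriv' r2
  have r4 := contDiff_deriv' r3
  obtain ⟨Y, hY⟩ : ∃ Y, Y = M • (A.rad (fun t => χ (t - s)) + A.rad fun t => χ (t - T)) := ⟨_, rfl⟩
  have evY : ∀ x, A.ev x Y = M * (χ (A.τ x - s) + χ (A.τ x - T)) := fun x => by
    rw [hY, map_smul, map_add, hχ.ev, hχ.ev, smul_eq_mul]
  have hb' := hb χ hχ.nonneg hχ.eq_one s T
  have := h A (A.rad (ramp s T)) Y v (ramp_mem hsT) (isRad_rad r1)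
    (by rw [hY]; exact smul_mem' (A.c.add_mem (hχ.mem s) (hχ.mem T)) _)
    (fun x => by rw [A.D_rad r1, A.ev_rad r2, evY]; exact (hb' _).1)
    (fun x => by rw [A.D_rad r1, A.D_rad r2, A.ev_rad r3, evY]; exact (hb' _).2.1)
    (fun x => by rw [A.D_rad r1, A.D_rad r2, A.D_rad r3, A.ev_rad r4, evY]; exact (hb' _).2.2.1)
    hN hD
  refine this.trans (le_of_eq ?_)
  rw [hY, smul_mul_assoc, map_smul, add_mul, map_add, smul_eq_mul, win, win]
  ring

lemma eq_zero_of_frequently {Q : S} (hQ : ∀ x, 0 ≤ A.ev x Q) {W : ℝ → ℝ} {C : ℝ} (hC : 0 ≤ C)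
    (h : ∀ s T, s ≤ T → A.I (A.rad (ramp s T) * Q) ≤ C * (W s + W T))
    (h0 : Tendsto W atBot (𝓝 0)) (h1 : ∀ ε > 0, ∃ᶠ T in atTop, W T < ε) : Q = 0 := by
  refine A.ext fun x => ?_
  rw [map_zero]
  have hle : A.τ x - 1 ≤ A.τ x + 1 := by linarith
  have m0 := A.c.mul_mem_right Q (ramp_mem (A := A) hle)
  have n0 : ∀ y, 0 ≤ A.ev y (A.rad (ramp (A.τ x - 1) (A.τ x + 1)) * Q) := fun y => by
    rw [map_mul, ev_ramp]; exact mul_nonneg (ramp_nonneg hle _) (hQ y)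
  have hI : A.I (A.rad (ramp (A.τ x - 1) (A.τ x + 1)) * Q) = 0 := by
    refine le_antisymm (le_of_forall_pos_le_add fun ε hε => ?_) (A.I_nonneg m0 n0)
    have hε' : 0 < ε / (2 * (C + 1)) := by positivity
    obtain ⟨s, hs, hs'⟩ := ((h0.eventually_lt_const hε').and
      (eventually_le_atBot (A.τ x - 1))).exists
    obtain ⟨T, hT, hT'⟩ := ((h1 _ hε').and_eventually (eventually_ge_atTop (A.τ x + 1))).exists
    have hsT : s ≤ T := by linarith
    have := h s T hsT
    have h2 : A.I (A.rad (ramp (A.τ x - 1) (A.τ x + 1)) * Q) ≤ A.I (A.rad (ramp s T) * Q) :=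
      I_mono m0 (A.c.mul_mem_right _ (ramp_mem hsT)) fun y => by
        rw [map_mul, map_mul, ev_ramp, ev_ramp]
        exact mul_le_mul_of_nonneg_right (ramp_mono hs' hT' _) (hQ y)
    have h3 : C * (W s + W T) ≤ C * (ε / (C + 1)) := by
      refine mul_le_mul_of_nonneg_left ?_ hC
      have : ε / (2 * (C + 1)) + ε / (2 * (C + 1)) = ε / (C + 1) := by field_simp; ring
      linarith
    have h4 : C * (ε / (C + 1)) ≤ ε := by
      rw [mul_div_assoc', div_le_iff₀ (by positivity)]; nlinarith
    linarith
  have := congrArg (A.ev x) (A.I_faithful m0 n0 hI)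
  rwa [map_mul, ev_ramp, ramp_eq_one (by linarith) (by linarith), one_mul, map_zero] at this

lemma Window.tendsto_win_atBot {χ : ℝ → ℝ} (hχ : Window χ) {E : S} (hE : ∀ x, 0 ≤ A.ev x E)
    {m C : ℝ} (hm : 0 < m) (h : ∀ x, A.τ x ≤ 2 → A.ev x E ≤ C * Real.exp (m * A.τ x)) :
    Tendsto (A.win χ E) atBot (𝓝 0) := by
  have hexp : ContDiff ℝ ∞ fun t => Real.exp (m * t) :=
    Real.contDiff_exp.comp (contDiff_const.mul contDiff_id)
  have hcs : HasCompactSupport χ := by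
    simpa using hasCompactSupport_shift hχ.left hχ.right 0
  obtain ⟨M, hM⟩ : ∃ M, M = A.I (A.rad fun t => χ t * Real.exp (m * t)) := ⟨_, rfl⟩
  have lim : Tendsto (fun T => C * (Real.exp (m * T) * M)) atBot (𝓝 0) := by
    have : Tendsto (fun T => Real.exp (m * T)) atBot (𝓝 0) :=
      Real.tendsto_exp_atBot.comp (tendsto_id.const_mul_atBot hm)
    simpa using (this.mul_const M).const_mul C
  refine tendsto_of_tendsto_of_tendsto_of_le_of_le' tendsto_const_nhds lim
    (Eventually.of_forall fun T => hχ.win_nonneg hE T) ?_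
  filter_upwards [eventually_le_atBot 0] with T hT
  have sc : ContDiff ℝ ∞ fun t => χ (t - T) * Real.exp (m * t) :=
    (contDiff_shift hχ.smooth T).mul hexp
  rw [hM, ← I_rad_mul_exp hχ.smooth hcs, mul_I]
  refine I_mono (A.c.mul_mem_right _ (hχ.mem T)) (smul_mem' (A.rad_mem sc
    (HasCompactSupport.mul_right (hasCompactSupport_shift hχ.left hχ.right T))) _) fun x => ?_
  rw [map_mul, hχ.ev, map_smul, A.ev_rad sc, smul_eq_mul, mul_left_comm]
  by_cases hx : A.τ x - T ≤ 2
  · exact mul_le_mul_of_nonneg_left (h x (by linarith)) (hχ.nonneg _)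
  · rw [hχ.right _ (not_le.1 hx).le, zero_mul, zero_mul]

/-- Liouville property in the subcritical range. -/
theorem eq_zero_of_subcritical {p c σ k T₀ m C₀ : ℝ} (hp : 1 < p) (hc : 0 < c)
    (hk : k * (p - 1) = 2 * σ) (hk0 : k < 0) (hm : 0 < m) {w : S}
    (hG : ∀ x, A.ev x (A.bilap 0 (2 * c) (c ^ 2) w * w) =
      Real.exp (-σ * A.τ x) * |A.ev x w| ^ (p + 1))
    (hD : A.D (A.bilap 0 (2 * c) (c ^ 2) w * w) =
      (-σ) • (A.bilap 0 (2 * c) (c ^ 2) w * w) + (p + 1) • (A.bilap 0 (2 * c) (c ^ 2) w * A.D w))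
    (hst : ∀ f, ContDiff ℝ ∞ f → HasCompactSupport f → (∀ t ≤ T₀, f t = 0) →
      p * A.I (A.rad f ^ 2 * (A.bilap 0 (2 * c) (c ^ 2) w * w)) ≤ A.I (A.quad c (A.rad f * w)))
    (h0 : ∀ x, A.τ x ≤ 2 → A.ev x (A.tot 0 (2 * c) (c ^ 2) w) ≤ C₀ * Real.exp (m * A.τ x)) :
    w = 0 := by
  obtain ⟨χ, hχ, C, hC, hdec⟩ := exists_decay hp hc hk hG hst
  obtain ⟨C', hC', hpoh⟩ := exists_pohozaev_ramp (S := S) (X := X) (ι := ι) 0 (2 * c) (c ^ 2) σ hp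
  have hN : ∀ x, 0 ≤ A.ev x (A.bilap 0 (2 * c) (c ^ 2) w * w) := fun x => by rw [hG]; positivity
  have hE : ∀ x, 0 ≤ A.ev x (A.tot 0 (2 * c) (c ^ 2) w) := fun x =>
    (hN x).trans (ev_tot_bounds hN (by simp) x).2
  have hσ : σ < 0 := by nlinarith
  have hr : 0 < |σ / (p + 1)| := abs_pos.2 (div_ne_zero hσ.ne (by linarith))
  have hQ : A.bilap 0 (2 * c) (c ^ 2) w * w = 0 := by
    refine eq_zero_of_frequently hN (C := C' / |σ / (p + 1)|) (by positivity) (fun s T hsT => ?_)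
      (hχ.tendsto_win_atBot hE hm h0) fun ε hε => ?_
    · have := hpoh A χ w hχ hN hD s T hsT
      simp only [mul_zero, zero_mul, zero_add, abs_mul] at this
      have := (mul_le_mul_of_nonneg_left (le_abs_self _) hr.le).trans this
      rw [div_mul_eq_mul_div, le_div_iff₀ hr]
      linarith
    · have lim : Tendsto (fun T => C * Real.exp (k * T)) atTop (𝓝 0) := by
        have : Tendsto (fun T => Real.exp (k * T)) atTop (𝓝 0) :=
          Real.tendsto_exp_atBot.comp (tendsto_id.const_mul_atTop_of_neg hk0)
        simpa using this.const_mul C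
      refine Eventually.frequently ?_
      filter_upwards [lim.eventually_lt_const hε, eventually_ge_atTop (T₀ + 1)] with T h1 h2
      exact (hdec T h2).trans_lt h1
  refine A.ext fun x => ?_
  have := hG x
  rw [hQ, map_zero, zero_eq_mul] at this
  have := this.resolve_left (Real.exp_pos _).ne'
  rw [Real.rpow_eq_zero (abs_nonneg _) (by linarith), abs_eq_zero] at this
  rw [this, map_zero]

lemma contDiff_exp_mul (κ : ℝ) : ContDiff ℝ ∞ fun t : ℝ => Real.exp (κ * t) :=
  Real.contDiff_exp.comp (contDiff_const.mul contDiff_id)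

/-- The exponential weight `exp (κ τ)`. -/
noncomputable def wt (A : CylCalc S X ι) (κ : ℝ) : S := A.rad fun t => Real.exp (κ * t)

lemma ev_wt (κ : ℝ) (x : X) : A.ev x (A.wt κ) = Real.exp (κ * A.τ x) :=
  A.ev_rad (contDiff_exp_mul κ) x

lemma isRad_wt (κ : ℝ) : A.IsRad (A.wt κ) := isRad_rad (contDiff_exp_mul κ)

lemma D_wt (κ : ℝ) : A.D (A.wt κ) = κ • A.wt κ := by
  rw [wt, A.D_rad (contDiff_exp_mul κ), ← rad_smul (contDiff_exp_mul κ)]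
  congr 1; funext t
  have : HasDerivAt (fun t => Real.exp (κ * t)) _ t := ((hasDerivAt_id t).const_mul κ).exp
  rw [this.deriv]
  simp [mul_comm]

lemma wt_mul_wt (κ μ : ℝ) : A.wt κ * A.wt μ = A.wt (κ + μ) :=
  A.ext fun x => by rw [map_mul, ev_wt, ev_wt, ev_wt, ← Real.exp_add]; ring_nf

lemma wt_zero : A.wt 0 = 1 := A.ext fun x => by rw [ev_wt, map_one, zero_mul, Real.exp_zero]

lemma D_wt_mul (κ : ℝ) (w : S) : A.D (A.wt κ * w) = A.wt κ * (κ • w + A.D w) := by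
  rw [Derivation.leibniz, D_wt, smul_eq_mul, smul_eq_mul, mul_add, mul_smul_comm, mul_smul_comm,
    mul_comm w, add_comm]

lemma ev_en_wt_mul_le (κ : ℝ) (w : S) (x : X) : A.ev x (A.en (A.wt κ * w)) ≤
    3 * (κ ^ 4 + 4 * κ ^ 2 + 1) * (Real.exp (2 * κ * A.τ x) * A.ev x (A.en w)) := by
  have hd2 : A.D (A.D (A.wt κ * w)) =
      A.wt κ * (κ ^ 2 • w + (2 * κ) • A.D w + A.D (A.D w)) := by
    rw [D_wt_mul, D_wt_mul, map_add, Derivation.map_smul, smul_add, smul_smul]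
    congr 1; module
  have hΓ := A.ev_Γ_add_le (κ • w) (A.D w) x
  have h0 := A.ev_Γ_self_nonneg w x
  have h1 := A.ev_Γ_self_nonneg (A.D w) x
  rw [Γ_smul, Γ_smul_right, map_smul, map_smul, smul_eq_mul, smul_eq_mul] at hΓ
  rw [en, hd2, D_wt_mul, (isRad_wt κ).Γ_mul, (isRad_wt κ).Γ_mul_right, (isRad_wt κ).Γ_mul,
    (isRad_wt κ).Γ_mul_right, (isRad_wt κ).lapS_mul]
  have he : Real.exp (2 * κ * A.τ x) = A.ev x (A.wt κ) ^ 2 := by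
    rw [ev_wt, ← Real.exp_nat_mul]; congr 1; push_cast; ring
  rw [he]
  have hlhs : A.ev x ((A.wt κ * w) ^ 2 + (A.wt κ * (κ • w + A.D w)) ^ 2
      + (A.wt κ * (κ ^ 2 • w + (2 * κ) • A.D w + A.D (A.D w))) ^ 2
      + A.wt κ * (A.wt κ * A.Γ w w) + A.wt κ * (A.wt κ * A.Γ (κ • w + A.D w) (κ • w + A.D w))
      + (A.wt κ * A.lapS w) ^ 2) = A.ev x (A.wt κ) ^ 2 * (A.ev x w ^ 2
        + (κ * A.ev x w + A.ev x (A.D w)) ^ 2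
        + (κ ^ 2 * A.ev x w + 2 * κ * A.ev x (A.D w) + A.ev x (A.D (A.D w))) ^ 2
        + A.ev x (A.Γ w w) + A.ev x (A.Γ (κ • w + A.D w) (κ • w + A.D w))
        + A.ev x (A.lapS w) ^ 2) := by
    simp only [map_add, map_mul, map_pow, map_smul, smul_eq_mul]; ring
  rw [hlhs, mul_left_comm]
  refine mul_le_mul_of_nonneg_left ?_ (sq_nonneg _)
  simp only [en, map_add, map_pow]
  generalize A.ev x (A.Γ (κ • w + A.D w) (κ • w + A.D w)) = q at *
  generalize A.ev x w = a at *
  generalize A.ev x (A.D w) = b at *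
  generalize A.ev x (A.D (A.D w)) = d at *
  generalize A.ev x (A.Γ w w) = e at *
  generalize A.ev x (A.Γ (A.D w) (A.D w)) = f at *
  generalize A.ev x (A.lapS w) = g at *
  have i1 : (κ * a + b) ^ 2 ≤ 2 * (κ ^ 2 * a ^ 2 + b ^ 2) := by nlinarith [sq_nonneg (κ * a - b)]
  have i2 : (κ ^ 2 * a + 2 * κ * b + d) ^ 2 ≤ 3 * (κ ^ 4 * a ^ 2 + 4 * κ ^ 2 * b ^ 2 + d ^ 2) := by
    nlinarith [sq_nonneg (κ ^ 2 * a - 2 * κ * b), sq_nonneg (κ ^ 2 * a - d),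
      sq_nonneg (2 * κ * b - d)]
  have z1 : 0 ≤ κ ^ 2 := sq_nonneg _
  have z2 : 0 ≤ κ ^ 4 := by positivity
  have m1 : ∀ y : ℝ, 0 ≤ y → 0 ≤ κ ^ 2 * y ∧ 0 ≤ κ ^ 4 * y := fun y hy =>
    ⟨mul_nonneg z1 hy, mul_nonneg z2 hy⟩
  have a0 := m1 _ (sq_nonneg a)
  have b0 := m1 _ (sq_nonneg b)
  have d0 := m1 _ (sq_nonneg d)
  have e0 := m1 _ h0
  have f0 := m1 _ h1
  have g0 := m1 _ (sq_nonneg g)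
  nlinarith [sq_nonneg a, sq_nonneg b, sq_nonneg d, sq_nonneg g]

lemma frequently_lt_of_telescope {V W : ℝ → ℝ} {K a : ℝ} (h0 : ∀ T, a ≤ T → 0 ≤ V T)
    (hK : ∀ T, a ≤ T → V T ≤ K) (h : ∀ T, a ≤ T → W (T + 2) ≤ V (T + 4) - V T) {ε : ℝ}
    (hε : 0 < ε) : ∃ᶠ T in atTop, W T < ε := by
  intro hev
  simp only [not_lt] at hev
  obtain ⟨b, hb⟩ := eventually_atTop.1 hev
  have grow : ∀ j : ℕ, j * ε ≤ V (max a b + 4 * j) := fun j => by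
    induction j with
    | zero => simpa using h0 _ (le_max_left a b)
    | succ j ih =>
      have hj : (0 : ℝ) ≤ j := j.cast_nonneg
      have h1 := h (max a b + 4 * j) (by linarith [le_max_left a b])
      have h2 := hb (max a b + 4 * j + 2) (by linarith [le_max_right a b])
      push_cast
      rw [show max a b + 4 * ((j : ℝ) + 1) = max a b + 4 * j + 4 by ring]
      linarith
  obtain ⟨j, hj⟩ := exists_nat_gt (K / ε)
  rw [div_lt_iff₀ hε] at hj
  have := hK (max a b + 4 * j) (by have : (0 : ℝ) ≤ j := j.cast_nonneg
                                   linarith [le_max_left a b])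
  linarith [grow j]

lemma eq_zero_of_D_eq_zero {χ : ℝ → ℝ} (hχ : Window χ) {v E : S} (hv : A.D v = 0)
    (hvE : ∀ x, A.ev x (v ^ 2) ≤ A.ev x E) (h0 : Tendsto (A.win χ E) atBot (𝓝 0)) : v = 0 := by
  have p0 : ContDiff ℝ ∞ Real.smoothTransition := Real.smoothTransition.contDiff
  have p1 := contDiff_deriv' p0
  have z1 := deriv_eq_zero_off_unit (f := Real.smoothTransition) 0 1
    (fun t ht => Real.smoothTransition.zero_of_nonpos ht.le)
    (fun t ht => Real.smoothTransition.one_of_one_le ht.le)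
  have cs : HasCompactSupport (deriv Real.smoothTransition) :=
    HasCompactSupport.intro (isCompact_Icc (a := 0) (b := 1)) fun t ht => by
      simp only [Set.mem_Icc, not_and_or, not_le] at ht
      exact ht.elim (z1 t).1 (z1 t).2
  have nn : ∀ t, 0 ≤ deriv Real.smoothTransition t := fun t =>
    Real.smoothTransition.monotone.deriv_nonneg
  obtain ⟨M, hM, hb⟩ := exists_bound p1 cs
  have cT : ∀ T, HasCompactSupport fun t => deriv Real.smoothTransition (t - T) := fun T =>
    hasCompactSupport_shift (a := -1) (b := 2) (fun t ht => (z1 t).1 (by linarith))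
      (fun t ht => (z1 t).2 (by linarith)) T
  have mT : ∀ T, A.rad (fun t => deriv Real.smoothTransition (t - T)) ∈ A.c := fun T =>
    A.rad_mem (contDiff_shift p1 T) (cT T)
  have nT : ∀ T x, 0 ≤ A.ev x (A.rad (fun t => deriv Real.smoothTransition (t - T)) * v ^ 2) :=
    fun T x => by
      rw [map_mul, A.ev_rad (contDiff_shift p1 T), map_pow]
      exact mul_nonneg (nn _) (sq_nonneg _)
  have const : ∀ s T, s ≤ T → A.I (A.rad (fun t => deriv Real.smoothTransition (t - T)) * v ^ 2) =
      A.I (A.rad (fun t => deriv Real.smoothTransition (t - s)) * v ^ 2) := fun s T hsT => by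
    have := I_D_mul_self (ramp_mem (A := A) hsT) v
    have e : A.D (A.rad (ramp s T)) = A.rad (fun t => deriv Real.smoothTransition (t - s))
        - A.rad fun t => deriv Real.smoothTransition (t - T) := A.ext fun x => by
      have e1 : deriv (ramp s T) = _ := deriv_shift_sub p0 s T
      rw [A.D_rad (contDiff_ramp s T), A.ev_rad (contDiff_deriv' (contDiff_ramp s T)), map_sub,
        A.ev_rad (contDiff_shift p1 s), A.ev_rad (contDiff_shift p1 T), e1]
    rw [hv, zero_mul, mul_zero, map_zero, e, sub_mul, map_sub] at this
    linarith
  have zero : ∀ T, A.I (A.rad (fun t => deriv Real.smoothTransition (t - T)) * v ^ 2) = 0 :=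
    fun T => by
      refine le_antisymm ?_ (A.I_nonneg (A.c.mul_mem_right _ (mT T)) (nT T))
      have lim := h0.const_mul M
      rw [mul_zero] at lim
      refine ge_of_tendsto lim ?_
      filter_upwards [eventually_le_atBot T] with s hs
      rw [const s T hs, win, mul_I]
      refine I_mono (A.c.mul_mem_right _ (mT s)) (smul_mem' (A.c.mul_mem_right _ (hχ.mem s)) _)
        fun x => ?_
      rw [map_mul, A.ev_rad (contDiff_shift p1 s), map_smul, map_mul, hχ.ev, smul_eq_mul,
        ← mul_assoc]
      refine mul_le_mul ?_ (hvE x) (by rw [map_pow]; positivity) (mul_nonneg hM (hχ.nonneg _))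
      by_cases h : A.τ x - s < 0
      · rw [(z1 _).1 h]; exact mul_nonneg hM (hχ.nonneg _)
      by_cases h' : 1 < A.τ x - s
      · rw [(z1 _).2 h']; exact mul_nonneg hM (hχ.nonneg _)
      rw [hχ.eq_one _ (not_lt.1 h) (not_lt.1 h'), mul_one]
      exact (le_abs_self _).trans (hb _)
  obtain ⟨ξ, -, hξ⟩ := exists_deriv_eq_slope Real.smoothTransition zero_lt_one
    p0.continuous.continuousOn (differentiable_of_smooth p0).differentiableOn
  rw [Real.smoothTransition.one_of_one_le le_rfl, Real.smoothTransition.zero_of_nonpos le_rfl] at hξ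
  refine A.ext fun x => ?_
  have := congrArg (A.ev x) (A.I_faithful (A.c.mul_mem_right _ (mT (A.τ x - ξ)))
    (nT (A.τ x - ξ)) (zero _))
  rw [map_mul, A.ev_rad (contDiff_shift p1 _), sub_sub_cancel, hξ, map_zero, map_pow] at this
  rw [map_zero]
  norm_num at this
  exact this

set_option maxHeartbeats 800000 in
/-- Liouville property in the supercritical range. -/
theorem eq_zero_of_supercritical {p c σ k l₁ l₂ T₀ m C₀ : ℝ} (hp : 1 < p) (hc : 0 < c)
    (hk : k * (p - 1) = 2 * σ) (hk0 : 0 < k) (hm : k < m) (h₁ : 2 * c < p * l₁)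
    (h₂ : c ^ 2 < p * l₂) {w : S}
    (hG : ∀ x, A.ev x (A.bilap 0 (2 * c) (c ^ 2) w * w) =
      Real.exp (-σ * A.τ x) * |A.ev x w| ^ (p + 1))
    (hD : A.D (A.bilap 0 (2 * c) (c ^ 2) w * w) =
      (-σ) • (A.bilap 0 (2 * c) (c ^ 2) w * w) + (p + 1) • (A.bilap 0 (2 * c) (c ^ 2) w * A.D w))
    (hst : ∀ f, ContDiff ℝ ∞ f → HasCompactSupport f → (∀ t ≤ T₀, f t = 0) →
      p * A.I (A.rad f ^ 2 * (A.bilap 0 (2 * c) (c ^ 2) w * w)) ≤ A.I (A.quad c (A.rad f * w)))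
    (h0 : ∀ x, A.τ x ≤ 2 → A.ev x (A.tot 0 (2 * c) (c ^ 2) w) ≤ C₀ * Real.exp (m * A.τ x))
    (hv : A.bilap k l₁ l₂ (A.wt (-(k / 2)) * w) =
      A.wt (-(k / 2)) * A.bilap 0 (2 * c) (c ^ 2) w) :
    w = 0 := by
  obtain ⟨v, hvw⟩ : ∃ v, v = A.wt (-(k / 2)) * w := ⟨_, rfl⟩
  rw [← hvw] at hv
  have hwv : w = A.wt (k / 2) * v := by
    rw [hvw, ← mul_assoc, wt_mul_wt, add_neg_cancel, wt_zero, one_mul]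
  obtain ⟨G, hGdef⟩ : ∃ G, G = A.bilap 0 (2 * c) (c ^ 2) w * w := ⟨_, rfl⟩
  have hN : ∀ x, 0 ≤ A.ev x G := fun x => by rw [hGdef, hG]; positivity
  have hNv : A.bilap k l₁ l₂ v * v = A.wt (-k) * G := by
    rw [hv, hvw, hGdef, show -k = -(k / 2) + -(k / 2) by ring, ← wt_mul_wt]; ring
  have hNv0 : ∀ x, 0 ≤ A.ev x (A.bilap k l₁ l₂ v * v) := fun x => by
    rw [hNv, map_mul, ev_wt]; exact mul_nonneg (Real.exp_pos _).le (hN x)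
  have hDv : A.D (A.bilap k l₁ l₂ v * v) = (-(0 : ℝ)) • (A.bilap k l₁ l₂ v * v)
      + (p + 1) • (A.bilap k l₁ l₂ v * A.D v) := by
    have e1 : A.bilap k l₁ l₂ v * A.D v = A.wt (-k) * ((-(k / 2)) • G
        + A.bilap 0 (2 * c) (c ^ 2) w * A.D w) := by
      rw [hv, hvw, D_wt_mul, hGdef, show -k = -(k / 2) + -(k / 2) by ring, ← wt_mul_wt,
        Algebra.smul_def, Algebra.smul_def]
      generalize (algebraMap ℝ S) (-(k / 2)) = r
      ring
    rw [e1, hNv, D_wt_mul, hGdef, hD, neg_zero, zero_smul, zero_add,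
      ← mul_smul_comm (p + 1) (A.wt (-k))]
    congr 1
    have : σ = k * (p - 1) / 2 := by linarith
    rw [this]
    module
  have hE : ∀ x, 0 ≤ A.ev x (A.tot k l₁ l₂ v) := fun x =>
    (hNv0 x).trans (ev_tot_bounds hNv0 (by simp) x).2
  obtain ⟨C₁, hC₁⟩ : ∃ C₁ : ℝ, C₁ = 3 * ((-(k / 2)) ^ 4 + 4 * (-(k / 2)) ^ 2 + 1) := ⟨_, rfl⟩
  have hC₁1 : 1 ≤ C₁ := by rw [hC₁]; nlinarith [sq_nonneg (k / 2), sq_nonneg ((k / 2) ^ 2)]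
  have htot : ∀ x, A.ev x (A.tot k l₁ l₂ v) ≤
      C₁ * (Real.exp (-k * A.τ x) * A.ev x (A.tot 0 (2 * c) (c ^ 2) w)) := fun x => by
    have h := ev_en_wt_mul_le (A := A) (-(k / 2)) w x
    rw [← hvw, ← hC₁, show 2 * -(k / 2) = -k by ring] at h
    rw [tot, tot, map_add, map_add, hNv, map_mul, ev_wt, ← hGdef, mul_add, mul_add]
    refine add_le_add h (le_mul_of_one_le_left ?_ hC₁1)
    exact mul_nonneg (Real.exp_pos _).le (hN x)
  obtain ⟨χ, hχ, C, hC, hdec⟩ := exists_decay hp hc hk hG hst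
  obtain ⟨W, hW⟩ : ∃ W, W = A.win χ (A.tot k l₁ l₂ v) := ⟨_, rfl⟩
  have hW0 : ∀ T, 0 ≤ W T := fun T => by rw [hW]; exact hχ.win_nonneg hE T
  have hEw : ∀ x, 0 ≤ A.ev x (A.tot 0 (2 * c) (c ^ 2) w) := fun x => by
    rw [hGdef] at hN
    exact (hN x).trans (ev_tot_bounds hN (by simp) x).2
  obtain ⟨K, hK⟩ : ∃ K, K = C₁ * Real.exp k * C := ⟨_, rfl⟩
  have hWK : ∀ T, T₀ + 1 ≤ T → W T ≤ K := fun T hT => by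
    have h1 : W T ≤ C₁ * Real.exp k * Real.exp (-(k * T)) *
        A.I (A.rad (fun t => χ (t - T)) * A.tot 0 (2 * c) (c ^ 2) w) := by
      rw [hW, win, mul_I]
      refine I_mono (A.c.mul_mem_right _ (hχ.mem T)) (smul_mem' (A.c.mul_mem_right _ (hχ.mem T)) _)
        fun x => ?_
      rw [map_mul, map_smul, map_mul, hχ.ev, smul_eq_mul, mul_left_comm]
      by_cases hx : A.τ x - T ≤ -1
      · rw [hχ.left _ hx, zero_mul, zero_mul]
      refine mul_le_mul_of_nonneg_left ((htot x).trans ?_) (hχ.nonneg _)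
      rw [mul_assoc C₁, ← Real.exp_add, mul_assoc]
      refine mul_le_mul_of_nonneg_left (mul_le_mul_of_nonneg_right (Real.exp_le_exp.2 ?_) (hEw x))
        (by linarith)
      nlinarith
    refine h1.trans ((mul_le_mul_of_nonneg_left (hdec T hT) (by positivity)).trans (le_of_eq ?_))
    rw [hK, mul_mul_mul_comm, Real.exp_neg]
    have := (Real.exp_pos (k * T)).ne'
    field_simp
  have hWbot : Tendsto W atBot (𝓝 0) := by
    rw [hW]
    refine hχ.tendsto_win_atBot hE (m := m - k) (C := C₁ * C₀) (by linarith) fun x hx => ?_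
    refine (htot x).trans ?_
    have := mul_le_mul_of_nonneg_left (h0 x hx) (Real.exp_pos (-k * A.τ x)).le
    have := mul_le_mul_of_nonneg_left this (show 0 ≤ C₁ by linarith)
    refine this.trans (le_of_eq ?_)
    rw [show (m - k) * A.τ x = -k * A.τ x + m * A.τ x by ring, Real.exp_add]
    ring
  obtain ⟨C', hC', hpoh⟩ := exists_pohozaev_ramp (S := S) (X := X) (ι := ι) k l₁ l₂ 0 hp
  have hl : 0 < l₁ := by
    by_contra! h
    nlinarith
  have hdiss : ∀ s T, s ≤ T → A.I (A.rad (ramp s T) * A.diss v) ≤ C' / (2 * k) * (W s + W T) := by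
    intro s T hsT
    have h1 := hpoh A χ v hχ hNv0 hDv s T hsT
    rw [zero_div, zero_mul, add_zero, ← hW] at h1
    have h2 := (le_abs_self _).trans h1
    have h3 : 0 ≤ A.I (A.rad (ramp s T) * A.D v ^ 2) :=
      A.I_nonneg (A.c.mul_mem_right _ (ramp_mem hsT)) fun x => by
        rw [map_mul, ev_ramp, map_pow]
        exact mul_nonneg (ramp_nonneg hsT _) (sq_nonneg _)
    have h4 := mul_nonneg (mul_nonneg hk0.le (by linarith : 0 ≤ l₁ + 2)) h3
    rw [diss, mul_add, mul_add, map_add, map_add, div_mul_eq_mul_div, le_div_iff₀ (by linarith)]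
    linarith
  obtain ⟨M, hM, hb⟩ := exists_ramp_deriv_bound
  obtain ⟨C₂, hC₂, hen⟩ := exists_energy (S := S) (X := X) (ι := ι) (k := k) hp hc h₁ h₂
    (M := 2 * M) (by positivity)
  obtain ⟨V, hV⟩ : ∃ V : ℝ → ℝ, V = fun T => A.I (A.rad (ramp (T₀ + 1) T) ^ 2 *
    A.tot k l₁ l₂ v) := ⟨_, rfl⟩
  have m2 : ∀ T, T₀ + 1 ≤ T → A.rad (ramp (T₀ + 1) T) ^ 2 ∈ A.c := fun T hT => by
    rw [sq]; exact A.c.mul_mem_left _ (ramp_mem hT)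
  have hVK : ∀ T, T₀ + 1 ≤ T → V T ≤ C₂ * (C' / (2 * k) * (K + K) + M * (K + K)) := by
    intro T hT
    have r1 := contDiff_ramp (T₀ + 1) T
    have r2 := contDiff_deriv' r1
    have r3 := contDiff_deriv' r2
    have r4 := contDiff_deriv' r3
    have r5 := contDiff_deriv' r4
    obtain ⟨Y, hY⟩ : ∃ Y, Y = M • (A.rad (fun t => χ (t - (T₀ + 1))) + A.rad fun t => χ (t - T)) :=
      ⟨_, rfl⟩
    have evY : ∀ x, A.ev x Y = M * (χ (A.τ x - (T₀ + 1)) + χ (A.τ x - T)) := fun x => by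
      rw [hY, map_smul, map_add, hχ.ev, hχ.ev, smul_eq_mul]
    have hb' := hb χ hχ.nonneg hχ.eq_one (T₀ + 1) T
    have h := hen A (A.rad (ramp (T₀ + 1) T)) Y v (ramp_mem hT) (isRad_rad r1)
      (by rw [hY]; exact smul_mem' (A.c.add_mem (hχ.mem _) (hχ.mem T)) _)
      (fun x => by rw [ev_ramp, abs_of_nonneg (ramp_nonneg hT _)]; exact ramp_le_one _ _ _)
      (fun x => by
        rw [evY]
        nlinarith [hχ.le_one (A.τ x - (T₀ + 1)), hχ.le_one (A.τ x - T)])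
      (fun x => by rw [A.D_rad r1, A.ev_rad r2, evY]; exact (hb' _).1)
      (fun x => by rw [A.D_rad r1, A.D_rad r2, A.ev_rad r3, evY]; exact (hb' _).2.1)
      (fun x => by
        rw [A.D_rad r1, A.D_rad r2, A.D_rad r3, A.ev_rad r4, evY]; exact (hb' _).2.2.1)
      (fun x => by
        rw [A.D_rad r1, A.D_rad r2, A.D_rad r3, A.D_rad r4, A.ev_rad r5, evY]
        exact (hb' _).2.2.2)
      hNv0 (by
        have sf : ContDiff ℝ ∞ fun t => ramp (T₀ + 1) T t * Real.exp (-(k / 2) * t) :=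
          r1.mul (contDiff_exp_mul _)
        have := hst _ sf (hasCompactSupport_ramp hT).mul_right fun t ht => by
          rw [ramp_of_le hT (by linarith), zero_mul]
        rw [rad_mul r1 (contDiff_exp_mul _)] at this
        have e1 : A.rad (ramp (T₀ + 1) T) * A.rad (fun t => Real.exp (-(k / 2) * t)) * w =
            A.rad (ramp (T₀ + 1) T) * v := by rw [mul_assoc, hvw, wt]
        have e2 : (A.rad (ramp (T₀ + 1) T) * A.rad (fun t => Real.exp (-(k / 2) * t))) ^ 2 *
            (A.bilap 0 (2 * c) (c ^ 2) w * w) =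
            A.rad (ramp (T₀ + 1) T) ^ 2 * (A.bilap k l₁ l₂ v * v) := by
          rw [hNv, ← hGdef, show -k = -(k / 2) + -(k / 2) by ring, ← wt_mul_wt, wt]; ring
        rwa [e1, e2] at this)
    rw [hV]
    refine h.trans (mul_le_mul_of_nonneg_left (add_le_add ?_ ?_) hC₂)
    · refine le_trans ?_ ((hdiss (T₀ + 1) T hT).trans (mul_le_mul_of_nonneg_left
        (add_le_add (hWK _ le_rfl) (hWK _ hT)) (by positivity)))
      refine I_mono (A.c.mul_mem_right _ (m2 T hT)) (A.c.mul_mem_right _ (ramp_mem hT)) fun x => ?_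
      rw [map_mul, map_mul, map_pow, ev_ramp]
      refine mul_le_mul_of_nonneg_right ?_ (ev_diss_nonneg v x)
      have := ramp_nonneg hT (A.τ x)
      have := ramp_le_one (T₀ + 1) T (A.τ x)
      nlinarith
    · have : A.I (Y * A.tot k l₁ l₂ v) = M * (W (T₀ + 1) + W T) := by
        rw [hY, smul_mul_assoc, map_smul, add_mul, map_add, smul_eq_mul, hW, win, win]
      rw [this]
      exact mul_le_mul_of_nonneg_left (add_le_add (hWK _ le_rfl) (hWK _ hT)) hM
  have hWV : ∀ T, T₀ + 1 ≤ T → W (T + 2) ≤ V (T + 4) - V T := by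
    intro T hT
    have hT4 : T₀ + 1 ≤ T + 4 := by linarith
    rw [hV, hW, win, ← map_sub, ← sub_mul]
    refine I_mono (A.c.mul_mem_right _ (hχ.mem _)) (A.c.mul_mem_right _
      (A.c.sub_mem (m2 _ hT4) (m2 _ hT))) fun x => ?_
    rw [map_mul, map_mul, hχ.ev, map_sub, map_pow, map_pow, ev_ramp, ev_ramp]
    refine mul_le_mul_of_nonneg_right ?_ (hE x)
    have i1 := ramp_nonneg hT (A.τ x)
    have i2 := ramp_mono le_rfl (show T ≤ T + 4 by linarith) (A.τ x) (s := T₀ + 1)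
    by_cases hl : A.τ x - (T + 2) ≤ -1
    · rw [hχ.left _ hl]; nlinarith
    by_cases hr : 2 ≤ A.τ x - (T + 2)
    · rw [hχ.right _ hr]; nlinarith
    push Not at hl hr
    rw [ramp_of_ge hT (by linarith), ramp_eq_one (by linarith) (by linarith)]
    linarith [hχ.le_one (A.τ x - (T + 2))]
  have hV0 : ∀ T, T₀ + 1 ≤ T → 0 ≤ V T := fun T hT => by
    rw [hV]
    refine A.I_nonneg (A.c.mul_mem_right _ (m2 T hT)) fun x => ?_
    rw [map_mul, map_pow]; exact mul_nonneg (sq_nonneg _) (hE x)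
  have hQ := eq_zero_of_frequently (A := A) (ev_diss_nonneg v) (by positivity) hdiss hWbot
    fun ε hε => frequently_lt_of_telescope hV0 hVK hWV hε
  have hv0 : v = 0 := by
    refine eq_zero_of_D_eq_zero hχ (A.ext fun x => ?_)
      (fun x => (ev_tot_bounds hNv0 (by simp) x).2) (hW ▸ hWbot)
    have h := congrArg (A.ev x) hQ
    have := A.ev_Γ_self_nonneg (A.D v) x
    simp only [diss, map_add, map_pow, map_zero] at h ⊢
    nlinarith [sq_nonneg (A.ev x (A.D v)), sq_nonneg (A.ev x (A.D (A.D v)))]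
  rw [hwv, hv0, mul_zero]

/-- The Euclidean Laplacian in cylindrical coordinates; `m + 2` is the dimension. -/
noncomputable def eucl (A : CylCalc S X ι) (m : ℝ) (g : S) : S :=
  A.wt (-2) * (A.D (A.D g) + m • A.D g + A.lapS g)

lemma eucl_wt_mul (m μ : ℝ) (g : S) : A.eucl m (A.wt μ * g) =
    A.wt (μ - 2) * (A.D (A.D g) + (2 * μ + m) • A.D g + (μ * (μ + m)) • g + A.lapS g) := by
  rw [eucl, (isRad_wt μ).lapS_mul, D_wt_mul, D_wt_mul, ← mul_smul_comm m, ← mul_add, ← mul_add,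
    ← mul_assoc, wt_mul_wt, map_add, Derivation.map_smul, show -2 + μ = μ - 2 by ring]
  congr 1; module

lemma bilap_wt_mul (m b : ℝ) (U : S) :
    A.bilap (m - 2 - 2 * b) ((b + 2) * (m - 2 - b) + b * (m - b))
      (b * (b + 2) * (m - 2 - b) * (m - b)) (A.wt b * U) =
      A.wt (b + 4) * A.eucl m (A.eucl m U) := by
  have hU : U = A.wt (-b) * (A.wt b * U) := by
    rw [← mul_assoc, wt_mul_wt, neg_add_cancel, wt_zero, one_mul]
  generalize A.wt b * U = v at *
  rw [hU, eucl_wt_mul, eucl_wt_mul, ← mul_assoc, wt_mul_wt,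
    show b + 4 + (-b - 2 - 2) = 0 by ring, wt_zero, one_mul, bilap]
  simp only [map_add, Derivation.map_smul, map_smul, D_lapS]
  module

lemma eucl_wt_mul_eq_symLap (b : ℝ) (z : S) : A.eucl (2 * b + 2) (A.wt (-b) * z) =
    A.wt (-b - 2) * A.symLap (b * (b + 2)) z := by
  rw [eucl_wt_mul, symLap]
  congr 1; module

end CylCalc

namespace Punctured

variable {n : ℕ}

/-- The punctured Euclidean space. -/
abbrev Pt (n : ℕ) : Type := {x : EuclideanSpace ℝ (Fin n) // x ≠ 0}

open Classical in
/-- Extension by zero of a function on the punctured space. -/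
noncomputable def zext (g : Pt n → ℝ) (x : EuclideanSpace ℝ (Fin n)) : ℝ :=
  if h : x ≠ 0 then g ⟨x, h⟩ else 0

lemma zext_of_ne (g : Pt n → ℝ) {x : EuclideanSpace ℝ (Fin n)} (h : x ≠ 0) :
    zext g x = g ⟨x, h⟩ := dif_pos h

@[simp] lemma zext_coe (g : Pt n → ℝ) (x : Pt n) : zext g x = g x := dif_pos x.2

@[simp] lemma zext_zero_pt (g : Pt n → ℝ) : zext g 0 = 0 := dif_neg (by simp)

lemma eventuallyEq_of_pt {f g : EuclideanSpace ℝ (Fin n) → ℝ} (h : ∀ x : Pt n, f x = g x)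
    (x : Pt n) : f =ᶠ[𝓝 (x : EuclideanSpace ℝ (Fin n))] g := by
  filter_upwards [isOpen_ne.mem_nhds x.2] with y hy using h ⟨y, hy⟩

/-- The algebra of smooth functions on the punctured Euclidean space. -/
def smoothAlg (n : ℕ) : Subalgebra ℝ (Pt n → ℝ) where
  carrier := {g | ∀ x : Pt n, ContDiffAt ℝ ∞ (zext g) (x : EuclideanSpace ℝ (Fin n))}
  mul_mem' {f g} hf hg x := ((hf x).mul (hg x)).congr_of_eventuallyEq
    (eventuallyEq_of_pt (fun y => by simp) x)
  add_mem' {f g} hf hg x := ((hf x).add (hg x)).congr_of_eventuallyEq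
    (eventuallyEq_of_pt (fun y => by simp) x)
  algebraMap_mem' r x := (contDiffAt_const (c := r)).congr_of_eventuallyEq
    (eventuallyEq_of_pt (fun y => by simp [Algebra.algebraMap_eq_smul_one]) x)

/-- Restriction to the punctured space. -/
def res (f : EuclideanSpace ℝ (Fin n) → ℝ)
    (hf : ∀ x : Pt n, ContDiffAt ℝ ∞ f (x : EuclideanSpace ℝ (Fin n))) : smoothAlg n :=
  ⟨fun x => f x, fun x => (hf x).congr_of_eventuallyEq (eventuallyEq_of_pt (fun y => by simp) x)⟩

@[simp] lemma res_apply {f : EuclideanSpace ℝ (Fin n) → ℝ}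
    (hf : ∀ x : Pt n, ContDiffAt ℝ ∞ f (x : EuclideanSpace ℝ (Fin n))) (x : Pt n) :
    (res f hf).1 x = f x := rfl

lemma smooth_zext (g : smoothAlg n) (x : Pt n) :
    ContDiffAt ℝ ∞ (zext g.1) (x : EuclideanSpace ℝ (Fin n)) := g.2 x

lemma differentiableAt_zext (g : smoothAlg n) (x : Pt n) :
    DifferentiableAt ℝ (zext g.1) (x : EuclideanSpace ℝ (Fin n)) :=
  (g.2 x).differentiableAt (by simp)

/-- The standard basis. -/
noncomputable def bas (i : Fin n) : EuclideanSpace ℝ (Fin n) := EuclideanSpace.single i 1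

lemma contDiffAt_fderiv_apply {f : EuclideanSpace ℝ (Fin n) → ℝ} {x : EuclideanSpace ℝ (Fin n)}
    (hf : ContDiffAt ℝ ∞ f x) (v : EuclideanSpace ℝ (Fin n)) :
    ContDiffAt ℝ ∞ (fun y => fderiv ℝ f y v) x :=
  (hf.fderiv_right (m := ∞) (by simp)).clm_apply contDiffAt_const

lemma fderiv_zext_congr {g : Pt n → ℝ} {f : EuclideanSpace ℝ (Fin n) → ℝ}
    (h : ∀ x : Pt n, g x = f x) (x : Pt n) :
    fderiv ℝ (zext g) (x : EuclideanSpace ℝ (Fin n)) = fderiv ℝ f x :=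
  (eventuallyEq_of_pt (fun y => by rw [zext_coe, h]) x).fderiv_eq

/-- The partial derivatives. -/
noncomputable def pd (i : Fin n) : Derivation ℝ (smoothAlg n) (smoothAlg n) :=
  Derivation.mk'
    { toFun := fun g => res (fun x => fderiv ℝ (zext g.1) x (bas i)) fun x =>
        contDiffAt_fderiv_apply (smooth_zext g x) _
      map_add' := fun f g => Subtype.ext <| funext fun x => by
        have h : fderiv ℝ (zext (f + g).1) (x : EuclideanSpace ℝ (Fin n)) = _ :=
          fderiv_zext_congr (f := fun y => zext f.1 y + zext g.1 y) (fun y => by simp) x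
        rw [fderiv_fun_add (differentiableAt_zext f x) (differentiableAt_zext g x)] at h
        exact congrArg (fun T => T (bas i)) h
      map_smul' := fun r g => Subtype.ext <| funext fun x => by
        have h : fderiv ℝ (zext (r • g).1) (x : EuclideanSpace ℝ (Fin n)) = _ :=
          fderiv_zext_congr (f := fun y => r * zext g.1 y) (fun y => by simp) x
        rw [fderiv_const_mul (differentiableAt_zext g x)] at h
        exact congrArg (fun T => T (bas i)) h }
    fun f g => Subtype.ext <| funext fun x => by
      have h : fderiv ℝ (zext (f * g).1) (x : EuclideanSpace ℝ (Fin n)) = _ :=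
        fderiv_zext_congr (f := fun y => zext f.1 y * zext g.1 y) (fun y => by simp) x
      rw [fderiv_fun_mul (differentiableAt_zext f x) (differentiableAt_zext g x), zext_coe,
        zext_coe] at h
      exact congrArg (fun T => T (bas i)) h

lemma pd_apply (i : Fin n) (g : smoothAlg n) (x : Pt n) :
    (pd i g).1 x = fderiv ℝ (zext g.1) x (bas i) := rfl

lemma pd_apply_of_eq (i : Fin n) {g : smoothAlg n} {f : EuclideanSpace ℝ (Fin n) → ℝ}
    (h : ∀ x : Pt n, g.1 x = f x) (x : Pt n) : (pd i g).1 x = fderiv ℝ f x (bas i) := by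
  rw [pd_apply, fderiv_zext_congr h]

lemma pd_pd_apply (i j : Fin n) (g : smoothAlg n) (x : Pt n) :
    (pd i (pd j g)).1 x = fderiv ℝ (fderiv ℝ (zext g.1)) x (bas i) (bas j) := by
  rw [pd_apply_of_eq i (f := fun y => fderiv ℝ (zext g.1) y (bas j)) fun y => pd_apply j g y]
  have hd : DifferentiableAt ℝ (fderiv ℝ (zext g.1)) (x : EuclideanSpace ℝ (Fin n)) :=
    ((smooth_zext g x).fderiv_right (m := ∞) (by simp)).differentiableAt (by simp)
  rw [fderiv_clm_apply hd (differentiableAt_const _)]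
  simp

lemma pd_comm (i j : Fin n) (g : smoothAlg n) : pd i (pd j g) = pd j (pd i g) := by
  refine Subtype.ext <| funext fun x => ?_
  rw [pd_pd_apply, pd_pd_apply]
  exact ((smooth_zext g x).isSymmSndFDerivAt
    (by simpa using WithTop.coe_le_coe.2 (le_top (a := (2 : ℕ∞))))).eq _ _

/-- The coordinate functions. -/
def coord (j : Fin n) : smoothAlg n := res (fun x => x j) fun x => by fun_prop

lemma pd_coord (i j : Fin n) : pd i (coord j) = if i = j then 1 else 0 := by
  refine Subtype.ext <| funext fun x => ?_
  rw [pd_apply_of_eq i (f := fun y => EuclideanSpace.proj (𝕜 := ℝ) j y) fun y => rfl,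
    ContinuousLinearMap.fderiv]
  change EuclideanSpace.single i (1 : ℝ) j = _
  rw [PiLp.single_apply]
  by_cases h : i = j
  · simp [h]
  · simp [h, Ne.symm h]

/-- The squared norm. -/
def normSq (n : ℕ) : smoothAlg n := ∑ i, coord i * coord i

/-- The Euler derivation. -/
noncomputable def eul (n : ℕ) : Derivation ℝ (smoothAlg n) (smoothAlg n) :=
  ∑ i, coord i • pd i

/-- The normalised rotation derivations. -/
noncomputable def rot (ij : Fin n × Fin n) : Derivation ℝ (smoothAlg n) (smoothAlg n) :=
  (Real.sqrt 2)⁻¹ • (coord ij.1 • pd ij.2 - coord ij.2 • pd ij.1)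

/-- The Laplacian on the punctured space. -/
noncomputable def Lap (g : smoothAlg n) : smoothAlg n := ∑ i, pd i (pd i g)

lemma eul_apply (g : smoothAlg n) : eul n g = ∑ i, coord i * pd i g := by
  rw [eul, ← Derivation.coeFnAddMonoidHom_apply, map_sum, Finset.sum_apply]
  rfl

lemma rot_apply (i j : Fin n) (g : smoothAlg n) :
    rot (i, j) g = (Real.sqrt 2)⁻¹ • (coord i * pd j g - coord j * pd i g) := by
  simp [rot]

lemma pd_coord_mul (i j : Fin n) (g : smoothAlg n) :
    pd i (coord j * g) = coord j * pd i g + if i = j then g else 0 := by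
  rw [Derivation.leibniz, pd_coord, smul_eq_mul, smul_eq_mul]
  split_ifs <;> simp

lemma eul_coord (j : Fin n) : eul n (coord j) = coord j := by
  simp [eul_apply, pd_coord]

lemma eul_pd (j : Fin n) (g : smoothAlg n) : pd j (eul n g) = eul n (pd j g) + pd j g := by
  simp only [eul_apply, map_sum, pd_coord_mul, Finset.sum_add_distrib, Finset.sum_ite_eq,
    Finset.mem_univ, if_true, pd_comm j]

lemma eul_rot (ij : Fin n × Fin n) (g : smoothAlg n) :
    eul n (rot ij g) = rot ij (eul n g) := by
  obtain ⟨i, j⟩ := ij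
  rw [rot_apply, rot_apply, Derivation.map_smul, map_sub, Derivation.leibniz, Derivation.leibniz,
    eul_coord, eul_coord, eul_pd, eul_pd]
  simp only [smul_eq_mul]
  congr 1; ring

lemma normSq_mul_Lap (g : smoothAlg n) : normSq n * Lap g =
    eul n (eul n g) + ((n : ℝ) - 2) • eul n g + ∑ ij, rot ij (rot ij g) := by
  have h2 : (Real.sqrt 2)⁻¹ * (Real.sqrt 2)⁻¹ = 1 / 2 := by
    rw [← mul_inv, Real.mul_self_sqrt (by norm_num)]; norm_num
  have hr : ∀ i j, rot (i, j) (rot (i, j) g) = (1 / 2 : ℝ) •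
      (coord i * coord i * pd j (pd j g) + coord j * coord j * pd i (pd i g)
        - (2 : ℝ) • (coord i * (coord j * pd i (pd j g)))
        - (coord i * pd i g + coord j * pd j g)
        + if i = j then (2 : ℝ) • (coord i * pd i g) else 0) := fun i j => by
    rw [rot_apply i j g, Derivation.map_smul, rot_apply, smul_smul, h2]
    congr 1
    simp only [map_sub, pd_coord_mul, pd_comm j i, if_true, two_smul]
    by_cases hij : i = j
    · subst hij; simp; ring
    · simp [hij, Ne.symm hij]; ring
  have he : eul n (eul n g) = eul n g + ∑ i, ∑ j, coord i * (coord j * pd i (pd j g)) := by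
    conv_lhs => rw [eul_apply]
    simp only [eul_pd, mul_add, Finset.sum_add_distrib, ← eul_apply g]
    rw [add_comm]
    simp only [eul_apply, Finset.mul_sum, pd_comm]
  have hN : normSq n * Lap g = ∑ i, ∑ j, coord i * coord i * pd j (pd j g) := by
    rw [normSq, Lap, Finset.sum_mul_sum]
  have hN' : normSq n * Lap g = ∑ i, ∑ j, coord j * coord j * pd i (pd i g) := by
    rw [hN, Finset.sum_comm]
  have hc : ∑ i : Fin n, ∑ _j : Fin n, coord i * pd i g = (n : ℝ) • eul n g := by
    simp [eul_apply, Finset.smul_sum, ← Nat.cast_smul_eq_nsmul ℝ]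
  have hc' : ∑ _i : Fin n, ∑ j : Fin n, coord j * pd j g = (n : ℝ) • eul n g := by
    rw [Finset.sum_comm, hc]
  rw [Fintype.sum_prod_type]
  simp only [hr, ← Finset.smul_sum, Finset.sum_add_distrib, Finset.sum_sub_distrib,
    Finset.sum_ite_eq, Finset.mem_univ, if_true, ← hN, ← hN', hc, hc', he]
  rw [← eul_apply]
  module

lemma contDiffAt_radial {f : ℝ → ℝ} (hf : ContDiff ℝ ∞ f) (x : Pt n) :
    ContDiffAt ℝ ∞ (fun y : EuclideanSpace ℝ (Fin n) => f (Real.log ‖y‖))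
      (x : EuclideanSpace ℝ (Fin n)) :=
  hf.contDiffAt.comp _ ((contDiffAt_norm ℝ x.2).log (norm_ne_zero_iff.2 x.2))

open Classical in
/-- Functions of the logarithm of the norm. -/
noncomputable def radial (n : ℕ) (f : ℝ → ℝ) : smoothAlg n :=
  if hf : ContDiff ℝ ∞ f then res (fun y => f (Real.log ‖y‖)) (contDiffAt_radial hf) else 0

lemma radial_apply {f : ℝ → ℝ} (hf : ContDiff ℝ ∞ f) (x : Pt n) :
    (radial n f).1 x = f (Real.log ‖(x : EuclideanSpace ℝ (Fin n))‖) := by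
  rw [radial, dif_pos hf, res_apply]

lemma inner_bas (x : EuclideanSpace ℝ (Fin n)) (i : Fin n) : ⟪x, bas i⟫ = x i := by
  simp [bas, EuclideanSpace.inner_single_right]

lemma pd_radial_apply {f : ℝ → ℝ} (hf : ContDiff ℝ ∞ f) (i : Fin n) (x : Pt n) :
    (pd i (radial n f)).1 x = deriv f (Real.log ‖(x : EuclideanSpace ℝ (Fin n))‖) *
      ((x : EuclideanSpace ℝ (Fin n)) i / ‖(x : EuclideanSpace ℝ (Fin n))‖ ^ 2) := by
  have hx : ‖(x : EuclideanSpace ℝ (Fin n))‖ ≠ 0 := norm_ne_zero_iff.2 x.2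
  rw [pd_apply_of_eq i (f := fun y => f (Real.log ‖y‖)) (radial_apply hf)]
  have h2 : HasFDerivAt (fun y : EuclideanSpace ℝ (Fin n) => ‖y‖ ^ 2)
    (2 • innerSL ℝ (x : EuclideanSpace ℝ (Fin n))) x := (hasStrictFDerivAt_norm_sq _).hasFDerivAt
  have h3 := (h2.log (pow_ne_zero 2 hx)).const_mul (1 / 2)
  have h4 : HasFDerivAt (fun y : EuclideanSpace ℝ (Fin n) => Real.log ‖y‖) _
      (x : EuclideanSpace ℝ (Fin n)) := h3.congr_of_eventuallyEq
    (Eventually.of_forall fun y => by simp [Real.log_pow])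
  have h5 : HasDerivAt f _ (Real.log ‖(x : EuclideanSpace ℝ (Fin n))‖) :=
    ((hf.differentiable (by simp)) _).hasDerivAt
  have h6 : HasFDerivAt (fun y : EuclideanSpace ℝ (Fin n) => f (Real.log ‖y‖)) _
      (x : EuclideanSpace ℝ (Fin n)) :=
    h5.comp_hasFDerivAt (f := fun y : EuclideanSpace ℝ (Fin n) => Real.log ‖y‖) _ h4
  rw [h6.fderiv]
  simp [inner_bas]
  left
  field_simp

lemma eul_radial {f : ℝ → ℝ} (hf : ContDiff ℝ ∞ f) :
    eul n (radial n f) = radial n (deriv f) := by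
  refine Subtype.ext <| funext fun x => ?_
  have hx : ‖(x : EuclideanSpace ℝ (Fin n))‖ ≠ 0 := norm_ne_zero_iff.2 x.2
  have hs : ∑ i, (x : EuclideanSpace ℝ (Fin n)) i * (x : EuclideanSpace ℝ (Fin n)) i =
      ‖(x : EuclideanSpace ℝ (Fin n))‖ ^ 2 := by
    rw [EuclideanSpace.real_norm_sq_eq]; simp only [sq]
  have e : (eul n (radial n f)).1 x =
      ∑ i, (x : EuclideanSpace ℝ (Fin n)) i * (pd i (radial n f)).1 x := by
    rw [eul_apply]; simp [coord]
  rw [e, radial_apply (CylCalc.contDiff_deriv' hf)]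
  simp only [pd_radial_apply hf]
  calc _ = deriv f (Real.log ‖(x : EuclideanSpace ℝ (Fin n))‖) /
      ‖(x : EuclideanSpace ℝ (Fin n))‖ ^ 2
      * ∑ i, (x : EuclideanSpace ℝ (Fin n)) i * (x : EuclideanSpace ℝ (Fin n)) i := by
        rw [Finset.mul_sum]; exact Finset.sum_congr rfl fun i _ => by ring
    _ = _ := by rw [hs]; field_simp

lemma rot_radial {f : ℝ → ℝ} (hf : ContDiff ℝ ∞ f) (ij : Fin n × Fin n) :
    rot ij (radial n f) = 0 := by
  obtain ⟨i, j⟩ := ij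
  rw [rot_apply]
  have : coord i * pd j (radial n f) - coord j * pd i (radial n f) = 0 := by
    refine Subtype.ext <| funext fun x => ?_
    have e : (coord i * pd j (radial n f) - coord j * pd i (radial n f)).1 x =
      (x : EuclideanSpace ℝ (Fin n)) i * (pd j (radial n f)).1 x -
        (x : EuclideanSpace ℝ (Fin n)) j * (pd i (radial n f)).1 x := rfl
    rw [e, pd_radial_apply hf, pd_radial_apply hf]
    simp
    ring
  rw [this, smul_zero]

/-- The ideal of functions supported in an annulus. -/
def annular (n : ℕ) : Ideal (smoothAlg n) where
  carrier := {g | ∃ r R : ℝ, 0 < r ∧ ∀ x : Pt n, ‖(x : EuclideanSpace ℝ (Fin n))‖ < r ∨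
    R < ‖(x : EuclideanSpace ℝ (Fin n))‖ → g.1 x = 0}
  zero_mem' := ⟨1, 1, one_pos, fun _ _ => rfl⟩
  add_mem' := by
    rintro f g ⟨r, R, hr, h⟩ ⟨r', R', hr', h'⟩
    refine ⟨min r r', max R R', lt_min hr hr', fun x hx => ?_⟩
    change f.1 x + g.1 x = 0
    rw [h x (hx.imp (fun t => t.trans_le (min_le_left _ _)) (le_max_left _ _).trans_lt),
      h' x (hx.imp (fun t => t.trans_le (min_le_right _ _)) (le_max_right _ _).trans_lt), add_zero]
  smul_mem' := by
    rintro f g ⟨r, R, hr, h⟩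
    refine ⟨r, R, hr, fun x hx => ?_⟩
    change f.1 x * g.1 x = 0
    rw [h x hx, mul_zero]

lemma pd_mem_annular {g : smoothAlg n} (hg : g ∈ annular n) (i : Fin n) : pd i g ∈ annular n := by
  obtain ⟨r, R, hr, h⟩ := hg
  refine ⟨r, R, hr, fun x hx => ?_⟩
  have ho : IsOpen {y : EuclideanSpace ℝ (Fin n) | ‖y‖ < r ∨ R < ‖y‖} :=
    (isOpen_lt continuous_norm continuous_const).union (isOpen_lt continuous_const continuous_norm)
  have : zext g.1 =ᶠ[𝓝 (x : EuclideanSpace ℝ (Fin n))] fun _ => 0 := by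
    filter_upwards [ho.mem_nhds hx, isOpen_ne.mem_nhds x.2] with y hy hy'
    rw [zext_of_ne _ hy']
    exact h ⟨y, hy'⟩ hy
  rw [pd_apply, this.fderiv_eq, fderiv_fun_const]
  rfl

lemma tsupport_zext {g : smoothAlg n} {r R : ℝ} (h : ∀ x : Pt n,
    ‖(x : EuclideanSpace ℝ (Fin n))‖ < r ∨ R < ‖(x : EuclideanSpace ℝ (Fin n))‖ → g.1 x = 0) :
    tsupport (zext g.1) ⊆ {x | r ≤ ‖x‖ ∧ ‖x‖ ≤ R} := by
  refine closure_minimal (fun x hx => ?_) ((isClosed_le continuous_const continuous_norm).inter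
    (isClosed_le continuous_norm continuous_const))
  have hx0 : x ≠ 0 := by rintro rfl; simp at hx
  by_contra hc
  rw [mem_ofPred_eq, not_and_or, not_le, not_le] at hc
  exact hx ((zext_of_ne _ hx0).trans (h ⟨x, hx0⟩ hc))

lemma hasCompactSupport_zext {g : smoothAlg n} (hg : g ∈ annular n) :
    HasCompactSupport (zext g.1) := by
  obtain ⟨r, R, hr, h⟩ := hg
  exact (isCompact_closedBall 0 R).of_isClosed_subset (isClosed_tsupport _)
    ((tsupport_zext h).trans fun x hx => by simpa using hx.2)

lemma contDiff_zext {g : smoothAlg n} (hg : g ∈ annular n) : ContDiff ℝ ∞ (zext g.1) := by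
  obtain ⟨r, R, hr, h⟩ := hg
  refine contDiff_iff_contDiffAt.2 fun x => ?_
  by_cases hx : x = 0
  · subst hx
    have : zext g.1 =ᶠ[𝓝 0] fun _ => 0 := notMem_tsupport_iff_eventuallyEq.1 fun hm => by
      have := (tsupport_zext h hm).1
      simp at this
      linarith
    exact contDiffAt_const.congr_of_eventuallyEq this
  · exact smooth_zext g ⟨x, hx⟩

lemma integrable_zext {g : smoothAlg n} (hg : g ∈ annular n) : Integrable (zext g.1) :=
  (contDiff_zext hg).continuous.integrable_of_hasCompactSupport (hasCompactSupport_zext hg)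

lemma zext_eq_of_forall {g : Pt n → ℝ} {f : EuclideanSpace ℝ (Fin n) → ℝ}
    (h : ∀ x : Pt n, g x = f x) (h0 : f 0 = 0) : zext g = f := by
  funext x
  by_cases hx : x = 0
  · subst hx; simp [h0]
  · rw [zext_of_ne _ hx, h]

lemma zext_pd {g : smoothAlg n} (hg : g ∈ annular n) (i : Fin n) :
    zext (pd i g).1 = fun x => fderiv ℝ (zext g.1) x (bas i) := by
  refine zext_eq_of_forall (fun x => pd_apply i g x) ?_
  obtain ⟨r, R, hr, h⟩ := hg
  have : zext g.1 =ᶠ[𝓝 0] fun _ => 0 := notMem_tsupport_iff_eventuallyEq.1 fun hm => by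
    have := (tsupport_zext h hm).1
    simp at this
    linarith
  rw [this.fderiv_eq, fderiv_fun_const]
  rfl

lemma integral_zext_pd {g : smoothAlg n} (hg : g ∈ annular n) (i : Fin n) :
    ∫ x, zext (pd i g).1 x = 0 := by
  have hi := integrable_zext (pd_mem_annular hg i)
  have := integral_mul_fderiv_eq_neg_fderiv_mul_of_integrable (μ := volume)
    (f := fun _ : EuclideanSpace ℝ (Fin n) => (1 : ℝ)) (g := zext g.1) (v := bas i)
    (by simp) (by simpa [zext_pd hg i] using hi) (by simpa using integrable_zext hg)
    (fun _ _ => differentiableAt_const _)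
    fun x _ => (contDiff_zext hg).differentiable (by simp) x
  rw [zext_pd hg i]
  simpa using this

lemma zext_add (g h : Pt n → ℝ) (x : EuclideanSpace ℝ (Fin n)) :
    zext (g + h) x = zext g x + zext h x := by
  by_cases hx : x = 0
  · subst hx; simp
  · simp [zext_of_ne _ hx]

lemma zext_smul (r : ℝ) (g : Pt n → ℝ) (x : EuclideanSpace ℝ (Fin n)) :
    zext (r • g) x = r * zext g x := by
  by_cases hx : x = 0
  · subst hx; simp
  · simp [zext_of_ne _ hx]

/-- The integral of functions supported in an annulus. -/
noncomputable def integralAnnular (n : ℕ) : (annular n).restrictScalars ℝ →ₗ[ℝ] ℝ where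
  toFun g := ∫ x, zext g.1.1 x
  map_add' g h := by
    rw [← integral_add (integrable_zext g.2) (integrable_zext h.2)]
    exact integral_congr_ae (ae_of_all _ fun x => zext_add g.1.1 h.1.1 x)
  map_smul' r g := by
    rw [RingHom.id_apply, smul_eq_mul, ← integral_const_mul]
    exact integral_congr_ae (ae_of_all _ fun x => zext_smul r g.1.1 x)

/-- A linear extension of the integral to all smooth functions. -/
noncomputable def integralExt (n : ℕ) : smoothAlg n →ₗ[ℝ] ℝ :=
  (LinearMap.exists_extend (integralAnnular n)).choose

lemma integralExt_apply {g : smoothAlg n} (hg : g ∈ annular n) :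
    integralExt n g = ∫ x, zext g.1 x :=
  LinearMap.congr_fun (LinearMap.exists_extend (integralAnnular n)).choose_spec ⟨g, hg⟩

/-- The density `‖x‖⁻ⁿ` of the dilation invariant measure. -/
noncomputable def rho (n : ℕ) : smoothAlg n := radial n fun t => Real.exp (-(n : ℝ) * t)

lemma rho_apply (x : Pt n) :
    (rho n).1 x = Real.exp (-(n : ℝ) * Real.log ‖(x : EuclideanSpace ℝ (Fin n))‖) :=
  radial_apply (CylCalc.contDiff_exp_mul _) x

lemma eul_rho : eul n (rho n) = -(n : ℝ) • rho n := by
  refine (eul_radial (CylCalc.contDiff_exp_mul _)).trans <| Subtype.ext <| funext fun x => ?_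
  have e : (-(n : ℝ) • rho n).1 x = -(n : ℝ) * (rho n).1 x := rfl
  have h : HasDerivAt (fun t => Real.exp (-(n : ℝ) * t)) _
      (Real.log ‖(x : EuclideanSpace ℝ (Fin n))‖) := ((hasDerivAt_id _).const_mul (-(n : ℝ))).exp
  rw [e, rho_apply, radial_apply (CylCalc.contDiff_deriv' (CylCalc.contDiff_exp_mul _)), h.deriv]
  simp [mul_comm]

lemma eul_mem_annular {g : smoothAlg n} (hg : g ∈ annular n) : eul n g ∈ annular n := by
  rw [eul_apply]
  exact Ideal.sum_mem _ fun i _ => (annular n).mul_mem_left _ (pd_mem_annular hg i)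

lemma smul_mem_annular {g : smoothAlg n} (hg : g ∈ annular n) (r : ℝ) : r • g ∈ annular n := by
  rw [← one_mul g, ← smul_mul_assoc]
  exact (annular n).mul_mem_left _ hg

lemma rot_mem_annular {g : smoothAlg n} (hg : g ∈ annular n) (ij : Fin n × Fin n) :
    rot ij g ∈ annular n := by
  obtain ⟨i, j⟩ := ij
  rw [rot_apply]
  exact smul_mem_annular (sub_mem ((annular n).mul_mem_left _ (pd_mem_annular hg j))
    ((annular n).mul_mem_left _ (pd_mem_annular hg i))) _

lemma integralExt_pd {g : smoothAlg n} (hg : g ∈ annular n) (i : Fin n) :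
    integralExt n (pd i g) = 0 := by
  rw [integralExt_apply (pd_mem_annular hg i), integral_zext_pd hg]

lemma integralExt_eul {g : smoothAlg n} (hg : g ∈ annular n) :
    integralExt n (rho n * eul n g) = 0 := by
  have h : rho n * eul n g = ∑ i, pd i (coord i * (rho n * g)) := by
    have e : eul n (rho n * g) = rho n * eul n g - (n : ℝ) • (rho n * g) := by
      rw [Derivation.leibniz, eul_rho, smul_eq_mul, smul_eq_mul, mul_smul_comm, mul_comm g,
        neg_smul,
        sub_eq_add_neg]
    simp only [pd_coord_mul, Finset.sum_add_distrib, ← eul_apply, e, if_true]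
    simp [← Nat.cast_smul_eq_nsmul ℝ]
  rw [h, map_sum]
  exact Finset.sum_eq_zero fun i _ => integralExt_pd
    ((annular n).mul_mem_left _ ((annular n).mul_mem_left _ hg)) i

lemma integralExt_rot {g : smoothAlg n} (hg : g ∈ annular n) (ij : Fin n × Fin n) :
    integralExt n (rho n * rot ij g) = 0 := by
  obtain ⟨i, j⟩ := ij
  have h : rho n * rot (i, j) g = (Real.sqrt 2)⁻¹ •
      (pd j (coord i * (rho n * g)) - pd i (coord j * (rho n * g))) := by
    have e : rho n * rot (i, j) g = rot (i, j) (rho n * g) := by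
      rw [Derivation.leibniz, rho, rot_radial (CylCalc.contDiff_exp_mul _), smul_zero, add_zero,
        smul_eq_mul]
    rw [e, rot_apply, pd_coord_mul, pd_coord_mul]
    congr 1
    simp only [eq_comm]
    ring
  rw [h, map_smul, map_sub, integralExt_pd, integralExt_pd, sub_zero, smul_zero] <;>
  exact (annular n).mul_mem_left _ ((annular n).mul_mem_left _ hg)

lemma zext_rho_mul_nonneg {g : smoothAlg n} (h : ∀ x, 0 ≤ g.1 x) (x : EuclideanSpace ℝ (Fin n)) :
    0 ≤ zext (rho n * g).1 x := by
  by_cases hx : x = 0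
  · subst hx; simp
  · rw [zext_of_ne _ hx]
    refine mul_nonneg ?_ (h _)
    rw [rho_apply]; positivity

lemma radial_mem_annular {f : ℝ → ℝ} (hf : ContDiff ℝ ∞ f) (hc : HasCompactSupport f) :
    radial n f ∈ annular n := by
  obtain ⟨M, hM⟩ := hc.isBounded.subset_closedBall 0
  refine ⟨Real.exp (-M), Real.exp M, Real.exp_pos _, fun x hx => ?_⟩
  have hx0 : 0 < ‖(x : EuclideanSpace ℝ (Fin n))‖ := norm_pos_iff.2 x.2
  rw [radial_apply hf]
  refine image_eq_zero_of_notMem_tsupport fun hm => ?_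
  have := hM hm
  rw [mem_closedBall_zero_iff, Real.norm_eq_abs, abs_le] at this
  rcases hx with hx | hx
  · rw [← Real.log_lt_iff_lt_exp hx0] at hx; linarith
  · rw [← Real.lt_log_iff_exp_lt hx0] at hx; linarith

lemma integralExt_translate {f : ℝ → ℝ} (hf : ContDiff ℝ ∞ f) (hc : HasCompactSupport f) (T : ℝ) :
    integralExt n (rho n * radial n fun t => f (t - T)) = integralExt n (rho n * radial n f) := by
  have hf' : ContDiff ℝ ∞ fun t => f (t - T) := CylCalc.contDiff_shift hf T
  have hc' : HasCompactSupport fun t => f (t - T) :=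
    hc.comp_homeomorph (Homeomorph.subRight T)
  rw [integralExt_apply ((annular n).mul_mem_left _ (radial_mem_annular hf' hc')),
    integralExt_apply ((annular n).mul_mem_left _ (radial_mem_annular hf hc))]
  have key : zext (rho n * radial n fun t => f (t - T)).1 = fun x =>
      Real.exp (-(n : ℝ) * T) * zext (rho n * radial n f).1 (Real.exp (-T) • x) := by
    refine zext_eq_of_forall (fun x => ?_) (by simp)
    have hx0 : ‖(x : EuclideanSpace ℝ (Fin n))‖ ≠ 0 := norm_ne_zero_iff.2 x.2
    have hy : Real.exp (-T) • (x : EuclideanSpace ℝ (Fin n)) ≠ 0 :=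
      smul_ne_zero (Real.exp_pos _).ne' x.2
    rw [zext_of_ne _ hy]
    change (rho n).1 x * (radial n fun t => f (t - T)).1 x =
      _ * ((rho n).1 ⟨_, hy⟩ * (radial n f).1 ⟨_, hy⟩)
    rw [rho_apply, rho_apply, radial_apply hf, radial_apply hf']
    simp only [norm_smul, Real.norm_eq_abs, Real.abs_exp]
    rw [Real.log_mul (Real.exp_pos _).ne' hx0, Real.log_exp, ← mul_assoc, ← Real.exp_add]
    ring_nf
  rw [key, integral_const_mul, Measure.integral_comp_smul, finrank_euclideanSpace_fin, smul_eq_mul,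
    ← mul_assoc]
  have : Real.exp (-(n : ℝ) * T) * |(Real.exp (-T) ^ n)⁻¹| = 1 := by
    rw [abs_of_pos (by positivity), ← Real.exp_nat_mul, ← Real.exp_neg, ← Real.exp_add]
    simp
  rw [this, one_mul]

/-- Calculus on the punctured space, viewed as a cylinder over the sphere. -/
noncomputable def annulusCalc (n : ℕ) : CylCalc (smoothAlg n) (Pt n) (Fin n × Fin n) where
  D := eul n
  L := rot
  I := integralExt n ∘ₗ LinearMap.mulLeft ℝ (rho n)
  c := annular n
  ev x := (Pi.evalAlgHom ℝ _ x).comp (smoothAlg n).val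
  τ x := Real.log ‖(x : EuclideanSpace ℝ (Fin n))‖
  rad := radial n
  ext h := Subtype.ext <| funext h
  D_L := eul_rot
  D_mem := eul_mem_annular
  L_mem hg := rot_mem_annular hg _
  I_D := integralExt_eul
  I_L hg := integralExt_rot hg _
  I_nonneg {g} hg h := by
    change 0 ≤ integralExt n (rho n * g)
    rw [integralExt_apply ((annular n).mul_mem_left _ hg)]
    exact integral_nonneg fun x => zext_rho_mul_nonneg h x
  I_faithful {g} hg h h0 := by
    have hm := (annular n).mul_mem_left (rho n) hg
    change integralExt n (rho n * g) = 0 at h0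
    rw [integralExt_apply hm] at h0
    refine Subtype.ext <| funext fun x => ?_
    by_contra hx
    refine (Continuous.integral_pos_of_hasCompactSupport_nonneg_nonzero
      (x := (x : EuclideanSpace ℝ (Fin n))) (contDiff_zext hm).continuous
      (hasCompactSupport_zext hm) (fun y => zext_rho_mul_nonneg h y) ?_).ne' h0
    rw [zext_coe]
    refine mul_ne_zero ?_ hx
    rw [rho_apply]; positivity
  ev_rad hf x := radial_apply hf x
  D_rad := eul_radial
  L_rad hf ij := rot_radial hf ij
  rad_mem := radial_mem_annular
  I_translate := integralExt_translate

lemma calc_D (g : smoothAlg n) : (annulusCalc n).D g = ∑ i, coord i * pd i g := eul_apply g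

lemma calc_I {g : smoothAlg n} (hg : g ∈ (annulusCalc n).c) :
    (annulusCalc n).I g = ∫ x, zext (rho n * g).1 x :=
  integralExt_apply ((annular n).mul_mem_left _ hg)

lemma normSq_eq : normSq n = (annulusCalc n).wt 2 := by
  refine Subtype.ext <| funext fun x => ?_
  have hx : 0 < ‖(x : EuclideanSpace ℝ (Fin n))‖ := norm_pos_iff.2 x.2
  have h2 : ((annulusCalc n).wt 2).1 x = _ := CylCalc.ev_wt (A := annulusCalc n) 2 x
  have h1 : (normSq n).1 x =
      ∑ i, (x : EuclideanSpace ℝ (Fin n)) i * (x : EuclideanSpace ℝ (Fin n)) i := by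
    simp [normSq, coord]
  have h3 : (annulusCalc n).τ x = Real.log ‖(x : EuclideanSpace ℝ (Fin n))‖ := rfl
  rw [h2, h1, h3, mul_comm, Real.exp_mul, Real.exp_log hx, Real.rpow_two,
    EuclideanSpace.real_norm_sq_eq]
  simp only [sq]

lemma Lap_eq (g : smoothAlg n) : Lap g = (annulusCalc n).eucl ((n : ℝ) - 2) g := by
  have h := normSq_mul_Lap g
  have h' : (annulusCalc n).wt (-2) * (normSq n * Lap g) = Lap g := by
    rw [normSq_eq, ← mul_assoc, CylCalc.wt_mul_wt, neg_add_cancel, CylCalc.wt_zero, one_mul]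
  rw [← h', h, CylCalc.eucl, CylCalc.lapS_apply]
  rfl

lemma Lap_apply_of_eq {g : smoothAlg n} {f : EuclideanSpace ℝ (Fin n) → ℝ}
    (h : ∀ x : Pt n, g.1 x = f x) (x : Pt n) : (Lap g).1 x = lap n f x := by
  have e : zext g.1 =ᶠ[𝓝 (x : EuclideanSpace ℝ (Fin n))] f :=
    eventuallyEq_of_pt (fun y => by rw [zext_coe, h]) x
  have h1 : (Lap g).1 x = ∑ i, (pd i (pd i g)).1 x := by simp [Lap]
  rw [h1, lap]
  refine Finset.sum_congr rfl fun i _ => ?_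
  rw [pd_pd_apply, e.fderiv.fderiv_eq, iteratedFDeriv_two_apply]
  rfl

/-- The functions that extend smoothly across the origin. -/
def extendable (n : ℕ) : Subalgebra ℝ (smoothAlg n) where
  carrier := {g | ∃ f : EuclideanSpace ℝ (Fin n) → ℝ, ContDiff ℝ ∞ f ∧ ∀ x : Pt n, g.1 x = f x}
  mul_mem' := by
    rintro g h ⟨f, hf, e⟩ ⟨f', hf', e'⟩
    exact ⟨_, hf.mul hf', fun x => by rw [← e, ← e']; rfl⟩
  add_mem' := by
    rintro g h ⟨f, hf, e⟩ ⟨f', hf', e'⟩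
    exact ⟨_, hf.add hf', fun x => by rw [← e, ← e']; rfl⟩
  algebraMap_mem' r := ⟨fun _ => r, contDiff_const, fun _ => rfl⟩

lemma coord_mem_extendable (i : Fin n) : coord i ∈ extendable n :=
  ⟨fun x => x i, by fun_prop, fun _ => rfl⟩

lemma pd_mem_extendable {g : smoothAlg n} (hg : g ∈ extendable n) (i : Fin n) :
    pd i g ∈ extendable n := by
  obtain ⟨f, hf, e⟩ := hg
  exact ⟨fun x => fderiv ℝ f x (bas i),
    contDiff_iff_contDiffAt.2 fun x => contDiffAt_fderiv_apply hf.contDiffAt _, pd_apply_of_eq i e⟩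

lemma D_mem_extendable {g : smoothAlg n} (hg : g ∈ extendable n) :
    (annulusCalc n).D g ∈ extendable n := by
  rw [calc_D]
  exact sum_mem fun i _ => mul_mem (coord_mem_extendable i) (pd_mem_extendable hg i)

lemma L_mem_extendable {g : smoothAlg n} (hg : g ∈ extendable n) (ij : Fin n × Fin n) :
    (annulusCalc n).L ij g ∈ extendable n := by
  obtain ⟨i, j⟩ := ij
  have h : (annulusCalc n).L (i, j) g = _ := rot_apply i j g
  rw [h]
  exact Subalgebra.smul_mem _ (sub_mem (mul_mem (coord_mem_extendable i) (pd_mem_extendable hg j))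
    (mul_mem (coord_mem_extendable j) (pd_mem_extendable hg i))) _

lemma en_mem_extendable {g : smoothAlg n} (hg : g ∈ extendable n) :
    (annulusCalc n).en g ∈ extendable n := by
  have hD := D_mem_extendable hg
  have hΓ : ∀ {g}, g ∈ extendable n → (annulusCalc n).Γ g g ∈ extendable n := fun hg =>
    sum_mem fun ij _ => mul_mem (L_mem_extendable hg ij) (L_mem_extendable hg ij)
  rw [CylCalc.en, CylCalc.lapS_apply]
  exact add_mem (add_mem (add_mem (add_mem (add_mem (pow_mem hg 2) (pow_mem hD 2))
    (pow_mem (D_mem_extendable hD) 2)) (hΓ hg)) (hΓ hD))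
    (pow_mem (sum_mem fun ij _ => L_mem_extendable (L_mem_extendable hg ij) ij) 2)

lemma exists_bound_of_mem_extendable {g : smoothAlg n} (hg : g ∈ extendable n) (R : ℝ) :
    ∃ C, ∀ x : Pt n, ‖(x : EuclideanSpace ℝ (Fin n))‖ ≤ R → g.1 x ≤ C := by
  obtain ⟨f, hf, e⟩ := hg
  obtain ⟨C, hC⟩ :=
    (isCompact_closedBall (0 : EuclideanSpace ℝ (Fin n)) R).exists_bound_of_continuousOn
    hf.continuous.continuousOn
  exact ⟨C, fun x hx => (e x).trans_le ((le_abs_self _).trans (hC x (by simpa using hx)))⟩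

lemma zext_ae_eq (hn : 0 < n) {g : Pt n → ℝ} {f : EuclideanSpace ℝ (Fin n) → ℝ}
    (h : ∀ x : Pt n, g x = f x) : zext g =ᵐ[volume] f := by
  have : Nonempty (Fin n) := ⟨⟨0, hn⟩⟩
  filter_upwards [(measure_singleton (0 : EuclideanSpace ℝ (Fin n)) : volume _ = 0).le |>
    fun h0 => compl_mem_ae_iff.2 (le_antisymm h0 zero_le)] with x hx
  rw [zext_of_ne _ hx, h]

lemma exp_mul_log_norm (κ : ℝ) (x : Pt n) : Real.exp (κ * (annulusCalc n).τ x) =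
    ‖(x : EuclideanSpace ℝ (Fin n))‖ ^ κ := by
  rw [Real.rpow_def_of_pos (norm_pos_iff.2 x.2), mul_comm]
  rfl

lemma abs_rpow_mul_mul_self {p : ℝ} (hp : 1 < p) (s : ℝ) :
    |s| ^ (p - 1) * s * s = |s| ^ (p + 1) := by
  rw [mul_assoc, ← abs_mul_abs_self, ← sq, ← Real.rpow_two,
    ← Real.rpow_add_of_nonneg (abs_nonneg s) (by linarith) (by norm_num)]
  ring_nf

/-- The restriction of a smooth function to the punctured space. -/
def resU {u : EuclideanSpace ℝ (Fin n) → ℝ} (hu : ContDiff ℝ ∞ u) : smoothAlg n :=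
  res u fun _ => hu.contDiffAt

section Solution

variable {a p b T₀ : ℝ} {u : EuclideanSpace ℝ (Fin n) → ℝ} (hu : ContDiff ℝ ∞ u)

lemma resU_mem_extendable : resU hu ∈ extendable n := ⟨u, hu, fun _ => rfl⟩

lemma Lap_Lap_apply (hsol : IsSolutionOn n a p u univ) (x : Pt n) :
    (Lap (Lap (resU hu))).1 x = ‖(x : EuclideanSpace ℝ (Fin n))‖ ^ a * |u x| ^ (p - 1) * u x := by
  rw [Lap_apply_of_eq (f := lap n u) (Lap_apply_of_eq fun _ => rfl), hsol _ (mem_univ _)]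

/-- The solution in cylindrical coordinates. -/
noncomputable def profile (b : ℝ) : smoothAlg n := (annulusCalc n).wt b * resU hu

lemma ev_profile (x : Pt n) : (annulusCalc n).ev x (profile hu b) =
    Real.exp (b * (annulusCalc n).τ x) * u x := by
  rw [profile, map_mul, CylCalc.ev_wt]
  rfl

lemma bilap_profile (β : ℝ) :
    (annulusCalc n).bilap (n - 4 - 2 * β) ((β + 2) * (n - 4 - β) + β * (n - 2 - β))
      (β * (β + 2) * (n - 4 - β) * (n - 2 - β)) (profile hu β) =
    (annulusCalc n).wt (β + 4) * Lap (Lap (resU hu)) := by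
  rw [profile, Lap_eq, Lap_eq, ← CylCalc.bilap_wt_mul]
  congr 1 <;> ring

lemma bilap_profile_symm (hb : (n : ℝ) = 2 * b + 4) :
    (annulusCalc n).bilap 0 (2 * (b * (b + 2))) ((b * (b + 2)) ^ 2) (profile hu b) =
    (annulusCalc n).wt (b + 4) * Lap (Lap (resU hu)) := by
  rw [← bilap_profile, hb]
  congr 1 <;> ring

lemma ev_bilap_profile_mul (hp : 1 < p) (hsol : IsSolutionOn n a p u univ)
    (hb : (n : ℝ) = 2 * b + 4) (x : Pt n) : (annulusCalc n).ev x
      ((annulusCalc n).bilap 0 (2 * (b * (b + 2))) ((b * (b + 2)) ^ 2) (profile hu b) *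
        profile hu b) = Real.exp ((n + a) * (annulusCalc n).τ x) * |u x| ^ (p + 1) := by
  have h : (annulusCalc n).ev x (Lap (Lap (resU hu))) = _ := Lap_Lap_apply hu hsol x
  rw [bilap_profile_symm hu hb, map_mul, map_mul, h, CylCalc.ev_wt, ev_profile,
    ← exp_mul_log_norm, ← abs_rpow_mul_mul_self hp,
    show ((n : ℝ) + a) * (annulusCalc n).τ x = (b + 4) * (annulusCalc n).τ x +
      a * (annulusCalc n).τ x + b * (annulusCalc n).τ x by rw [hb]; ring,
    Real.exp_add, Real.exp_add]
  ring

lemma D_bilap_profile_mul (hp : 1 < p) (hsol : IsSolutionOn n a p u univ)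
    (hb : (n : ℝ) = 2 * b + 4) : (annulusCalc n).D
      ((annulusCalc n).bilap 0 (2 * (b * (b + 2))) ((b * (b + 2)) ^ 2) (profile hu b) *
        profile hu b) =
      (-(b * (p - 1) - (4 + a))) •
        ((annulusCalc n).bilap 0 (2 * (b * (b + 2))) ((b * (b + 2)) ^ 2) (profile hu b) *
          profile hu b) +
      (p + 1) • ((annulusCalc n).bilap 0 (2 * (b * (b + 2))) ((b * (b + 2)) ^ 2) (profile hu b) *
        (annulusCalc n).D (profile hu b)) := by
  obtain ⟨N, hN⟩ : ∃ N, N = (annulusCalc n).bilap 0 (2 * (b * (b + 2))) ((b * (b + 2)) ^ 2)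
    (profile hu b) := ⟨_, rfl⟩
  have hG := ev_bilap_profile_mul hu hp hsol hb
  rw [← hN] at hG ⊢
  have hH : ∀ x : Pt n, ((annulusCalc n).wt (-(n + a)) * (N * profile hu b)).1 x =
      |u x| ^ (p + 1) := fun x => by
    have : ((annulusCalc n).wt (-(n + a)) * (N * profile hu b)).1 x =
      (annulusCalc n).ev x ((annulusCalc n).wt (-(n + a)) * (N * profile hu b)) := rfl
    rw [this, map_mul, hG, CylCalc.ev_wt, ← mul_assoc, ← Real.exp_add, ← add_mul,
      neg_add_cancel, zero_mul, Real.exp_zero, one_mul]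
  have hpd : ∀ i, pd i ((annulusCalc n).wt (-(n + a)) * (N * profile hu b)) =
      (p + 1) • ((annulusCalc n).wt (-a) * Lap (Lap (resU hu)) * pd i (resU hu)) := fun i => by
    refine Subtype.ext <| funext fun x => ?_
    rw [pd_apply_of_eq i (f := fun y => |u y| ^ (p + 1)) hH]
    have h1 : HasFDerivAt (fun y => |u y| ^ (p + 1)) _ (x : EuclideanSpace ℝ (Fin n)) :=
      (hasDerivAt_abs_rpow (u x) (p := p + 1) (by linarith)).comp_hasFDerivAt _
        (hu.differentiable (by simp) x).hasFDerivAt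
    have h2 : ((p + 1) • ((annulusCalc n).wt (-a) * Lap (Lap (resU hu)) * pd i (resU hu))).1 x =
      (p + 1) * ((annulusCalc n).ev x ((annulusCalc n).wt (-a)) * (Lap (Lap (resU hu))).1 x *
        (pd i (resU hu)).1 x) := rfl
    rw [h1.fderiv, h2, pd_apply_of_eq i (f := u) fun _ => rfl, Lap_Lap_apply hu hsol,
      CylCalc.ev_wt, ← exp_mul_log_norm, show p + 1 - 2 = p - 1 by ring]
    have h3 : Real.exp (-a * (annulusCalc n).τ x) * Real.exp (a * (annulusCalc n).τ x) = 1 := by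
      rw [← Real.exp_add, ← add_mul, neg_add_cancel, zero_mul, Real.exp_zero]
    change (p + 1) * |u x| ^ (p - 1) * u x * fderiv ℝ u x (bas i) = _
    linear_combination (-((p + 1) * |u x| ^ (p - 1) * u x * fderiv ℝ u x (bas i))) * h3
  have hDH : (annulusCalc n).D ((annulusCalc n).wt (-(n + a)) * (N * profile hu b)) =
      (p + 1) • ((annulusCalc n).wt (-a) * Lap (Lap (resU hu)) *
        (annulusCalc n).D (resU hu)) := by
    rw [calc_D, calc_D, Finset.mul_sum, Finset.smul_sum]
    refine Finset.sum_congr rfl fun i _ => ?_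
    rw [hpd, mul_smul_comm, mul_left_comm]
  have hDU : (annulusCalc n).wt b * (annulusCalc n).D (resU hu) =
      (-b) • profile hu b + (annulusCalc n).D (profile hu b) := by
    rw [profile, CylCalc.D_wt_mul, mul_add, mul_smul_comm]
    module
  rw [CylCalc.D_wt_mul] at hDH
  have key : (annulusCalc n).wt (n + a) * _ = (annulusCalc n).wt (n + a) * _ := congrArg _ hDH
  have e : (annulusCalc n).wt (n + a) * (annulusCalc n).wt (-(n + a)) = 1 := by
    rw [CylCalc.wt_mul_wt, add_neg_cancel, CylCalc.wt_zero]
  have e' : (annulusCalc n).wt (n + a) * ((annulusCalc n).wt (-a) * Lap (Lap (resU hu)) *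
      (annulusCalc n).D (resU hu)) =
      N * ((annulusCalc n).wt b * (annulusCalc n).D (resU hu)) := by
    rw [hN, bilap_profile_symm hu hb, mul_mul_mul_comm, CylCalc.wt_mul_wt, ← mul_assoc, ← mul_assoc,
      CylCalc.wt_mul_wt, ← mul_assoc, hb]
    ring_nf
  rw [← mul_assoc, e, one_mul, mul_smul_comm, e', hDU, mul_add, mul_smul_comm] at key
  rw [← neg_add_cancel_left ((-(n + a) : ℝ) • (N * profile hu b))
    ((annulusCalc n).D (N * profile hu b)), key, hb]
  module

lemma stability_profile (hp : 1 < p) (hsol : IsSolutionOn n a p u univ) (hn : 0 < n)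
    (hb : (n : ℝ) = 2 * b + 4) {K : Set (EuclideanSpace ℝ (Fin n))}
    (hK : ∀ x ∈ K, ‖x‖ < Real.exp T₀) (hst : StableOn n a p u Kᶜ) {f : ℝ → ℝ}
    (hf : ContDiff ℝ ∞ f) (hc : HasCompactSupport f) (h0 : ∀ t ≤ T₀, f t = 0) :
    p * (annulusCalc n).I ((annulusCalc n).rad f ^ 2 *
      ((annulusCalc n).bilap 0 (2 * (b * (b + 2))) ((b * (b + 2)) ^ 2) (profile hu b) *
        profile hu b)) ≤
      (annulusCalc n).I ((annulusCalc n).quad (b * (b + 2))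
        ((annulusCalc n).rad f * profile hu b)) := by
  have hr : (annulusCalc n).rad f ∈ (annulusCalc n).c := (annulusCalc n).rad_mem hf hc
  have hz : (annulusCalc n).rad f * profile hu b ∈ (annulusCalc n).c :=
    Ideal.mul_mem_right _ _ hr
  have hψ : (annulusCalc n).rad f * resU hu ∈ annular n := Ideal.mul_mem_right _ _ hr
  have hrad : ∀ x : Pt n, ((annulusCalc n).rad f).1 x = f ((annulusCalc n).τ x) :=
    (annulusCalc n).ev_rad hf
  have hrho : ∀ x, (rho n).1 x = Real.exp (-n * (annulusCalc n).τ x) := rho_apply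
  have hsupp : tsupport (zext ((annulusCalc n).rad f * resU hu).1) ⊆ Kᶜ := by
    obtain ⟨r, R, -, hR⟩ := hψ
    refine (tsupport_zext (r := Real.exp T₀) (R := R) fun x hx => ?_).trans
      fun x hx hxK => (hK x hxK).not_ge hx.1
    rcases hx with hx | hx
    · change ((annulusCalc n).rad f).1 x * _ = 0
      have h : (annulusCalc n).τ x ≤ T₀ := (Real.log_le_iff_le_exp (norm_pos_iff.2 x.2)).2 hx.le
      rw [hrad, h0 _ h, zero_mul]
    · exact hR x (Or.inr hx)
  have key := hst _ (contDiff_zext hψ) (hasCompactSupport_zext hψ) hsupp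
  have e1 : (annulusCalc n).I ((annulusCalc n).rad f ^ 2 *
      ((annulusCalc n).bilap 0 (2 * (b * (b + 2))) ((b * (b + 2)) ^ 2) (profile hu b) *
        profile hu b)) =
      ∫ x, ‖x‖ ^ a * |u x| ^ (p - 1) * zext ((annulusCalc n).rad f * resU hu).1 x ^ 2 := by
    rw [calc_I (Ideal.mul_mem_right _ _ (Ideal.pow_mem_of_mem _ hr 2 two_pos))]
    refine integral_congr_ae (zext_ae_eq hn fun x => ?_)
    have e := ev_bilap_profile_mul hu hp hsol hb x
    generalize (annulusCalc n).bilap 0 (2 * (b * (b + 2))) ((b * (b + 2)) ^ 2) (profile hu b) *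
        profile hu b = G at *
    rw [zext_coe, ← exp_mul_log_norm]
    change (rho n).1 x * (((annulusCalc n).rad f).1 x ^ 2 * (annulusCalc n).ev x G) =
      _ * (((annulusCalc n).rad f).1 x * u x) ^ 2
    have e3 : Real.exp (-n * (annulusCalc n).τ x) * Real.exp ((n + a) * (annulusCalc n).τ x) =
        Real.exp (a * (annulusCalc n).τ x) := by
      rw [← Real.exp_add]; ring_nf
    rw [e, hrad, hrho, ← e3, ← abs_rpow_mul_mul_self hp]
    ring
  have e2 : (annulusCalc n).I ((annulusCalc n).quad (b * (b + 2))
        ((annulusCalc n).rad f * profile hu b)) =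
      ∫ x, lap n (zext ((annulusCalc n).rad f * resU hu).1) x ^ 2 := by
    rw [← CylCalc.I_symLap_sq hz]
    have hs : (annulusCalc n).symLap (b * (b + 2)) ((annulusCalc n).rad f * profile hu b) ^ 2 =
        (annulusCalc n).wt n * Lap ((annulusCalc n).rad f * resU hu) ^ 2 := by
      have := CylCalc.eucl_wt_mul_eq_symLap (A := annulusCalc n) b
        ((annulusCalc n).rad f * profile hu b)
      have hU : (annulusCalc n).wt (-b) * ((annulusCalc n).rad f * profile hu b) =
          (annulusCalc n).rad f * resU hu := by
        rw [profile, mul_left_comm, ← mul_assoc ((annulusCalc n).wt (-b)), CylCalc.wt_mul_wt,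
          neg_add_cancel, CylCalc.wt_zero, one_mul]
      rw [hU, show 2 * b + 2 = (n : ℝ) - 2 by rw [hb]; ring, ← Lap_eq] at this
      rw [this, mul_pow, ← mul_assoc, sq ((annulusCalc n).wt _),
        CylCalc.wt_mul_wt, CylCalc.wt_mul_wt, hb, show 2 * b + 4 + (-b - 2 + (-b - 2)) = 0 by ring,
        CylCalc.wt_zero, one_mul]
    have hm : Lap ((annulusCalc n).rad f * resU hu) ∈ (annulusCalc n).c :=
      Ideal.sum_mem _ fun i _ => pd_mem_annular (pd_mem_annular hψ i) i
    rw [hs, calc_I (Ideal.mul_mem_left _ _ (Ideal.pow_mem_of_mem _ hm 2 two_pos))]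
    refine integral_congr_ae (zext_ae_eq hn fun x => ?_)
    have e := Lap_apply_of_eq (g := (annulusCalc n).rad f * resU hu)
      (fun y => (zext_coe _ y).symm) x
    rw [← e]
    change (rho n).1 x * ((annulusCalc n).ev x ((annulusCalc n).wt n) * _ ^ 2) = _
    rw [hrho, CylCalc.ev_wt, ← mul_assoc, ← Real.exp_add, ← add_mul, neg_add_cancel, zero_mul,
      Real.exp_zero, one_mul]
  rw [e1, e2]
  exact key

lemma exists_tot_profile_le (hp : 1 < p) (ha : 0 ≤ a) (hsol : IsSolutionOn n a p u univ)
    (hb : (n : ℝ) = 2 * b + 4) : ∃ C, ∀ x, (annulusCalc n).τ x ≤ 2 →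
      (annulusCalc n).ev x
        ((annulusCalc n).tot 0 (2 * (b * (b + 2))) ((b * (b + 2)) ^ 2) (profile hu b)) ≤
      C * Real.exp ((n - 4) * (annulusCalc n).τ x) := by
  obtain ⟨C₁, h₁⟩ := exists_bound_of_mem_extendable
    (en_mem_extendable (resU_mem_extendable hu)) (Real.exp 2)
  obtain ⟨C₂, h₂⟩ := exists_bound_of_mem_extendable (resU_mem_extendable hu) (Real.exp 2)
  obtain ⟨C₃, h₃⟩ := exists_bound_of_mem_extendable
    (Subalgebra.smul_mem _ (resU_mem_extendable hu) (-1)) (Real.exp 2)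
  refine ⟨3 * (b ^ 4 + 4 * b ^ 2 + 1) * C₁ + Real.exp ((4 + a) * 2) * (max C₂ C₃) ^ (p + 1),
    fun x hx => ?_⟩
  have hx' : ‖(x : EuclideanSpace ℝ (Fin n))‖ ≤ Real.exp 2 :=
    (Real.log_le_iff_le_exp (norm_pos_iff.2 x.2)).1 hx
  have hux : |u x| ≤ max C₂ C₃ := by
    refine abs_le'.2 ⟨(h₂ x hx').trans (le_max_left _ _), le_trans ?_ (le_max_right _ _)⟩
    have : -1 * u x ≤ C₃ := h₃ x hx'
    linarith
  have hen := CylCalc.ev_en_wt_mul_le (A := annulusCalc n) b (resU hu) x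
  have h₁' : (annulusCalc n).ev x ((annulusCalc n).en (resU hu)) ≤ C₁ := h₁ x hx'
  rw [CylCalc.tot, map_add, ev_bilap_profile_mul hu hp hsol hb,
    add_mul (3 * (b ^ 4 + 4 * b ^ 2 + 1) * C₁)]
  refine add_le_add (hen.trans ?_) ?_
  · rw [show ((n : ℝ) - 4) = 2 * b by rw [hb]; ring, mul_comm (Real.exp _), ← mul_assoc]
    gcongr
  · rw [show ((n : ℝ) + a) * (annulusCalc n).τ x =
      (4 + a) * (annulusCalc n).τ x + (n - 4) * (annulusCalc n).τ x by ring, Real.exp_add,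
      mul_right_comm]
    gcongr

end Solution

end Punctured

/-- Theorem 1.2, first part: Liouville theorem for smooth finite Morse
index (i.e. stable outside a compact set) solutions, in the non-critical range. -/
theorem stmt1 (n : ℕ) (hn : 5 ≤ n) (a p : ℝ) (ha : 0 ≤ a) (hp : 1 < p)
    (hpne : p ≠ ((n : ℝ) + 4 + 2 * a) / ((n : ℝ) - 4))
    (hrange : p < ((n : ℝ) + 4 + 2 * a) / ((n : ℝ) - 4) ∨
      (((n : ℝ) + 4 + 2 * a) / ((n : ℝ) - 4) < p ∧
        p * ell1 n a p > (n : ℝ) * ((n : ℝ) - 4) / 2 ∧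
        p * ell2 n a p > (n : ℝ) ^ 2 * ((n : ℝ) - 4) ^ 2 / 16))
    (u : EuclideanSpace ℝ (Fin n) → ℝ) (hu : ContDiff ℝ (⊤ : ℕ∞) u)
    (hsol : IsSolutionOn n a p u Set.univ)
    (hstab : ∃ K : Set (EuclideanSpace ℝ (Fin n)), IsCompact K ∧ StableOn n a p u Kᶜ) :
    ∀ x, u x = 0 := by
  obtain ⟨K, hK, hst⟩ := hstab
  obtain ⟨M, hM⟩ := hK.isBounded.subset_ball 0
  have hn' : (5 : ℝ) ≤ n := by exact_mod_cast hn
  obtain ⟨b, hb⟩ : ∃ b : ℝ, (n : ℝ) = 2 * b + 4 := ⟨((n : ℝ) - 4) / 2, by ring⟩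
  obtain ⟨C, hC⟩ := Punctured.exists_tot_profile_le hu hp ha hsol hb
  have hKT : ∀ x ∈ K, ‖x‖ < Real.exp M := fun x hx =>
    (mem_ball_zero_iff.1 (hM hx)).trans ((lt_add_one M).trans_le (Real.add_one_le_exp M))
  have hc : 0 < b * (b + 2) := mul_pos (by linarith) (by linarith)
  have hpm : 0 < p - 1 := by linarith
  have hnm : (0 : ℝ) < n - 4 := by linarith
  have hG : ∀ x, (Punctured.annulusCalc n).ev x ((Punctured.annulusCalc n).bilap 0
      (2 * (b * (b + 2))) ((b * (b + 2)) ^ 2) (Punctured.profile hu b) *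
        Punctured.profile hu b) = Real.exp (-(b * (p - 1) - (4 + a)) *
        (Punctured.annulusCalc n).τ x) *
        |(Punctured.annulusCalc n).ev x (Punctured.profile hu b)| ^ (p + 1) := fun x => by
    rw [Punctured.ev_bilap_profile_mul hu hp hsol hb, Punctured.ev_profile, abs_mul, Real.abs_exp,
      Real.mul_rpow (Real.exp_pos _).le (abs_nonneg _), ← Real.exp_mul, ← mul_assoc,
      ← Real.exp_add, hb]
    ring_nf
  have hw : Punctured.profile hu b = 0 := by
    have hD := Punctured.D_bilap_profile_mul hu hp hsol hb
    have hS := fun f (hf : ContDiff ℝ ∞ f) (hfc : HasCompactSupport f) hf0 =>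
      Punctured.stability_profile hu hp hsol (by omega) hb hKT hst hf hfc hf0
    have hk : ((n : ℝ) - 4 - 2 * ((4 + a) / (p - 1))) * (p - 1) =
        2 * (b * (p - 1) - (4 + a)) := by
      rw [hb]; field_simp; ring
    rcases hrange with h | ⟨h, h₁, h₂⟩
    · refine CylCalc.eq_zero_of_subcritical hp hc hk ?_ hnm hG hD hS hC
      rw [lt_div_iff₀ hnm] at h
      refine neg_of_mul_neg_left (b := p - 1) ?_ hpm.le
      rw [hk]
      nlinarith
    · refine CylCalc.eq_zero_of_supercritical (l₁ := ell1 n a p) (l₂ := ell2 n a p) hp hc hk ?_ ?_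
        ?_ ?_ hG hD hS hC ?_
      · rw [div_lt_iff₀ hnm] at h
        refine pos_of_mul_pos_left (b := p - 1) ?_ hpm.le
        rw [hk]
        nlinarith
      · have : 0 < (4 + a) / (p - 1) := div_pos (by linarith) hpm
        linarith
      · refine lt_of_eq_of_lt ?_ h₁
        rw [hb]; ring
      · refine lt_of_eq_of_lt ?_ h₂
        rw [hb]; ring
      · rw [Punctured.bilap_profile_symm hu hb, Punctured.profile, ← mul_assoc, ← mul_assoc,
          CylCalc.wt_mul_wt, CylCalc.wt_mul_wt]
        rw [show -(((n : ℝ) - 4 - 2 * ((4 + a) / (p - 1))) / 2) + b = (4 + a) / (p - 1) by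
            rw [hb]; ring,
          show -(((n : ℝ) - 4 - 2 * ((4 + a) / (p - 1))) / 2) + (b + 4) =
            (4 + a) / (p - 1) + 4 by rw [hb]; ring]
        exact Punctured.bilap_profile hu _
  have hz : ∀ x, x ≠ 0 → u x = 0 := fun x hx => by
    have := Punctured.ev_profile hu (b := b) ⟨x, hx⟩
    rw [hw, map_zero] at this
    exact (mul_eq_zero.1 this.symm).resolve_left (Real.exp_pos _).ne'
  have : Nonempty (Fin n) := ⟨⟨0, by omega⟩⟩
  exact congrFun (Continuous.ext_on (dense_compl_singleton 0) hu.continuous continuous_const hz)
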